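/- arXiv:1209.1144 — 2 statements merged into one kernel-verified Lean document; each statement's English description precedes it below -/
import Mathlib

section
/- Let n ≥ 3 and 0 < λ ≤ Λ, set ñ = (λ/Λ)(n−1) + 1, and let p > 1 satisfy p ≤ ñ/(ñ−2) if ñ > 2 (any p > 1 if ñ ≤ 2). Let f : [0,∞) → ℝ be continuous with lim_{t→∞} t^{−p} f(t) = γ for some γ ∈ (0,∞). Then there exists a constant C > 0, depending only on n, f, λ, Λ (and independent of Ω), such that for every open connected set Ω ⊆ ℝⁿ with Ω ≠ ℝⁿ and every positive u ∈ C²(Ω) satisfying M⁺_{λ,Λ}(D²u(x)) + f(u(x)) = 0 for all x ∈ Ω, one has u(x) + |∇u(x)|^{2/(p+1)} ≤ C · (1 + dist(x, ∂Ω)^{−2/(p−1)}) for all x ∈ Ω; in particular, if Ω is the punctured ball B_R \ {0}, then u(x) + |∇u(x)|^{2/(p+1)} ≤ C · (1 + |x|^{−2/(p−1)}) for all 0 < |x| ≤ R/2. -/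
open scoped BigOperators

/-- The Pucci maximal operator `M⁺_{λ,Λ}`: for a symmetric matrix it equals
`Λ · (sum of positive eigenvalues) + λ · (sum of negative eigenvalues)`. -/
noncomputable def pucciMax (lam Lam : ℝ) {n : ℕ} (M : Matrix (Fin n) (Fin n) ℝ) : ℝ :=
  if h : M.IsHermitian then
    ∑ i, (Lam * max (h.eigenvalues i) 0 + lam * min (h.eigenvalues i) 0)
  else 0

/-- The Hessian matrix of `φ` at `x`. -/
noncomputable def hess {n : ℕ} (φ : EuclideanSpace ℝ (Fin n) → ℝ)
    (x : EuclideanSpace ℝ (Fin n)) : Matrix (Fin n) (Fin n) ℝ :=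
  fun i j => iteratedFDeriv ℝ 2 φ x ![EuclideanSpace.single i 1, EuclideanSpace.single j 1]

open Filter Topology Metric Set

/-- `F` is differentiable near `0` and its derivative has derivative `q` at `0`. -/
def HasSecondDerivAtZero (F : ℝ → ℝ) (q : ℝ) : Prop :=
  ∃ g : ℝ → ℝ, (∀ᶠ t in 𝓝 (0 : ℝ), HasDerivAt F (g t) t) ∧ HasDerivAt g q 0

namespace HasSecondDerivAtZero

variable {F G : ℝ → ℝ} {p q : ℝ}

lemma sub (hF : HasSecondDerivAtZero F p) (hG : HasSecondDerivAtZero G q) :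
    HasSecondDerivAtZero (fun t => F t - G t) (p - q) := by
  obtain ⟨f, hf, hf'⟩ := hF
  obtain ⟨g, hg, hg'⟩ := hG
  refine ⟨fun t => f t - g t, ?_, hf'.sub hg'⟩
  filter_upwards [hf, hg] with t h₁ h₂ using h₁.sub h₂

lemma const_mul (c : ℝ) (hF : HasSecondDerivAtZero F p) :
    HasSecondDerivAtZero (fun t => c * F t) (c * p) := by
  obtain ⟨f, hf, hf'⟩ := hF
  refine ⟨fun t => c * f t, ?_, hf'.const_mul c⟩
  filter_upwards [hf] with t h₁ using h₁.const_mul c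

lemma comp_mul (c : ℝ) (hF : HasSecondDerivAtZero F p) :
    HasSecondDerivAtZero (fun t => F (c * t)) (c ^ 2 * p) := by
  obtain ⟨f, hf, hf'⟩ := hF
  have hl : ∀ t : ℝ, HasDerivAt (fun t : ℝ => c * t) c t := fun t => by
    simpa using (hasDerivAt_id t).const_mul c
  refine ⟨fun t => f (c * t) * c, ?_, ?_⟩
  · have ht : Tendsto (fun t : ℝ => c * t) (𝓝 0) (𝓝 0) := by
      simpa using (hl 0).continuousAt.tendsto
    filter_upwards [ht.eventually hf] with t h₁ using h₁.comp t (hl t)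
  · have h₀ : HasDerivAt f p (c * 0) := by simpa using hf'
    exact ((h₀.comp 0 (hl 0)).mul_const c).congr_deriv (by ring)

lemma nonneg_of_isLocalMin (hF : HasSecondDerivAtZero F p) (hmin : IsLocalMin F 0) : 0 ≤ p := by
  obtain ⟨f, hf, hf'⟩ := hF
  have hd : deriv F =ᶠ[𝓝 0] f := by
    filter_upwards [hf] with t ht using ht.deriv
  have hdd : deriv (deriv F) 0 = p := by rw [hd.deriv_eq]; exact hf'.deriv
  by_contra! hp
  have hmax : IsLocalMax F 0 :=
    isLocalMax_of_deriv_deriv_neg (by rw [hdd]; exact hp) hmin.deriv_eq_zero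
      hf.self_of_nhds.continuousAt
  have hc : F =ᶠ[𝓝 0] fun _ => F 0 := by
    filter_upwards [hmax, hmin] with t h₁ h₂ using le_antisymm h₁ h₂
  have h0 : deriv F =ᶠ[𝓝 0] fun _ => 0 := by
    simpa using hc.deriv
  have : deriv (deriv F) 0 = 0 := by rw [h0.deriv_eq]; simp
  linarith

/-- The chain rule for `h ∘ (s + 2 c t + t²)`. -/
lemma comp_quadratic {h h₁ : ℝ → ℝ} {h₂ s : ℝ} (c d : ℝ)
    (hh : ∀ᶠ y in 𝓝 s, HasDerivAt h (h₁ y) y) (hh₁ : HasDerivAt h₁ h₂ s) :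
    HasSecondDerivAtZero (fun t => h (s + c * t + d * t ^ 2)) (c ^ 2 * h₂ + 2 * d * h₁ s) := by
  have hq : ∀ t : ℝ, HasDerivAt (fun t : ℝ => s + c * t + d * t ^ 2) (c + 2 * d * t) t := by
    intro t
    exact ((((hasDerivAt_id t).const_mul c).const_add s).add
      (((hasDerivAt_id t).pow 2).const_mul d)).congr_deriv (by simp; ring)
  have hl : HasDerivAt (fun t : ℝ => c + 2 * d * t) (2 * d) 0 := by
    simpa using ((hasDerivAt_id (0 : ℝ)).const_mul (2 * d)).const_add c
  refine ⟨fun t => h₁ (s + c * t + d * t ^ 2) * (c + 2 * d * t), ?_, ?_⟩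
  · have ht : Tendsto (fun t : ℝ => s + c * t + d * t ^ 2) (𝓝 0) (𝓝 s) := by
      simpa using (hq 0).continuousAt.tendsto
    filter_upwards [ht.eventually hh] with t h' using h'.comp t (hq t)
  · have h₀ : HasDerivAt h₁ h₂ (s + c * 0 + d * 0 ^ 2) := by simpa using hh₁
    exact ((h₀.comp 0 (hq 0)).mul hl).congr_deriv (by simp; ring)

end HasSecondDerivAtZero

section Pucci

variable {n : ℕ}

local notation "E" => EuclideanSpace ℝ (Fin n)

/-- The second order behaviour of `u` at `x` determines the value `P` of the Pucci operator as the
maximum over orthonormal bases `b` and weights `a` in `[lam, Lam]` of `∑ i, a i * ∂²u/∂(b i)²`. -/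
structure PucciValue (lam Lam : ℝ) (u : E → ℝ) (x : E) (P : ℝ) : Prop where
  attained : ∃ (b : OrthonormalBasis (Fin n) ℝ E) (a q : Fin n → ℝ),
    (∀ i, a i ∈ Icc lam Lam) ∧
    (∀ i, HasSecondDerivAtZero (fun t => u (x + t • b i)) (q i)) ∧ P = ∑ i, a i * q i
  le : ∀ (b : OrthonormalBasis (Fin n) ℝ E) (a : Fin n → ℝ), (∀ i, a i ∈ Icc lam Lam) →
    ∃ q : Fin n → ℝ, (∀ i, HasSecondDerivAtZero (fun t => u (x + t • b i)) (q i)) ∧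
      ∑ i, a i * q i ≤ P

lemma hasSecondDerivAtZero_line {u : E → ℝ} {x : E} (hu : ContDiffAt ℝ 2 u x) (v : E) :
    HasSecondDerivAtZero (fun t => u (x + t • v)) (fderiv ℝ (fderiv ℝ u) x v v) := by
  have hl : ∀ t : ℝ, HasDerivAt (fun t : ℝ => x + t • v) v t := fun t => by
    simpa using ((hasDerivAt_id t).smul_const v).const_add x
  have ht : Tendsto (fun t : ℝ => x + t • v) (𝓝 0) (𝓝 x) := by
    simpa using (hl 0).continuousAt.tendsto
  refine ⟨fun t => fderiv ℝ u (x + t • v) v, ?_, ?_⟩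
  · have hev : ∀ᶠ y in 𝓝 x, DifferentiableAt ℝ u y := by
      filter_upwards [hu.eventually (by simp)] with y hy using hy.differentiableAt (by simp)
    filter_upwards [ht.eventually hev] with t h using h.hasFDerivAt.comp_hasDerivAt t (hl t)
  · have hd : DifferentiableAt ℝ (fderiv ℝ u) x :=
      (hu.fderiv_right (m := 1) (by norm_num [one_add_one_eq_two])).differentiableAt (by simp)
    have h₀ : HasFDerivAt (fderiv ℝ u) (fderiv ℝ (fderiv ℝ u) x) (x + (0 : ℝ) • v) := by
      simpa using hd.hasFDerivAt
    have h₁ : HasDerivAt (fun t : ℝ => fderiv ℝ u (x + t • v)) (fderiv ℝ (fderiv ℝ u) x v) 0 :=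
      h₀.comp_hasDerivAt 0 (hl 0)
    exact (ContinuousLinearMap.apply ℝ ℝ v).hasFDerivAt.comp_hasDerivAt 0 h₁

lemma sum_mul_le_sum_max_min {lam Lam : ℝ} (b w : OrthonormalBasis (Fin n) ℝ E) (a e : Fin n → ℝ)
    (ha : ∀ i, a i ∈ Icc lam Lam) :
    ∑ i, a i * ∑ k, e k * (inner ℝ (b i) (w k)) ^ 2 ≤
      ∑ k, (Lam * max (e k) 0 + lam * min (e k) 0) := by
  have hsw : ∑ i, a i * ∑ k, e k * (inner ℝ (b i) (w k)) ^ 2 =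
      ∑ k, e k * ∑ i, a i * (inner ℝ (b i) (w k)) ^ 2 := by
    simp only [Finset.mul_sum]
    rw [Finset.sum_comm]
    exact Finset.sum_congr rfl fun k _ => Finset.sum_congr rfl fun i _ => by ring
  rw [hsw]
  refine Finset.sum_le_sum fun k _ => ?_
  have h1 : ∑ i, (inner ℝ (b i) (w k)) ^ 2 = (1 : ℝ) := by
    have := b.sum_sq_norm_inner_right (w k)
    simpa using this
  have hlo : lam ≤ ∑ i, a i * (inner ℝ (b i) (w k)) ^ 2 := by
    calc lam = ∑ i, lam * (inner ℝ (b i) (w k)) ^ 2 := by rw [← Finset.mul_sum, h1, mul_one]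
      _ ≤ _ := Finset.sum_le_sum fun i _ => mul_le_mul_of_nonneg_right (ha i).1 (sq_nonneg _)
  have hhi : ∑ i, a i * (inner ℝ (b i) (w k)) ^ 2 ≤ Lam := by
    calc _ ≤ ∑ i, Lam * (inner ℝ (b i) (w k)) ^ 2 :=
          Finset.sum_le_sum fun i _ => mul_le_mul_of_nonneg_right (ha i).2 (sq_nonneg _)
      _ = Lam := by rw [← Finset.mul_sum, h1, mul_one]
  rcases le_total 0 (e k) with h | h
  · rw [max_eq_left h, min_eq_right h]
    nlinarith
  · rw [max_eq_right h, min_eq_left h]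
    nlinarith

lemma pucciValue_pucciMax {lam Lam : ℝ} (hLam : lam ≤ Lam) {u : E → ℝ} {x : E}
    (hu : ContDiffAt ℝ 2 u x) : PucciValue lam Lam u x (pucciMax lam Lam (hess u x)) := by
  set B := fderiv ℝ (fderiv ℝ u) x with hB
  have hentry : ∀ i j, hess u x i j = B (EuclideanSpace.single i 1) (EuclideanSpace.single j 1) := by
    intro i j
    simp [hess, iteratedFDeriv_two_apply, hB]
  have hsymm : ∀ v w, B v w = B w v := (hu.isSymmSndFDerivAt (by simp)).eq
  have hH : (hess u x).IsHermitian := by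
    ext i j
    simp [hentry, Matrix.conjTranspose_apply, hsymm]
  set w := hH.eigenvectorBasis with hw
  have hexp : ∀ v : E, v = ∑ i, v i • (EuclideanSpace.single i (1 : ℝ) : E) := by
    intro v
    have := (EuclideanSpace.basisFun (Fin n) ℝ).sum_repr v
    simpa using this.symm
  have hBw : ∀ v k, B v (w k) = hH.eigenvalues k * inner ℝ v (w k) := by
    intro v k
    have hk := hH.mulVec_eigenvectorBasis k
    have h2 : ∀ i, ∑ j, hess u x i j * w k j = hH.eigenvalues k * w k i := fun i => by
      simpa [Matrix.mulVec, dotProduct] using congrFun hk i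
    conv_lhs => rw [hexp v, hexp (w k)]
    simp only [map_sum, map_smul, _root_.sum_apply, _root_.smul_apply,
      smul_eq_mul, ← hentry]
    simp only [PiLp.inner_apply, Finset.mul_sum]
    rw [Finset.sum_comm]
    refine Finset.sum_congr rfl fun i _ => ?_
    simp only [RCLike.inner_apply, conj_trivial]
    calc _ = v i * ∑ j, hess u x i j * w k j := by
          rw [Finset.mul_sum]; exact Finset.sum_congr rfl fun j _ => by ring
      _ = _ := by rw [h2 i]; ring
  have hBv : ∀ v, B v v = ∑ k, hH.eigenvalues k * (inner ℝ v (w k)) ^ 2 := by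
    intro v
    calc B v v = B v (∑ k, inner ℝ (w k) v • w k) := by rw [w.sum_repr']
      _ = ∑ k, inner ℝ (w k) v * (hH.eigenvalues k * inner ℝ v (w k)) := by
          simp only [map_sum, map_smul, smul_eq_mul, hBw]
      _ = _ := Finset.sum_congr rfl fun k _ => by rw [real_inner_comm]; ring
  have hP : pucciMax lam Lam (hess u x) =
      ∑ k, (Lam * max (hH.eigenvalues k) 0 + lam * min (hH.eigenvalues k) 0) := by
    rw [pucciMax, dif_pos hH]
  refine ⟨⟨w, fun k => if 0 ≤ hH.eigenvalues k then Lam else lam, fun k => B (w k) (w k), ?_,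
    fun k => hasSecondDerivAtZero_line hu _, ?_⟩, fun b a ha => ⟨fun i => B (b i) (b i),
    fun i => hasSecondDerivAtZero_line hu _, ?_⟩⟩
  · intro k
    dsimp only
    split_ifs
    exacts [⟨hLam, le_rfl⟩, ⟨le_rfl, hLam⟩]
  · rw [hP]
    refine Finset.sum_congr rfl fun k _ => ?_
    dsimp only
    rw [hBw, real_inner_self_eq_norm_sq, w.norm_eq_one]
    split_ifs with h
    · rw [max_eq_left h, min_eq_right h]; ring
    · rw [max_eq_right (not_le.1 h).le, min_eq_left (not_le.1 h).le]; ring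
  · rw [hP]
    simp only [hBv]
    exact sum_mul_le_sum_max_min b w a _ ha

end Pucci

section Touching

variable {n : ℕ}

local notation "E" => EuclideanSpace ℝ (Fin n)

lemma HasSecondDerivAtZero.quadratic (s c d : ℝ) :
    HasSecondDerivAtZero (fun t => s + c * t + d * t ^ 2) (2 * d) := by
  have := HasSecondDerivAtZero.comp_quadratic (h := id) (h₁ := fun _ => 1) (h₂ := 0) (s := s) c d
    (Eventually.of_forall fun y => hasDerivAt_id y) (hasDerivAt_const s 1)
  simpa using this

lemma tendsto_line (x v : E) : Tendsto (fun t : ℝ => x + t • v) (𝓝 0) (𝓝 x) := by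
  have : ContinuousAt (fun t : ℝ => x + t • v) 0 := by fun_prop
  simpa [ContinuousAt] using this

namespace PucciValue

variable {lam Lam : ℝ} {u : EuclideanSpace ℝ (Fin n) → ℝ} {x : EuclideanSpace ℝ (Fin n)} {P : ℝ}

lemma scale {s c : ℝ} (hc : 0 ≤ c) {y : E} (h : PucciValue lam Lam u (x + s • y) P) :
    PucciValue lam Lam (fun z => c * u (x + s • z)) y (c * s ^ 2 * P) := by
  have key : ∀ (b : E) (q : ℝ), HasSecondDerivAtZero (fun t => u ((x + s • y) + t • b)) q →
      HasSecondDerivAtZero (fun t => c * u (x + s • (y + t • b))) (c * (s ^ 2 * q)) := by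
    intro b q hq
    convert (hq.comp_mul s).const_mul c using 4 with t
    rw [smul_add, smul_smul, add_assoc]
  obtain ⟨⟨b, a, q, ha, hq, hP⟩, hle⟩ := h
  refine ⟨⟨b, a, fun i => c * (s ^ 2 * q i), ha, fun i => key _ _ (hq i), ?_⟩, fun b a ha => ?_⟩
  · rw [hP, Finset.mul_sum]
    exact Finset.sum_congr rfl fun i _ => by ring
  · obtain ⟨q, hq, hle⟩ := hle b a ha
    refine ⟨fun i => c * (s ^ 2 * q i), fun i => key _ _ (hq i), ?_⟩
    calc ∑ i, a i * (c * (s ^ 2 * q i)) = c * s ^ 2 * ∑ i, a i * q i := by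
          rw [Finset.mul_sum]; exact Finset.sum_congr rfl fun i _ => by ring
      _ ≤ _ := mul_le_mul_of_nonneg_left hle (by positivity)

lemma sum_le_of_isLocalMin (hlam : 0 ≤ lam) (h : PucciValue lam Lam u x P) {φ : E → ℝ}
    (hmin : IsLocalMin (fun z => u z - φ z) x) (b : OrthonormalBasis (Fin n) ℝ E)
    {a q : Fin n → ℝ} (ha : ∀ i, a i ∈ Icc lam Lam)
    (hφ : ∀ i, HasSecondDerivAtZero (fun t => φ (x + t • b i)) (q i)) :
    ∑ i, a i * q i ≤ P := by
  obtain ⟨r, hr, hle⟩ := h.le b a ha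
  refine le_trans (Finset.sum_le_sum fun i _ => ?_) hle
  refine mul_le_mul_of_nonneg_left ?_ (hlam.trans (ha i).1)
  have hm : IsLocalMin (fun t : ℝ => u (x + t • b i) - φ (x + t • b i)) 0 := by
    filter_upwards [(tendsto_line x (b i)).eventually hmin] with t ht
    simpa using ht
  have := ((hr i).sub (hφ i)).nonneg_of_isLocalMin hm
  linarith

/-- Touching from below by a paraboloid. -/
lemma le_of_isLocalMin_sub_sq (hlam : 0 ≤ lam) (hLam : lam ≤ Lam) (h : PucciValue lam Lam u x P)
    {η : ℝ} {y : E} (hmin : IsLocalMin (fun z => u z - η * ‖z - y‖ ^ 2) x) :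
    2 * lam * n * η ≤ P := by
  have hφ : ∀ i, HasSecondDerivAtZero
      (fun t => η * ‖x + t • EuclideanSpace.basisFun (Fin n) ℝ i - y‖ ^ 2) (2 * η) := by
    intro i
    convert HasSecondDerivAtZero.quadratic (η * ‖x - y‖ ^ 2)
      (η * (2 * inner ℝ (x - y) (EuclideanSpace.basisFun (Fin n) ℝ i))) η using 2 with t
    rw [add_sub_right_comm, norm_add_sq_real, inner_smul_right, norm_smul,
      (EuclideanSpace.basisFun (Fin n) ℝ).norm_eq_one]
    simp only [Real.norm_eq_abs, mul_one, sq_abs]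
    ring
  have := h.sum_le_of_isLocalMin hlam hmin (EuclideanSpace.basisFun (Fin n) ℝ)
    (a := fun _ => lam) (fun _ => ⟨le_rfl, hLam⟩) hφ
  simp only [Finset.sum_const, Finset.card_univ, Fintype.card_fin, nsmul_eq_mul] at this
  linarith

/-- Touching from below by the radial function `h (‖·‖²)`. -/
lemma le_of_isLocalMin_sub_radial (hlam : 0 ≤ lam) (hLam : lam ≤ Lam)
    (hP : PucciValue lam Lam u x P) (hx : x ≠ 0) {h h₁ : ℝ → ℝ} {h₂ : ℝ}
    (hh : ∀ᶠ s in 𝓝 (‖x‖ ^ 2), HasDerivAt h (h₁ s) s) (hh₁ : HasDerivAt h₁ h₂ (‖x‖ ^ 2))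
    (hmin : IsLocalMin (fun z => u z - h (‖z‖ ^ 2)) x) :
    Lam * (4 * h₂ * ‖x‖ ^ 2 + 2 * h₁ (‖x‖ ^ 2)) + lam * (n - 1) * (2 * h₁ (‖x‖ ^ 2)) ≤ P := by
  have hn : n ≠ 0 := by
    rintro rfl
    exact hx (Subsingleton.elim _ _)
  have hx' : ‖x‖ ≠ 0 := norm_ne_zero_iff.2 hx
  let i₀ : Fin n := ⟨0, Nat.pos_of_ne_zero hn⟩
  have hon : Orthonormal ℝ (({i₀} : Set (Fin n)).domRestrict fun _ => ‖x‖⁻¹ • x) := by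
    constructor
    · rintro ⟨i, hi⟩
      simp [norm_smul, hx']
    · rintro ⟨i, hi⟩ ⟨j, hj⟩ hij
      exact absurd (Subtype.ext ((mem_singleton_iff.1 hi).trans (mem_singleton_iff.1 hj).symm)) hij
  obtain ⟨b, hb⟩ := hon.exists_orthonormalBasis_extension_of_card_eq (by simp)
  have hb₀ : b i₀ = ‖x‖⁻¹ • x := hb i₀ rfl
  have hin₀ : inner ℝ x (b i₀) = ‖x‖ := by
    rw [hb₀, inner_smul_right, real_inner_self_eq_norm_sq]
    field_simp
  have hin : ∀ i, i ≠ i₀ → inner ℝ x (b i) = 0 := by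
    intro i hi
    have h0 : inner ℝ (b i₀) (b i) = 0 := b.orthonormal.2 hi.symm
    rw [hb₀, inner_smul_left] at h0
    simpa [hx'] using h0
  have hφ : ∀ i, HasSecondDerivAtZero (fun t => h (‖x + t • b i‖ ^ 2))
      ((2 * inner ℝ x (b i)) ^ 2 * h₂ + 2 * 1 * h₁ (‖x‖ ^ 2)) := by
    intro i
    convert HasSecondDerivAtZero.comp_quadratic (2 * inner ℝ x (b i)) 1 hh hh₁ using 3 with t
    rw [norm_add_sq_real, inner_smul_right, norm_smul, b.norm_eq_one]
    simp only [Real.norm_eq_abs, mul_one, sq_abs]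
    ring
  have := hP.sum_le_of_isLocalMin hlam hmin b
    (a := fun i => if i = i₀ then Lam else lam)
    (fun i => by split_ifs; exacts [⟨hLam, le_rfl⟩, ⟨le_rfl, hLam⟩]) hφ
  refine le_trans (le_of_eq ?_) this
  rw [← Finset.add_sum_erase _ _ (Finset.mem_univ i₀), Finset.sum_congr rfl (g := fun _ =>
    lam * (2 * h₁ (‖x‖ ^ 2)))]
  · simp only [Finset.sum_const, Finset.card_erase_of_mem (Finset.mem_univ i₀), Finset.card_univ,
      Fintype.card_fin, nsmul_eq_mul, if_true, hin₀]
    rw [Nat.cast_sub (Nat.one_le_iff_ne_zero.2 hn)]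
    push_cast
    ring
  · intro i hi
    rw [hin i (Finset.ne_of_mem_erase hi), if_neg (Finset.ne_of_mem_erase hi)]
    ring

end PucciValue

end Touching

section Lipschitz

variable {n : ℕ}

local notation "E" => EuclideanSpace ℝ (Fin n)

lemma reflection_orthogonal_unit {e : E} (he : ‖e‖ = 1) (v : E) :
    (ℝ ∙ e)ᗮ.reflection v = v - (2 * inner ℝ v e) • e := by
  rw [Submodule.reflection_orthogonal_apply, Submodule.reflection_singleton_apply, he,
    real_inner_comm]
  simp only [RCLike.ofReal_real_eq_id, id_eq, one_pow, div_one]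
  module

/-- The second order condition behind the Ishii–Lions method, along the reflection coupling. -/
lemma PucciValue.sub_le_of_isLocalMax {lam Lam : ℝ} (hlam : 0 ≤ lam)
    {u : E → ℝ} {x y : E} {P Q L k : ℝ} (hL : 0 ≤ L) (hk : 0 ≤ k) (hxy : x ≠ y)
    (hP : PucciValue lam Lam u x P) (hQ : PucciValue lam Lam u y Q)
    (hmax : IsLocalMax (fun z : E × E => u z.1 - u z.2 -
      L * (‖z.1 - z.2‖ - ‖z.1 - z.2‖ ^ 2 / 4) - k * ‖z.1‖ ^ 2) (x, y)) :
    P - Q ≤ 2 * k * n * Lam - 2 * L * lam := by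
  obtain ⟨b, a, q, ha, hq, rfl⟩ := hP.attained
  set r := ‖x - y‖ with hr
  have hr0 : 0 < r := norm_pos_iff.2 (sub_ne_zero.2 hxy)
  set e : E := r⁻¹ • (x - y) with he
  have he1 : ‖e‖ = 1 := by
    rw [he, norm_smul, norm_inv, norm_norm, ← hr]
    field_simp
  have hre : x - y = r • e := by
    rw [he, smul_smul, mul_inv_cancel₀ hr0.ne', one_smul]
  obtain ⟨q', hq', hle⟩ := hQ.le (b.map (ℝ ∙ e)ᗮ.reflection) a ha
  have key : ∀ i, q i - q' i ≤ 2 * k - 2 * L * (inner ℝ e (b i)) ^ 2 := by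
    intro i
    set c := inner ℝ e (b i) with hc
    have hb : (b.map (ℝ ∙ e)ᗮ.reflection) i = b i - (2 * c) • e := by
      rw [OrthonormalBasis.map_apply, reflection_orthogonal_unit he1, hc, real_inner_comm]
    have hq'i := hq' i
    rw [hb] at hq'i
    have hpen := HasSecondDerivAtZero.quadratic (L * (r - r ^ 2 / 4) + k * ‖x‖ ^ 2)
      (L * (2 * c - r * c) + k * (2 * inner ℝ x (b i))) (k - L * c ^ 2)
    have hpos : ∀ᶠ t : ℝ in 𝓝 0, 0 < r + t * (2 * c) := by
      have : ContinuousAt (fun t : ℝ => r + t * (2 * c)) 0 := by fun_prop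
      exact this.eventually (lt_mem_nhds (by simpa using hr0))
    have hline : Tendsto (fun t : ℝ => (x + t • b i, y + t • (b i - (2 * c) • e))) (𝓝 0)
        (𝓝 (x, y)) := (tendsto_line _ _).prodMk_nhds (tendsto_line _ _)
    have hmin : IsLocalMin (fun t : ℝ => L * (r - r ^ 2 / 4) + k * ‖x‖ ^ 2 +
        (L * (2 * c - r * c) + k * (2 * inner ℝ x (b i))) * t + (k - L * c ^ 2) * t ^ 2 -
        (u (x + t • b i) - u (y + t • (b i - (2 * c) • e)))) 0 := by
      filter_upwards [hpos, hline.eventually hmax] with t ht hm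
      have hd : x + t • b i - (y + t • (b i - (2 * c) • e)) = (r + t * (2 * c)) • e := by
        rw [add_smul, ← hre]
        module
      have hx2 : ‖x + t • b i‖ ^ 2 = ‖x‖ ^ 2 + 2 * inner ℝ x (b i) * t + t ^ 2 := by
        rw [norm_add_sq_real, inner_smul_right, norm_smul, b.norm_eq_one]
        simp only [Real.norm_eq_abs, mul_one, sq_abs]
        ring
      simp only [hd, norm_smul, he1, mul_one, Real.norm_eq_abs, abs_of_pos ht, hx2, ← hr] at hm
      simp only [zero_smul, add_zero, mul_zero]
      ring_nf at hm ⊢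
      linarith
    have := (hpen.sub ((hq i).sub hq'i)).nonneg_of_isLocalMin hmin
    linarith
  have hsum : ∑ i, a i * q i - ∑ i, a i * q' i ≤
      ∑ i, (2 * k * Lam - 2 * L * lam * (inner ℝ e (b i)) ^ 2) := by
    rw [← Finset.sum_sub_distrib]
    refine Finset.sum_le_sum fun i _ => ?_
    have h1 := mul_le_mul_of_nonneg_left (key i) (hlam.trans (ha i).1)
    have h2 := mul_le_mul_of_nonneg_left (ha i).2 (mul_nonneg zero_le_two hk)
    have h3 := mul_le_mul_of_nonneg_left (ha i).1
      (mul_nonneg (mul_nonneg zero_le_two hL) (sq_nonneg (inner ℝ e (b i))))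
    linarith
  have h1 : ∑ i, (inner ℝ e (b i)) ^ 2 = (1 : ℝ) := by
    simpa [he1] using b.sum_sq_norm_inner_left e
  simp only [Finset.sum_sub_distrib, Finset.sum_const, Finset.card_univ, Fintype.card_fin,
    nsmul_eq_mul] at hsum
  rw [← Finset.mul_sum, h1] at hsum
  linarith

/-- An interior one-sided Lipschitz estimate for bounded functions with bounded Pucci operator. -/
theorem exists_lipschitz_bound (n : ℕ) {lam Lam B K : ℝ} (hlam : 0 < lam) (hLam : lam ≤ Lam)
    (hB : 0 ≤ B) (hK : 0 ≤ K) :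
    ∃ L : ℝ, 0 < L ∧ ∀ (v P : EuclideanSpace ℝ (Fin n) → ℝ), ContinuousOn v (ball 0 1) →
      (∀ x ∈ ball 0 1, PucciValue lam Lam v x (P x)) → (∀ x ∈ ball 0 1, 0 ≤ v x) →
      (∀ x ∈ ball 0 1, v x ≤ B) → (∀ x ∈ ball 0 1, |P x| ≤ K) →
      ∀ y, ‖y‖ ≤ 3 / 4 → v 0 - L * ‖y‖ ≤ v y := by
  have hLam0 : 0 < Lam := hlam.trans_le hLam
  set k := 16 * B + 1 with hk
  have hk0 : 0 < k := by positivity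
  set L := 8 * B + (k * n * Lam + K) / lam + 1 with hL
  have hL0 : 0 < L := by positivity
  have hLbig : k * n * Lam + K < L * lam := by
    have : (k * n * Lam + K) / lam * lam = k * n * Lam + K := by field_simp
    have : L * lam = 8 * B * lam + (k * n * Lam + K) + lam := by rw [hL]; linarith
    have : 0 ≤ 8 * B * lam := by positivity
    linarith
  have hLB : 8 * B ≤ L := by
    have : 0 ≤ (k * n * Lam + K) / lam := by positivity
    linarith
  refine ⟨L, hL0, fun v P hv hP hv0 hvB hPK y₀ hy₀ => ?_⟩
  by_contra! hlt
  set D : Set (EuclideanSpace ℝ (Fin n)) := closedBall 0 (3 / 4) with hD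
  have hDsub : D ⊆ ball 0 1 := closedBall_subset_ball (by norm_num)
  set Φ : EuclideanSpace ℝ (Fin n) × EuclideanSpace ℝ (Fin n) → ℝ := fun z => v z.1 - v z.2 -
      L * (‖z.1 - z.2‖ - ‖z.1 - z.2‖ ^ 2 / 4) - k * ‖z.1‖ ^ 2 with hΦ
  have hvD : ContinuousOn v D := hv.mono hDsub
  have hΦc : ContinuousOn Φ (D ×ˢ D) := by
    have h1 : ContinuousOn (fun z : EuclideanSpace ℝ (Fin n) × EuclideanSpace ℝ (Fin n) => v z.1)
        (D ×ˢ D) := hvD.comp continuousOn_fst fun z hz => hz.1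
    have h2 : ContinuousOn (fun z : EuclideanSpace ℝ (Fin n) × EuclideanSpace ℝ (Fin n) => v z.2)
        (D ×ˢ D) := hvD.comp continuousOn_snd fun z hz => hz.2
    refine ((h1.sub h2).sub ?_).sub ?_ <;> fun_prop
  have h0D : (0 : EuclideanSpace ℝ (Fin n)) ∈ D := mem_closedBall_self (by norm_num)
  have hy₀D : y₀ ∈ D := by simpa [hD] using hy₀
  obtain ⟨⟨x, y⟩, ⟨hx, hy⟩, hmax⟩ := ((isCompact_closedBall 0 (3 / 4)).prod
    (isCompact_closedBall 0 (3 / 4))).exists_isMaxOn ⟨(0, y₀), h0D, hy₀D⟩ hΦc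
  simp only at hx hy
  have hpos : 0 < Φ (x, y) := by
    refine lt_of_lt_of_le ?_ (hmax (show ((0 : EuclideanSpace ℝ (Fin n)), y₀) ∈ D ×ˢ D from
      ⟨h0D, hy₀D⟩))
    simp only [hΦ, zero_sub, norm_neg, norm_zero]
    have : 0 ≤ L * (‖y₀‖ ^ 2 / 4) := by positivity
    nlinarith
  have hne : x ≠ y := by
    rintro rfl
    simp only [hΦ, sub_self, norm_zero] at hpos
    have : 0 ≤ k * ‖x‖ ^ 2 := by positivity
    linarith
  have hxn : ‖x‖ ≤ 3 / 4 := by simpa [hD] using hx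
  have hyn : ‖y‖ ≤ 3 / 4 := by simpa [hD] using hy
  have hvx := hvB x (hDsub hx)
  have hvy := hv0 y (hDsub hy)
  have hr2 : ‖x - y‖ ≤ 2 := by linarith [norm_sub_le x y]
  have hω : ‖x - y‖ / 2 ≤ ‖x - y‖ - ‖x - y‖ ^ 2 / 4 := by nlinarith [norm_nonneg (x - y)]
  have hω' := mul_le_mul_of_nonneg_left hω hL0.le
  have hkx : 0 ≤ k * ‖x‖ ^ 2 := by positivity
  have hLr : 0 ≤ L * (‖x - y‖ / 2) := by positivity
  simp only [hΦ] at hpos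
  have hx4 : ‖x‖ < 1 / 4 := by
    by_contra! h
    have : k * (1 / 16) ≤ k * ‖x‖ ^ 2 := by gcongr; nlinarith
    linarith
  have hr4 : ‖x - y‖ < 1 / 4 := by
    by_contra! h
    have : L * (1 / 8) ≤ L * (‖x - y‖ / 2) := mul_le_mul_of_nonneg_left (by linarith) hL0.le
    linarith
  have hy2 : ‖y‖ < 1 / 2 := by
    have : y = x - (x - y) := by abel
    have := norm_sub_le x (x - y)
    rw [← ‹y = x - (x - y)›] at this
    linarith
  have hloc : IsLocalMax Φ (x, y) := hmax.isLocalMax (prod_mem_nhds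
    (mem_of_superset (isOpen_ball.mem_nhds (by simpa using hx4 : x ∈ ball 0 (1 / 4)))
      (ball_subset_closedBall.trans (closedBall_subset_closedBall (by norm_num))))
    (mem_of_superset (isOpen_ball.mem_nhds (by simpa using hy2 : y ∈ ball 0 (1 / 2)))
      (ball_subset_closedBall.trans (closedBall_subset_closedBall (by norm_num)))))
  have := (hP x (hDsub hx)).sub_le_of_isLocalMax hlam.le hL0.le hk0.le hne (hP y (hDsub hy)) hloc
  have h1 := abs_le.1 (hPK x (hDsub hx))
  have h2 := abs_le.1 (hPK y (hDsub hy))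
  linarith

end Lipschitz

section Comparison

variable {n : ℕ}

local notation "E" => EuclideanSpace ℝ (Fin n)

lemma radial_le_of_pucciValue_lt {lam Lam : ℝ} (hlam : 0 ≤ lam) (hLam : lam ≤ Lam) {r S : ℝ}
    (hr : 0 < r) {v P : E → ℝ} {h h₁ h₂ : ℝ → ℝ}
    (hv : ContinuousOn v (closedBall 0 S))
    (hP : ∀ x, r < ‖x‖ → ‖x‖ < S → PucciValue lam Lam v x (P x))
    (hh : ∀ s, 0 < s → HasDerivAt h (h₁ s) s) (hh₁ : ∀ s, 0 < s → HasDerivAt h₁ (h₂ s) s)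
    (hlt : ∀ x : E, r < ‖x‖ → ‖x‖ < S → P x < Lam * (4 * h₂ (‖x‖ ^ 2) * ‖x‖ ^ 2 +
      2 * h₁ (‖x‖ ^ 2)) + lam * (n - 1) * (2 * h₁ (‖x‖ ^ 2)))
    (hbr : ∀ x : E, ‖x‖ = r → h (r ^ 2) ≤ v x) (hbS : ∀ x : E, ‖x‖ = S → h (S ^ 2) ≤ v x)
    {x : E} (hrx : r ≤ ‖x‖) (hxS : ‖x‖ ≤ S) : h (‖x‖ ^ 2) ≤ v x := by
  set D : Set E := closedBall 0 S \ ball 0 r with hD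
  have hDmem : ∀ z : E, z ∈ D ↔ r ≤ ‖z‖ ∧ ‖z‖ ≤ S := by
    intro z; simp [hD, and_comm]
  have hDc : IsCompact D := (isCompact_closedBall 0 S).diff isOpen_ball
  have hcont : ContinuousOn (fun z : E => v z - h (‖z‖ ^ 2)) D := by
    refine (hv.mono sdiff_subset).sub fun z hz => ContinuousAt.continuousWithinAt ?_
    have hz0 : 0 < ‖z‖ ^ 2 := pow_pos (hr.trans_le ((hDmem z).1 hz).1) 2
    exact ContinuousAt.comp (f := fun z : E => ‖z‖ ^ 2) (hh _ hz0).continuousAt (by fun_prop)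
  obtain ⟨y, hy, hmin⟩ := hDc.exists_isMinOn ⟨x, (hDmem x).2 ⟨hrx, hxS⟩⟩ hcont
  suffices 0 ≤ v y - h (‖y‖ ^ 2) by
    have : v y - h (‖y‖ ^ 2) ≤ v x - h (‖x‖ ^ 2) := hmin ((hDmem x).2 ⟨hrx, hxS⟩)
    linarith
  obtain ⟨hry, hyS⟩ := (hDmem y).1 hy
  rcases hry.eq_or_lt with heq | hry
  · rw [← heq]; linarith [hbr y heq.symm]
  rcases hyS.eq_or_lt with heq | hyS
  · rw [heq]; linarith [hbS y heq]
  have hy0 : 0 < ‖y‖ := hr.trans hry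
  have hnhds : D ∈ 𝓝 y := by
    have ho : IsOpen {z : E | r < ‖z‖ ∧ ‖z‖ < S} :=
      (isOpen_lt continuous_const continuous_norm).inter (isOpen_lt continuous_norm continuous_const)
    exact mem_of_superset (ho.mem_nhds ⟨hry, hyS⟩) fun z hz => (hDmem z).2 ⟨hz.1.le, hz.2.le⟩
  have hle := (hP y hry hyS).le_of_isLocalMin_sub_radial hlam hLam (norm_pos_iff.1 hy0)
    ((lt_mem_nhds (pow_pos hy0 2)).mono fun s hs => hh s hs) (hh₁ _ (pow_pos hy0 2))
    (hmin.isLocalMin hnhds)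
  exact absurd hle (not_le.2 (hlt y hry hyS))

lemma sq_rpow_neg_half {t : ℝ} (ht : 0 ≤ t) (α : ℝ) : (t ^ 2) ^ (-(α / 2)) = t ^ (-α) := by
  rw [← Real.rpow_natCast, ← Real.rpow_mul ht]
  congr 1
  push_cast
  ring

/-- Comparison with a power of the distance to the origin. -/
lemma power_lower_bound {lam Lam α : ℝ} (hlam : 0 < lam) (hLam : lam ≤ Lam) (hα : 0 < α)
    (hn : 0 < n) (hαn : lam * ((n : ℝ) - 1) ≤ Lam * (α + 1)) {r S ε μ : ℝ} (hr : 0 < r)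
    (hε : 0 < ε) (hμ : 0 ≤ μ) {v P : E → ℝ} (hv : ContinuousOn v (closedBall 0 S))
    (hP : ∀ x, r < ‖x‖ → ‖x‖ < S → PucciValue lam Lam v x (P x))
    (hPε : ∀ x, r < ‖x‖ → ‖x‖ < S → P x ≤ ε) (hv0 : ∀ x : E, ‖x‖ = S → 0 ≤ v x)
    (hvμ : ∀ x : E, ‖x‖ = r → μ ≤ v x) {x : E} (hrx : r ≤ ‖x‖) (hxS : 2 * ‖x‖ ≤ S) :
    μ * r ^ α * (1 - 2 ^ (-α)) * ‖x‖ ^ (-α) - ε / lam * S ^ 2 ≤ v x := by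
  have hx0 : 0 < ‖x‖ := hr.trans_le hrx
  have hS0 : 0 < S := by linarith
  have hrS : r ≤ S := by linarith
  set A := μ * r ^ α with hA
  have hA0 : 0 ≤ A := by positivity
  set η := ε / lam with hη
  have hη0 : 0 < η := by positivity
  set β := α / 2 with hβ
  have hβ0 : 0 < β := by positivity
  have hn1 : (1 : ℝ) ≤ n := by exact_mod_cast hn
  have key := radial_le_of_pucciValue_lt hlam.le hLam hr hv hP
    (h := fun s => A * (s ^ (-β) - S ^ (-α)) + η * (s - S ^ 2))
    (h₁ := fun s => A * (-β * s ^ (-β - 1)) + η)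
    (h₂ := fun s => A * (-β * ((-β - 1) * s ^ (-β - 1 - 1))))
    (fun s hs => (((Real.hasDerivAt_rpow_const (Or.inl hs.ne')).sub_const _).const_mul A).add
      (((hasDerivAt_id s).sub_const _).const_mul η) |>.congr_deriv (by ring))
    (fun s hs => ((((Real.hasDerivAt_rpow_const (Or.inl hs.ne')).const_mul (-β)).const_mul
      A).add_const η))
    ?_ ?_ ?_ hrx (by linarith)
  · simp only [hβ, sq_rpow_neg_half hx0.le] at key
    have h2 : S ^ (-α) ≤ 2 ^ (-α) * ‖x‖ ^ (-α) := by
      rw [← Real.mul_rpow zero_le_two hx0.le]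
      exact Real.rpow_le_rpow_of_nonpos (by positivity) hxS (by linarith)
    have h3 := mul_le_mul_of_nonneg_left h2 hA0
    have h4 : 0 ≤ η * ‖x‖ ^ 2 := by positivity
    linarith
  · intro y hry hyS
    refine (hPε y hry hyS).trans_lt ?_
    have hy0 : 0 < ‖y‖ ^ 2 := pow_pos (hr.trans hry) 2
    set s := ‖y‖ ^ 2
    have hs : s ^ (-β - 1 - 1) * s = s ^ (-β - 1) := by
      rw [Real.rpow_sub_one hy0.ne' (-β - 1)]
      field_simp
    have h1 : 0 ≤ 2 * A * β * s ^ (-β - 1) * (Lam * (α + 1) - lam * (n - 1)) :=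
      mul_nonneg (by positivity) (by linarith)
    have h2 : 2 * A * β * s ^ (-β - 1) * (Lam * (α + 1) - lam * (n - 1)) +
        2 * η * (Lam + lam * (n - 1)) = Lam * (4 * (A * (-β * ((-β - 1) * s ^ (-β - 1 - 1)))) * s +
        2 * (A * (-β * s ^ (-β - 1)) + η)) + lam * (n - 1) * (2 * (A * (-β * s ^ (-β - 1)) + η)) := by
      have hα2 : α = 2 * β := by rw [hβ]; ring
      rw [hα2]
      linear_combination -4 * Lam * A * β * (β + 1) * hs
    rw [← h2]
    have h3 : ε = η * lam := by rw [hη]; field_simp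
    have h4 : 0 ≤ 2 * η * (lam * (n - 1)) := by
      have : 0 ≤ (n : ℝ) - 1 := by linarith
      positivity
    have h5 : η * lam ≤ η * Lam := mul_le_mul_of_nonneg_left hLam hη0.le
    have h6 : 0 < η * lam := by positivity
    linarith
  · intro y hy
    refine le_trans ?_ (hvμ y hy)
    simp only [hβ, sq_rpow_neg_half hr.le]
    have h1 : A * r ^ (-α) = μ := by
      rw [hA, mul_assoc, ← Real.rpow_add hr]; simp
    have h2 : 0 ≤ A * S ^ (-α) := by positivity
    have h3 : η * (r ^ 2 - S ^ 2) ≤ 0 :=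
      mul_nonpos_of_nonneg_of_nonpos hη0.le (by nlinarith)
    linarith
  · intro y hy
    simp only [hβ, sq_rpow_neg_half hS0.le]
    simpa using hv0 y hy

/-- Comparison with a power of the distance to the origin times a logarithm. -/
lemma log_lower_bound {lam Lam α : ℝ} (hlam : 0 < lam) (hLam : lam ≤ Lam)
    (hαn : lam * ((n : ℝ) - 1) = Lam * (α + 1)) {r S A c : ℝ} (hr : 0 < r)
    (hAc : Lam * α * A < c) {v P : E → ℝ} (hv : ContinuousOn v (closedBall 0 S))
    (hP : ∀ x, r < ‖x‖ → ‖x‖ < S → PucciValue lam Lam v x (P x))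
    (hPc : ∀ x, r < ‖x‖ → ‖x‖ < S → P x ≤ -c * ‖x‖ ^ (-(α + 2)))
    (hvr : ∀ x : E, ‖x‖ = r → 0 ≤ v x) (hvS : ∀ x : E, ‖x‖ = S → 0 ≤ v x) (hA : 0 ≤ A)
    {x : E} (hrx : r ≤ ‖x‖) (hxS : ‖x‖ ≤ S) :
    A * (‖x‖ ^ (-α) * Real.log (‖x‖ / r) - S ^ (-α) * Real.log (S / r)) ≤ v x := by
  have hx0 : 0 < ‖x‖ := hr.trans_le hrx
  have hS0 : 0 < S := by linarith
  have hrS : r ≤ S := by linarith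
  set β := α / 2 with hβ
  have hα2 : α = 2 * β := by rw [hβ]; ring
  have hpow : ∀ t : ℝ, 0 < t → (t ^ 2) ^ (-β) = t ^ (-α) := fun t ht => sq_rpow_neg_half ht.le α
  set T := S ^ (-α) * Real.log (S / r) with hT
  have hT0 : 0 ≤ T := mul_nonneg (by positivity) (Real.log_nonneg ((one_le_div hr).2 hrS))
  have hlog : ∀ t : ℝ, 0 < t → Real.log (t ^ 2) / 2 - Real.log r = Real.log (t / r) := by
    intro t ht
    rw [Real.log_pow, Real.log_div ht.ne' hr.ne']
    push_cast
    ring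
  have key := radial_le_of_pucciValue_lt hlam.le hLam hr hv hP
    (h := fun s => A * (s ^ (-β) * (Real.log s / 2 - Real.log r) - T))
    (h₁ := fun s => A * (-β * s ^ (-β - 1) * (Real.log s / 2 - Real.log r) +
      1 / 2 * s ^ (-β - 1)))
    (h₂ := fun s => A * (-β * ((-β - 1) * s ^ (-β - 1 - 1)) * (Real.log s / 2 - Real.log r) +
      -β * s ^ (-β - 1 - 1) / 2 + 1 / 2 * ((-β - 1) * s ^ (-β - 1 - 1))))
    ?_ ?_ ?_ ?_ ?_ hrx hxS
  · simpa only [hpow _ hx0, hlog _ hx0] using key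
  · intro s hs
    refine ((((Real.hasDerivAt_rpow_const (Or.inl hs.ne')).mul
      (((Real.hasDerivAt_log hs.ne').div_const 2).sub_const _)).sub_const T).const_mul
        A).congr_deriv ?_
    rw [Real.rpow_sub_one hs.ne']
    field_simp
  · intro s hs
    refine (((((Real.hasDerivAt_rpow_const (p := -β - 1) (Or.inl hs.ne')).const_mul (-β)).mul
      (((Real.hasDerivAt_log hs.ne').div_const 2).sub_const _)).add
        ((Real.hasDerivAt_rpow_const (p := -β - 1) (Or.inl hs.ne')).const_mul (1 / 2))).const_mul
          A).congr_deriv ?_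
    rw [Real.rpow_sub_one hs.ne' (-β - 1)]
    field_simp
  · intro y hry hyS
    refine (hPc y hry hyS).trans_lt ?_
    have hyn : 0 < ‖y‖ := hr.trans hry
    have hy0 : 0 < ‖y‖ ^ 2 := pow_pos hyn 2
    have hyα : ‖y‖ ^ (-(α + 2)) = (‖y‖ ^ 2) ^ (-β - 1) := by
      rw [← sq_rpow_neg_half hyn.le]
      congr 1
      rw [hβ]; ring
    rw [hyα]
    set s := ‖y‖ ^ 2
    have hs : s ^ (-β - 1 - 1) * s = s ^ (-β - 1) := by
      rw [Real.rpow_sub_one hy0.ne' (-β - 1)]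
      field_simp
    have h2 : -(Lam * α * A) * s ^ (-β - 1) =
        Lam * (4 * (A * (-β * ((-β - 1) * s ^ (-β - 1 - 1)) * (Real.log s / 2 - Real.log r) +
      -β * s ^ (-β - 1 - 1) / 2 + 1 / 2 * ((-β - 1) * s ^ (-β - 1 - 1)))) * s +
      2 * (A * (-β * s ^ (-β - 1) * (Real.log s / 2 - Real.log r) + 1 / 2 * s ^ (-β - 1)))) +
      lam * (n - 1) * (2 * (A * (-β * s ^ (-β - 1) * (Real.log s / 2 - Real.log r) +
        1 / 2 * s ^ (-β - 1)))) := by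
      rw [hαn, hα2]
      linear_combination -4 * Lam * A * (β * (β + 1) * (Real.log s / 2 - Real.log r) - β / 2
        - (β + 1) / 2) * hs
    rw [← h2]
    have : 0 < s ^ (-β - 1) := by positivity
    nlinarith
  · intro y hy
    refine le_trans ?_ (hvr y hy)
    simp only [hlog r hr, div_self hr.ne', Real.log_one, mul_zero, zero_sub]
    nlinarith
  · intro y hy
    refine le_trans (le_of_eq ?_) (hvS y hy)
    simp only [hpow _ hS0, hlog _ hS0, hT, sub_self, mul_zero]

/-- A minimum principle in balls. -/
lemma sub_le_of_le_sphere {lam Lam ρ ε m : ℝ} (hlam : 0 < lam) (hLam : lam ≤ Lam) (hn : 0 < n)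
    (hε : 0 < ε) {v P : E → ℝ}
    (hv : ContinuousOn v (closedBall 0 ρ)) (hP : ∀ x ∈ ball 0 ρ, PucciValue lam Lam v x (P x))
    (hPε : ∀ x ∈ ball 0 ρ, P x ≤ ε) (hm : ∀ x : E, ‖x‖ = ρ → m ≤ v x) {x : E} (hx : ‖x‖ ≤ ρ) :
    m - ε / lam * ρ ^ 2 ≤ v x := by
  set η := ε / lam with hη
  have hη0 : 0 < η := by positivity
  have hcont : ContinuousOn (fun z : E => v z - η * ‖z - 0‖ ^ 2) (closedBall 0 ρ) :=
    hv.sub (by fun_prop)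
  have hxm : x ∈ closedBall 0 ρ := by simpa using hx
  obtain ⟨y, hy, hmin⟩ := (isCompact_closedBall 0 ρ).exists_isMinOn ⟨x, hxm⟩ hcont
  have hyx : v y - η * ‖y - 0‖ ^ 2 ≤ v x - η * ‖x - 0‖ ^ 2 := hmin hxm
  simp only [sub_zero] at hyx
  have hyρ : ‖y‖ ≤ ρ := by simpa using hy
  rcases hyρ.eq_or_lt with heq | hlt
  · rw [heq] at hyx
    have := hm y heq
    have : 0 ≤ η * ‖x‖ ^ 2 := by positivity
    linarith
  · have hyb : y ∈ ball 0 ρ := by simpa using hlt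
    have h1 := (hP y hyb).le_of_isLocalMin_sub_sq hlam.le hLam
      (hmin.isLocalMin (mem_of_superset (isOpen_ball.mem_nhds hyb) ball_subset_closedBall))
    have h2 := hPε y hyb
    have h3 : 2 * lam * n * η = 2 * n * ε := by rw [hη]; field_simp
    have hn1 : (1 : ℝ) ≤ n := by exact_mod_cast hn
    nlinarith

end Comparison

section Liouville

variable {n : ℕ}

local notation "E" => EuclideanSpace ℝ (Fin n)

/-- Positive solutions of `M⁺(D²v) = P ≤ ε - c v ^ p` in the ball of radius `R`. -/
structure ApproxSupersolution (lam Lam c p ε R : ℝ) (v P : E → ℝ) : Prop where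
  cont : ContinuousOn v (ball 0 R)
  pucci : ∀ x ∈ ball 0 R, PucciValue lam Lam v x (P x)
  pos : ∀ x ∈ ball 0 R, 0 < v x
  le : ∀ x ∈ ball 0 R, P x ≤ ε - c * v x ^ p

namespace ApproxSupersolution

lemma le_eps {lam Lam c p ε R : ℝ} {v P : E → ℝ} (hc : 0 ≤ c)
    (h : ApproxSupersolution lam Lam c p ε R v P) {x : E} (hx : x ∈ ball 0 R) : P x ≤ ε := by
  have h1 := h.le x hx
  have h2 := h.pos x hx
  have : 0 ≤ c * v x ^ p := by positivity
  linarith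

lemma power_bound {lam Lam c p ε R α r S μ : ℝ} {v P : E → ℝ}
    (hlam : 0 < lam) (hLam : lam ≤ Lam) (hα : 0 < α) (hn : 0 < n)
    (hαn : lam * ((n : ℝ) - 1) ≤ Lam * (α + 1)) (hc : 0 ≤ c) (hε : 0 < ε)
    (h : ApproxSupersolution lam Lam c p ε R v P) (hr : 0 < r) (hS : S < R) (hμ : 0 ≤ μ)
    (hvμ : ∀ x : E, ‖x‖ = r → μ ≤ v x) {x : E} (hrx : r ≤ ‖x‖) (hxS : 2 * ‖x‖ ≤ S) :
    μ * r ^ α * (1 - 2 ^ (-α)) * ‖x‖ ^ (-α) - ε / lam * S ^ 2 ≤ v x := by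
  have hb : ∀ z : E, ‖z‖ ≤ S → z ∈ ball 0 R := fun z hz => by simpa using hz.trans_lt hS
  exact power_lower_bound hlam hLam hα hn hαn hr hε hμ
    (h.cont.mono fun z hz => hb z (by simpa using hz)) (fun z _ hz => h.pucci z (hb z hz.le))
    (fun z _ hz => h.le_eps hc (hb z hz.le)) (fun z hz => (h.pos z (hb z hz.le)).le) hvμ hrx hxS

lemma one_sub_two_rpow_pos {α : ℝ} (hα : 0 < α) : 0 < 1 - (2 : ℝ) ^ (-α) :=
  sub_pos.2 (Real.rpow_lt_one_of_one_lt_of_neg one_lt_two (neg_lt_zero.2 hα))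

/-- A lower bound for `v` on a ball cannot be too large, by touching with a paraboloid. -/
lemma rpow_mul_sq_le {lam Lam c p ε R α ρ ℓ κ : ℝ} {v P : E → ℝ}
    (hlam : 0 < lam) (hLam : lam ≤ Lam) (hα : 0 < α) (hn : 0 < n)
    (hαn : lam * ((n : ℝ) - 1) ≤ Lam * (α + 1)) (hc : 0 < c) (hp : 1 < p) (hε : 0 < ε)
    (h : ApproxSupersolution lam Lam c p ε R v P) (hρ : 0 < ρ) (hR : 4 * ρ < R) (hℓ : 0 < ℓ)
    (hκ : κ = 2 ^ (-α) * (1 - 2 ^ (-α)) / 2) (hvℓ : ∀ x : E, ‖x‖ ≤ ρ → ℓ ≤ v x)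
    (hε₁ : ε / lam * (4 * ρ) ^ 2 ≤ κ * ℓ) (hε₂ : ε * ρ ^ 2 ≤ 2 * lam * n * ℓ) :
    c * κ ^ p * (ℓ ^ (p - 1) * ρ ^ 2) ≤ 4 * lam * n := by
  have hq := one_sub_two_rpow_pos hα
  have h2α : (0 : ℝ) < 2 ^ (-α) := by positivity
  have hκ0 : 0 < κ := by rw [hκ]; positivity
  have hκ1 : κ ≤ 1 := by rw [hκ]; nlinarith
  have hb : ∀ z : E, ‖z‖ ≤ 4 * ρ → z ∈ ball 0 R := fun z hz => by simpa using hz.trans_lt hR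
  have hcont : ContinuousOn v (closedBall 0 ρ) :=
    h.cont.mono fun z hz => hb z (by linarith [show ‖z‖ ≤ ρ by simpa using hz])
  obtain ⟨y, hy, hmin⟩ := (isCompact_closedBall (0 : E) ρ).exists_isMinOn
    ⟨0, mem_closedBall_self hρ.le⟩ hcont
  have hyρ : ‖y‖ ≤ ρ := by simpa using hy
  set m := v y with hm
  have hℓm : ℓ ≤ m := hvℓ y hyρ
  have hm0 : 0 < m := hℓ.trans_le hℓm
  have hmv : ∀ x : E, ‖x‖ ≤ ρ → m ≤ v x := fun x hx => hmin (by simpa using hx)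
  have hκm : ∀ x : E, ‖x‖ ≤ 2 * ρ → κ * m ≤ v x := by
    intro x hx
    rcases le_total ‖x‖ ρ with hxρ | hxρ
    · exact le_trans (mul_le_of_le_one_left hm0.le hκ1) (hmv x hxρ)
    · have h1 := h.power_bound hlam hLam hα hn hαn hc.le hε hρ hR hm0.le
        (fun z hz => hmv z hz.le) hxρ (by linarith)
      have h2 : (2 * ρ) ^ (-α) ≤ ‖x‖ ^ (-α) :=
        Real.rpow_le_rpow_of_nonpos (hρ.trans_le hxρ) hx (by linarith)
      rw [Real.mul_rpow zero_le_two hρ.le] at h2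
      have h3 : m * ρ ^ α * (1 - 2 ^ (-α)) * (2 ^ (-α) * ρ ^ (-α)) = 2 * (κ * m) := by
        have : ρ ^ α * ρ ^ (-α) = 1 := by rw [← Real.rpow_add hρ]; simp
        rw [hκ]
        linear_combination m * (1 - 2 ^ (-α)) * 2 ^ (-α) * this
      have h4 := mul_le_mul_of_nonneg_left h2
        (show 0 ≤ m * ρ ^ α * (1 - 2 ^ (-α)) by positivity)
      have h5 := mul_le_mul_of_nonneg_left hℓm hκ0.le
      linarith
  have hcont₂ : ContinuousOn (fun z => v z - -(m / ρ ^ 2) * ‖z - y‖ ^ 2) (closedBall y ρ) := by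
    refine ContinuousOn.sub (h.cont.mono fun z hz => hb z ?_) (by fun_prop)
    have h1 : ‖z - y‖ ≤ ρ := by simpa [dist_eq_norm] using hz
    have h2 := norm_add_le (z - y) y
    rw [sub_add_cancel] at h2
    linarith
  obtain ⟨x, hx, hxmin⟩ := (isCompact_closedBall y ρ).exists_isMinOn
    ⟨y, mem_closedBall_self hρ.le⟩ hcont₂
  have hxy : ‖x - y‖ ≤ ρ := by simpa [dist_eq_norm] using hx
  have hx2 : ‖x‖ ≤ 2 * ρ := by
    have h2 := norm_add_le (x - y) y
    rw [sub_add_cancel] at h2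
    linarith
  have hxR : x ∈ ball 0 R := hb x (by linarith)
  have hle : v x - -(m / ρ ^ 2) * ‖x - y‖ ^ 2 ≤ m := by
    simpa using hxmin (mem_closedBall_self hρ.le)
  have hlt : ‖x - y‖ < ρ := by
    refine hxy.lt_of_ne fun heq => ?_
    rw [heq] at hle
    have : m / ρ ^ 2 * ρ ^ 2 = m := by field_simp
    have := h.pos x hxR
    linarith
  have hP := (h.pucci x hxR).le_of_isLocalMin_sub_sq hlam.le hLam (hxmin.isLocalMin
    (mem_of_superset (isOpen_ball.mem_nhds (by simpa [dist_eq_norm] using hlt : x ∈ ball y ρ))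
      ball_subset_closedBall))
  have hPle := h.le x hxR
  have hvp : (κ * m) ^ p ≤ v x ^ p := Real.rpow_le_rpow (by positivity) (hκm x hx2) (by linarith)
  rw [Real.mul_rpow hκ0.le hm0.le] at hvp
  have hvp' := mul_le_mul_of_nonneg_left hvp hc.le
  have hmain : c * (κ ^ p * m ^ p) * ρ ^ 2 ≤ 4 * lam * n * m := by
    have h1 : c * (κ ^ p * m ^ p) ≤ ε + 2 * lam * n * (m / ρ ^ 2) := by linarith
    have h2 := mul_le_mul_of_nonneg_right h1 (sq_nonneg ρ)
    have h3 : (ε + 2 * lam * n * (m / ρ ^ 2)) * ρ ^ 2 = ε * ρ ^ 2 + 2 * lam * n * m := by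
      field_simp
    have h4 : 2 * lam * n * ℓ ≤ 2 * lam * n * m :=
      mul_le_mul_of_nonneg_left hℓm (by positivity)
    linarith
  have hmp : m ^ p = m ^ (p - 1) * m := by
    rw [← Real.rpow_add_one hm0.ne']; ring_nf
  rw [hmp] at hmain
  have hmain' : c * κ ^ p * (m ^ (p - 1) * ρ ^ 2) ≤ 4 * lam * n := by
    refine le_of_mul_le_mul_right ?_ hm0
    linarith
  refine le_trans ?_ hmain'
  have : ℓ ^ (p - 1) ≤ m ^ (p - 1) := Real.rpow_le_rpow hℓ.le hℓm (by linarith)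
  gcongr

end ApproxSupersolution

open ApproxSupersolution

lemma eventually_mul_le (a : ℝ) {b : ℝ} (hb : 0 < b) : ∀ᶠ ε : ℝ in 𝓝[>] 0, ε * a ≤ b := by
  have : Tendsto (fun ε : ℝ => ε * a) (𝓝[>] 0) (𝓝 0) := by
    have : Continuous fun ε : ℝ => ε * a := by fun_prop
    simpa using this.continuousWithinAt (s := Ioi 0) (x := 0) |>.tendsto
  exact this.eventually_le_const hb

lemma exists_forall_not_approxSupersolution_subcritical (hn : 0 < n) {lam Lam c p α r : ℝ}
    (hlam : 0 < lam) (hLam : lam ≤ Lam) (hc : 0 < c) (hp : 1 < p) (hα : 0 < α)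
    (hαn : lam * ((n : ℝ) - 1) ≤ Lam * (α + 1)) (hαp : α * (p - 1) < 2) (hr : 0 < r) (hr1 : r ≤ 1) :
    ∃ R ε : ℝ, 1 ≤ R ∧ 0 < ε ∧ ∀ v P : E → ℝ, ApproxSupersolution lam Lam c p ε R v P →
      ¬ ∀ x : E, ‖x‖ ≤ r → 1 / 2 ≤ v x := by
  have hq := one_sub_two_rpow_pos hα
  set κ : ℝ := 2 ^ (-α) * (1 - 2 ^ (-α)) / 2 with hκ
  have hκ0 : 0 < κ := by positivity
  set c₁ := r ^ α * (1 - 2 ^ (-α)) / 4 with hc₁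
  have hc₁0 : 0 < c₁ := by positivity
  have hc₁1 : c₁ ≤ 1 / 4 := by
    have h1 : r ^ α ≤ 1 := Real.rpow_le_one hr.le hr1 hα.le
    have h2 : (0 : ℝ) < 2 ^ (-α) := by positivity
    have h3 : 0 < r ^ α := by positivity
    rw [hc₁]; nlinarith
  obtain ⟨ρ, hρ1, hρ⟩ : ∃ ρ : ℝ, 1 ≤ ρ ∧
      4 * lam * n < c * κ ^ p * c₁ ^ (p - 1) * ρ ^ (2 - α * (p - 1)) := by
    have := (tendsto_rpow_atTop (sub_pos.2 hαp)).const_mul_atTop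
      (show 0 < c * κ ^ p * c₁ ^ (p - 1) by positivity)
    obtain ⟨ρ, h1, h2⟩ := ((eventually_ge_atTop 1).and (this.eventually_gt_atTop _)).exists
    exact ⟨ρ, h1, h2⟩
  have hρ0 : 0 < ρ := by linarith
  have hn0 : (0 : ℝ) < n := by exact_mod_cast hn
  set ℓ := c₁ * ρ ^ (-α) with hℓ
  have hℓ0 : 0 < ℓ := by positivity
  obtain ⟨ε, ⟨⟨h1, h2⟩, h3⟩, hε⟩ := (((eventually_mul_le ((4 * ρ) ^ 2 / lam)
    (show 0 < κ * ℓ by positivity)).and (eventually_mul_le (ρ ^ 2)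
    (show 0 < 2 * lam * n * ℓ by positivity))).and
    (eventually_mul_le ((2 * ρ) ^ 2 / lam) (show 0 < ℓ by positivity))).and
    self_mem_nhdsWithin |>.exists
  have hε : 0 < ε := hε
  refine ⟨5 * ρ, ε, by linarith, hε, fun v P h hv => ?_⟩
  have hvℓ : ∀ x : E, ‖x‖ ≤ ρ → ℓ ≤ v x := by
    intro x hx
    rcases le_total ‖x‖ r with hxr | hxr
    · refine le_trans ?_ (hv x hxr)
      have : ρ ^ (-α) ≤ 1 := Real.rpow_le_one_of_one_le_of_nonpos hρ1 (by linarith)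
      rw [hℓ]; nlinarith [show 0 < ρ ^ (-α) by positivity]
    · have h4 := h.power_bound hlam hLam hα hn hαn hc.le hε hr (S := 2 * ρ) (by linarith)
        (μ := 1 / 2) (by norm_num) (fun z hz => hv z hz.le) hxr (by linarith)
      have h5 : ρ ^ (-α) ≤ ‖x‖ ^ (-α) :=
        Real.rpow_le_rpow_of_nonpos (hr.trans_le hxr) hx (by linarith)
      have h6 := mul_le_mul_of_nonneg_left h5 hc₁0.le
      have h7 : 1 / 2 * r ^ α * (1 - 2 ^ (-α)) = 2 * c₁ := by rw [hc₁]; ring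
      rw [h7] at h4
      have h8 : ε / lam * (2 * ρ) ^ 2 = ε * ((2 * ρ) ^ 2 / lam) := by ring
      rw [h8] at h4
      linarith
  have := h.rpow_mul_sq_le hlam hLam hα hn hαn hc hp hε hρ0 (by linarith) hℓ0 hκ hvℓ
    (by rw [div_mul_eq_mul_div, ← mul_div_assoc']; exact h1) h2
  have h9 : ℓ ^ (p - 1) * ρ ^ 2 = c₁ ^ (p - 1) * ρ ^ (2 - α * (p - 1)) := by
    rw [hℓ, Real.mul_rpow hc₁0.le (by positivity), ← Real.rpow_mul hρ0.le, mul_assoc,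
      ← Real.rpow_natCast ρ 2, ← Real.rpow_add hρ0]
    congr 2
    push_cast; ring
  rw [h9] at this
  linarith

lemma exists_forall_not_approxSupersolution_critical (hn : 0 < n) {lam Lam c p α r : ℝ}
    (hlam : 0 < lam) (hLam : lam ≤ Lam) (hc : 0 < c) (hp : 1 < p) (hα : 0 < α)
    (hαn : lam * ((n : ℝ) - 1) = Lam * (α + 1)) (hαp : α * (p - 1) = 2) (hr : 0 < r) (hr1 : r ≤ 1) :
    ∃ R ε : ℝ, 1 ≤ R ∧ 0 < ε ∧ ∀ v P : E → ℝ, ApproxSupersolution lam Lam c p ε R v P →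
      ¬ ∀ x : E, ‖x‖ ≤ r → 1 / 2 ≤ v x := by
  have hLam0 : 0 < Lam := hlam.trans_le hLam
  have hq := one_sub_two_rpow_pos hα
  set κ : ℝ := 2 ^ (-α) * (1 - 2 ^ (-α)) / 2 with hκ
  have hκ0 : 0 < κ := by positivity
  set c₁ := r ^ α * (1 - 2 ^ (-α)) / 4 with hc₁
  have hc₁0 : 0 < c₁ := by positivity
  set c₂ := c * c₁ ^ p / 2 with hc₂
  have hc₂0 : 0 < c₂ := by positivity
  set A := c₂ / (2 * Lam * α) with hA
  have hA0 : 0 < A := by positivity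
  have hAc : Lam * α * A < c₂ := by
    have : Lam * α * A = c₂ / 2 := by rw [hA]; field_simp
    linarith
  obtain ⟨τ, hτ4, hτα, hτr, hτ⟩ : ∃ τ : ℝ, 4 ≤ τ ∧ τ ^ (-α) ≤ 1 / 4 ∧ 1 ≤ r * τ ∧
      4 * lam * n < c * κ ^ p * (A / 4) ^ (p - 1) * Real.log τ ^ (p - 1) := by
    have h1 := ((tendsto_rpow_atTop (sub_pos.2 hp)).comp Real.tendsto_log_atTop).const_mul_atTop
      (show 0 < c * κ ^ p * (A / 4) ^ (p - 1) by positivity)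
    have h2 := (tendsto_rpow_neg_atTop hα).eventually_le_const (show (0 : ℝ) < 1 / 4 by norm_num)
    have h3 := (tendsto_id.const_mul_atTop hr).eventually_ge_atTop 1
    obtain ⟨τ, ⟨⟨h4, h5⟩, h6⟩, h7⟩ := (((eventually_ge_atTop 4).and h2).and h3).and
      (h1.eventually_gt_atTop _) |>.exists
    exact ⟨τ, h4, h5, h6, h7⟩
  have hτ0 : 0 < τ := by linarith
  have hlog : 0 < Real.log τ := Real.log_pos (by linarith)
  set ρ := r * τ with hρ
  have hρ0 : 0 < ρ := by positivity
  set S := ρ * τ with hS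
  have hS0 : 0 < S := by positivity
  have hρS : 4 * ρ ≤ S := by rw [hS]; nlinarith
  have hrρ : r ≤ ρ := by rw [hρ]; nlinarith
  have hn0 : (0 : ℝ) < n := by exact_mod_cast hn
  set ℓ := A / 4 * (ρ ^ (-α) * Real.log τ) with hℓ
  have hℓ0 : 0 < ℓ := by positivity
  obtain ⟨ε, ⟨⟨⟨⟨h1, h2⟩, h3⟩, h4⟩, h5⟩, hε⟩ := (((((eventually_mul_le ((4 * ρ) ^ 2 / lam)
    (show 0 < κ * ℓ by positivity)).and (eventually_mul_le (ρ ^ 2)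
    (show 0 < 2 * lam * n * ℓ by positivity))).and
    (eventually_mul_le ((2 * S) ^ 2 / lam) (show 0 < c₁ * S ^ (-α) by positivity))).and
    (eventually_mul_le 1 (show 0 < c₂ * S ^ (-(α + 2)) by positivity))).and
    (eventually_mul_le (ρ ^ 2 / lam) hℓ0)).and
    self_mem_nhdsWithin |>.exists
  have hε : 0 < ε := hε
  refine ⟨3 * S, ε, by linarith, hε, fun v P h hv => ?_⟩
  have hb : ∀ z : E, ‖z‖ ≤ S → z ∈ ball 0 (3 * S) := fun z hz => by
    rw [mem_ball_zero_iff]; linarith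
  have hpow : ∀ x : E, r ≤ ‖x‖ → ‖x‖ ≤ S → c₁ * ‖x‖ ^ (-α) ≤ v x := by
    intro x hxr hx
    have h6 := h.power_bound hlam hLam hα hn hαn.le hc.le hε hr (S := 2 * S) (by linarith)
        (μ := 1 / 2) (by norm_num) (fun z hz => hv z hz.le) hxr (by linarith)
    have h7 : S ^ (-α) ≤ ‖x‖ ^ (-α) :=
      Real.rpow_le_rpow_of_nonpos (hr.trans_le hxr) hx (by linarith)
    have h8 := mul_le_mul_of_nonneg_left h7 hc₁0.le
    have h9 : 1 / 2 * r ^ α * (1 - 2 ^ (-α)) = 2 * c₁ := by rw [hc₁]; ring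
    rw [h9, div_mul_eq_mul_div, ← mul_div_assoc'] at h6
    linarith
  have hPc : ∀ x : E, r < ‖x‖ → ‖x‖ < S → P x ≤ -c₂ * ‖x‖ ^ (-(α + 2)) := by
    intro x hxr hx
    have hx0 : 0 < ‖x‖ := hr.trans hxr
    have h6 := h.le x (hb x hx.le)
    have h7 : (c₁ * ‖x‖ ^ (-α)) ^ p ≤ v x ^ p :=
      Real.rpow_le_rpow (by positivity) (hpow x hxr.le hx.le) (by linarith)
    rw [Real.mul_rpow hc₁0.le (by positivity), ← Real.rpow_mul hx0.le,
      show -α * p = -(α + 2) by linarith] at h7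
    have h8 : S ^ (-(α + 2)) ≤ ‖x‖ ^ (-(α + 2)) :=
      Real.rpow_le_rpow_of_nonpos hx0 hx.le (by linarith)
    have h9 := mul_le_mul_of_nonneg_left h8 hc₂0.le
    have h10 := mul_le_mul_of_nonneg_left h7 hc.le
    have h11 : c * (c₁ ^ p * ‖x‖ ^ (-(α + 2))) = 2 * (c₂ * ‖x‖ ^ (-(α + 2))) := by
      rw [hc₂]; ring
    linarith
  have hsphere : ∀ x : E, ‖x‖ = ρ → 2 * ℓ ≤ v x := by
    intro x hx
    have h6 := log_lower_bound hlam hLam hαn hr hAc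
      (h.cont.mono fun z hz => hb z (by simpa using hz)) (fun z _ hz => h.pucci z (hb z hz.le)) hPc
      (fun z hz => by linarith [hv z hz.le]) (fun z hz => (h.pos z (hb z hz.le)).le) hA0.le
      (x := x) (by linarith) (by linarith)
    have h7 : ρ / r = τ := by rw [hρ]; field_simp
    have h8 : S / r = τ ^ 2 := by rw [hS, hρ]; field_simp
    rw [hx, h7, h8, Real.log_pow, hS, Real.mul_rpow hρ0.le hτ0.le] at h6
    push_cast at h6
    have h9 : 0 < A * (ρ ^ (-α) * Real.log τ) := by positivity
    have h10 := mul_le_mul_of_nonneg_left hτα h9.le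
    rw [hℓ]
    linarith
  have hvℓ : ∀ x : E, ‖x‖ ≤ ρ → ℓ ≤ v x := by
    intro x hx
    have h6 := sub_le_of_le_sphere hlam hLam hn hε
      (h.cont.mono fun z hz => hb z (by linarith [show ‖z‖ ≤ ρ by simpa using hz]))
      (fun z hz => h.pucci z (hb z (by linarith [show ‖z‖ < ρ by simpa using hz])))
      (fun z hz => h.le_eps hc.le (hb z (by linarith [show ‖z‖ < ρ by simpa using hz])))
      hsphere hx
    rw [div_mul_eq_mul_div, ← mul_div_assoc'] at h6
    linarith
  have := h.rpow_mul_sq_le hlam hLam hα hn hαn.le hc hp hε hρ0 (by linarith) hℓ0 hκ hvℓ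
    (by rw [div_mul_eq_mul_div, ← mul_div_assoc']; exact h1) h2
  have h9 : ℓ ^ (p - 1) * ρ ^ 2 = (A / 4) ^ (p - 1) * Real.log τ ^ (p - 1) := by
    rw [hℓ, Real.mul_rpow (by positivity) (by positivity),
      Real.mul_rpow (by positivity) hlog.le, ← Real.rpow_mul hρ0.le,
      show -α * (p - 1) = -2 by linarith, Real.rpow_neg hρ0.le, Real.rpow_two]
    field_simp
  rw [h9] at this
  linarith

/-- A quantitative Liouville theorem. -/
theorem exists_forall_not_approxSupersolution (n : ℕ) (hn : 0 < n) {lam Lam c p B K : ℝ}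
    (hlam : 0 < lam) (hLam : lam ≤ Lam) (hc : 0 < c) (hp : 1 < p) (hB : 0 ≤ B) (hK : 0 ≤ K)
    (hcrit : lam * ((n : ℝ) - 1) ≤ Lam * (2 / (p - 1) + 1)) :
    ∃ R ε : ℝ, 1 ≤ R ∧ 0 < ε ∧ ∀ v P : EuclideanSpace ℝ (Fin n) → ℝ,
      ApproxSupersolution lam Lam c p ε R v P → (∀ x ∈ ball 0 R, v x ≤ B) →
      (∀ x ∈ ball 0 R, |P x| ≤ K) → v 0 ≠ 1 := by
  have hLam0 : 0 < Lam := hlam.trans_le hLam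
  have hp1 : 0 < p - 1 := by linarith
  obtain ⟨L, hL, hlip⟩ := exists_lipschitz_bound n hlam hLam hB hK
  set r := min (1 / 2) (1 / (2 * L)) with hr
  have hr0 : 0 < r := by positivity
  have hr2 : r ≤ 1 / 2 := min_le_left _ _
  have hrL : L * r ≤ 1 / 2 := by
    have h1 := mul_le_mul_of_nonneg_left (min_le_right (1 / 2) (1 / (2 * L))) hL.le
    have h2 : L * (1 / (2 * L)) = 1 / 2 := by field_simp
    linarith
  have key : ∃ R ε : ℝ, 1 ≤ R ∧ 0 < ε ∧ ∀ v P : EuclideanSpace ℝ (Fin n) → ℝ,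
      ApproxSupersolution lam Lam c p ε R v P →
      ¬ ∀ x : EuclideanSpace ℝ (Fin n), ‖x‖ ≤ r → 1 / 2 ≤ v x := by
    rcases hcrit.eq_or_lt with heq | hlt
    · exact exists_forall_not_approxSupersolution_critical hn hlam hLam hc hp
        (show 0 < 2 / (p - 1) by positivity) heq (by field_simp) hr0 (by linarith)
    · have h1 : lam * ((n : ℝ) - 1) / Lam - 1 < 2 / (p - 1) := by
        rw [sub_lt_iff_lt_add, div_lt_iff₀ hLam0]; linarith
      obtain ⟨α, hα1, hα2⟩ := exists_between
        (max_lt h1 (show 0 < 2 / (p - 1) by positivity))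
      have h2 := (le_max_left _ _).trans_lt hα1
      refine exists_forall_not_approxSupersolution_subcritical hn hlam hLam hc hp
        ((le_max_right _ _).trans_lt hα1) ?_ ((lt_div_iff₀ hp1).1 hα2) hr0 (by linarith)
      rw [sub_lt_iff_lt_add, div_lt_iff₀ hLam0] at h2
      linarith
  obtain ⟨R, ε, hR, hε, hno⟩ := key
  refine ⟨R, ε, hR, hε, fun v P h hvB hPK hv0 => hno v P h fun x hx => ?_⟩
  have hsub : ball (0 : EuclideanSpace ℝ (Fin n)) 1 ⊆ ball 0 R := ball_subset_ball hR
  have h1 := hlip v P (h.cont.mono hsub) (fun x hx => h.pucci x (hsub hx))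
    (fun x hx => (h.pos x (hsub hx)).le) (fun x hx => hvB x (hsub hx))
    (fun x hx => hPK x (hsub hx)) x (by linarith)
  have h2 := mul_le_mul_of_nonneg_left hx hL.le
  rw [hv0] at h1
  linarith

end Liouville

/-- Upper and lower bounds for a continuous nonlinearity asymptotic to `γ t ^ p`. -/
lemma exists_growth_bounds {f : ℝ → ℝ} {p γ : ℝ} (hp : 0 < p) (hγ : 0 < γ)
    (hf : ContinuousOn f (Ici 0))
    (hlim : Tendsto (fun t : ℝ => t ^ (-p) * f t) atTop (𝓝 γ)) :
    ∃ C₀, 0 < C₀ ∧ ∀ t, 0 ≤ t → γ / 2 * t ^ p - C₀ ≤ f t ∧ |f t| ≤ C₀ * (1 + t ^ p) := by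
  have hev : ∀ᶠ t in atTop, t ^ (-p) * f t ∈ Ioo (γ / 2) (2 * γ) :=
    hlim.eventually (Ioo_mem_nhds (by linarith) (by linarith))
  obtain ⟨T₀, hT₀⟩ := eventually_atTop.1 hev
  set T := max T₀ 1 with hT
  have hT1 : 1 ≤ T := le_max_right _ _
  obtain ⟨M, hM⟩ := (isCompact_Icc (a := (0 : ℝ)) (b := T)).exists_bound_of_continuousOn
    (hf.mono fun t ht => ht.1)
  have hM0 : 0 ≤ M := (norm_nonneg _).trans (hM 0 ⟨le_rfl, by linarith⟩)
  have hTp : 0 ≤ γ / 2 * T ^ p := by positivity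
  refine ⟨M + γ / 2 * T ^ p + 2 * γ, by positivity, fun t ht => ?_⟩
  have htp : 0 ≤ t ^ p := Real.rpow_nonneg ht p
  rcases le_total t T with htT | htT
  · have h1 : |f t| ≤ M := hM t ⟨ht, htT⟩
    have h2 : γ / 2 * t ^ p ≤ γ / 2 * T ^ p := by gcongr
    refine ⟨by linarith [(abs_le.1 h1).1], ?_⟩
    nlinarith
  · have ht0 : 0 < t := by linarith
    have hpos : 0 < t ^ p := Real.rpow_pos_of_pos ht0 p
    obtain ⟨h1, h2⟩ := hT₀ t ((le_max_left _ _).trans htT)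
    rw [Real.rpow_neg ht, inv_mul_eq_div] at h1 h2
    rw [lt_div_iff₀ hpos] at h1
    rw [div_lt_iff₀ hpos] at h2
    have hft : 0 ≤ f t := le_trans (by positivity) h1.le
    refine ⟨by linarith, ?_⟩
    rw [abs_of_nonneg hft]
    nlinarith

section Solutions

variable {n : ℕ}

local notation "E" => EuclideanSpace ℝ (Fin n)

/-- `u` is a positive classical solution of `M⁺(D²u) + f(u) = 0` in `S`. -/
structure IsPositiveSolution (lam Lam : ℝ) (f : ℝ → ℝ) (u : E → ℝ) (S : Set E) : Prop where
  contDiffOn : ContDiffOn ℝ 2 u S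
  pos : ∀ x ∈ S, 0 < u x
  eq : ∀ x ∈ S, pucciMax lam Lam (hess u x) + f (u x) = 0

namespace IsPositiveSolution

variable {lam Lam : ℝ} {f : ℝ → ℝ} {u : EuclideanSpace ℝ (Fin n) → ℝ}
  {S T : Set (EuclideanSpace ℝ (Fin n))}

lemma mono (h : IsPositiveSolution lam Lam f u S) (hT : T ⊆ S) :
    IsPositiveSolution lam Lam f u T :=
  ⟨h.contDiffOn.mono hT, fun x hx => h.pos x (hT hx), fun x hx => h.eq x (hT hx)⟩

lemma pucciValue (h : IsPositiveSolution lam Lam f u S) (hLam : lam ≤ Lam) (hS : IsOpen S)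
    {x : E} (hx : x ∈ S) : PucciValue lam Lam u x (-f (u x)) := by
  have := pucciValue_pucciMax hLam (h.contDiffOn.contDiffAt (hS.mem_nhds hx))
  rwa [eq_neg_of_add_eq_zero_left (h.eq x hx)] at this

/-- Rescalings of solutions solve the rescaled equation. -/
lemma pucciValue_scale (h : IsPositiveSolution lam Lam f u S) (hLam : lam ≤ Lam) (hS : IsOpen S)
    {c s : ℝ} (hc : 0 ≤ c) {x y : E} (hy : x + s • y ∈ S) :
    PucciValue lam Lam (fun z => c * u (x + s • z)) y (c * s ^ 2 * -f (u (x + s • y))) :=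
  (h.pucciValue hLam hS hy).scale hc

lemma continuousOn_scale (h : IsPositiveSolution lam Lam f u S) (c s : ℝ) {x : E}
    (hT : ∀ y ∈ T, x + s • y ∈ S) : ContinuousOn (fun z => c * u (x + s • z)) T :=
  continuousOn_const.mul (h.contDiffOn.continuousOn.comp (by fun_prop) hT)

/-- A doubling argument and the Liouville theorem bound positive solutions on balls. -/
theorem exists_le_rpow (hn : 0 < n) {lam Lam p c C₀ : ℝ} {f : ℝ → ℝ} (hlam : 0 < lam)
    (hLam : lam ≤ Lam) (hp : 1 < p)
    (hcrit : lam * ((n : ℝ) - 1) ≤ Lam * (2 / (p - 1) + 1)) (hc : 0 < c) (hC₀ : 0 < C₀)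
    (hf : ∀ t, 0 ≤ t → c * t ^ p - C₀ ≤ f t ∧ |f t| ≤ C₀ * (1 + t ^ p)) :
    ∃ C, 0 < C ∧ ∀ (u : E → ℝ) (x : E) (d : ℝ), 0 < d → d ≤ 1 →
      IsPositiveSolution lam Lam f u (ball x d) → u x ≤ C * d ^ (-(2 / (p - 1))) := by
  set q := 2 / (p - 1) with hq
  have hp1 : 0 < p - 1 := by linarith
  have hq0 : 0 < q := by positivity
  have hqp : q * (p - 1) = 2 := by rw [hq]; field_simp
  obtain ⟨R, ε, hR, hε, hL⟩ := exists_forall_not_approxSupersolution n hn hlam hLam hc hp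
    (B := 2 ^ q) (K := C₀ * (1 + (2 ^ q) ^ p)) (by positivity) (by positivity) hcrit
  set A := max ((2 * R) ^ q) (max 1 (C₀ / ε)) with hA
  have hA1 : 1 ≤ A := (le_max_left _ _).trans (le_max_right _ _)
  refine ⟨A * 2 ^ q, by positivity, fun u x d hd hd1 hu => ?_⟩
  by_contra! hlt
  have hbig : A < u x * (d / 2) ^ q := by
    rw [Real.rpow_neg hd.le, ← div_eq_mul_inv, div_lt_iff₀ (by positivity)] at hlt
    rw [Real.div_rpow hd.le (by norm_num), ← mul_div_assoc, lt_div_iff₀ (by positivity)]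
    exact hlt
  have hsub : closedBall x (d / 2) ⊆ ball x d := closedBall_subset_ball (by linarith)
  obtain ⟨x₁, hx₁, hmax⟩ := (isCompact_closedBall x (d / 2)).exists_isMaxOn
    ⟨x, mem_closedBall_self (by positivity)⟩
    (f := fun z => u z * (d / 2 - ‖z - x‖) ^ q)
    ((hu.contDiffOn.continuousOn.mono hsub).mul
      (ContinuousOn.rpow_const (by fun_prop) fun _ _ => Or.inr hq0.le))
  set σ := d / 2 - ‖x₁ - x‖ with hσ
  set U := u x₁ with hU
  have hU0 : 0 < U := hu.pos x₁ (hsub hx₁)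
  have hval : A < U * σ ^ q := by
    have := hmax (mem_closedBall_self (by positivity : 0 ≤ d / 2))
    simp only [mem_ofPred_eq, sub_self, norm_zero, sub_zero] at this
    exact hbig.trans_le this
  have hσ0 : 0 < σ := by
    refine lt_of_le_of_ne (sub_nonneg.2 (mem_closedBall_iff_norm.1 hx₁)) fun h => ?_
    rw [← h, Real.zero_rpow hq0.ne'] at hval
    linarith
  have hσ1 : σ ≤ 1 := by linarith [norm_nonneg (x₁ - x)]
  have hUA : A ≤ U :=
    hval.le.trans (mul_le_of_le_one_right hU0.le (Real.rpow_le_one hσ0.le hσ1 hq0.le))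
  have hU1 : 1 ≤ U := hA1.trans hUA
  set s := U ^ (-(1 / q)) with hs
  have hs0 : 0 < s := by positivity
  have hsq : s ^ q = U⁻¹ := by
    rw [hs, ← Real.rpow_mul hU0.le, ← Real.rpow_neg_one]
    congr 1; field_simp
  have hs2 : U⁻¹ * s ^ 2 = (U ^ p)⁻¹ := by
    have h2 : s ^ 2 = (U⁻¹) ^ (p - 1) := by
      rw [← hsq, ← Real.rpow_mul hs0.le, hqp]; norm_cast
    rw [h2, Real.inv_rpow hU0.le, ← mul_inv, Real.rpow_sub_one hU0.ne']
    field_simp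
  have hRs : R * s ≤ σ / 2 := by
    have h : 2 * R * s ≤ σ := by
      rw [← Real.rpow_le_rpow_iff (by positivity) hσ0.le hq0, Real.mul_rpow (by positivity) hs0.le,
        hsq, ← div_eq_mul_inv, div_le_iff₀ hU0, mul_comm (σ ^ q)]
      exact (le_max_left _ _).trans hval.le
    linarith
  have hball : ∀ y ∈ ball (0 : E) R, x₁ + s • y ∈ ball x₁ (σ / 2) := fun y hy => by
    rw [mem_ball_zero_iff] at hy
    rw [mem_ball_iff_norm, add_sub_cancel_left, norm_smul, Real.norm_of_nonneg hs0.le, mul_comm]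
    exact (mul_lt_mul_of_pos_right hy hs0).trans_le hRs
  have hdist : ∀ z ∈ ball x₁ (σ / 2), σ / 2 ≤ d / 2 - ‖z - x‖ := fun z hz => by
    rw [mem_ball_iff_norm] at hz
    linarith [norm_sub_le_norm_sub_add_norm_sub z x₁ x]
  have hin : ∀ z ∈ ball x₁ (σ / 2), z ∈ closedBall x (d / 2) := fun z hz => by
    rw [mem_closedBall_iff_norm]; linarith [hdist z hz]
  have hbd : ∀ z ∈ ball x₁ (σ / 2), u z ≤ 2 ^ q * U := fun z hz => by
    have h1 : u z * (d / 2 - ‖z - x‖) ^ q ≤ U * σ ^ q := hmax (hin z hz)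
    have h2 : u z * (σ / 2) ^ q ≤ U * σ ^ q := by
      refine le_trans ?_ h1
      have := (hu.pos z (hsub (hin z hz))).le
      gcongr
      exact hdist z hz
    rw [Real.div_rpow hσ0.le (by norm_num), ← mul_div_assoc, div_le_iff₀ (by positivity)] at h2
    have : 0 < σ ^ q := by positivity
    nlinarith
  have hmem : ∀ y ∈ ball (0 : E) R, x₁ + s • y ∈ ball x d := fun y hy =>
    hsub (hin _ (hball y hy))
  have hUp : 0 < U ^ p := by positivity
  have hUp1 : 1 ≤ U ^ p := Real.one_le_rpow hU1 (by linarith)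
  have hv0 : ∀ y ∈ ball (0 : E) R, 0 < U⁻¹ * u (x₁ + s • y) := fun y hy =>
    mul_pos (by positivity) (hu.pos _ (hmem y hy))
  have hvB : ∀ y ∈ ball (0 : E) R, U⁻¹ * u (x₁ + s • y) ≤ 2 ^ q := fun y hy => by
    rw [inv_mul_le_iff₀ hU0, mul_comm]; exact hbd _ (hball y hy)
  have hup : ∀ y ∈ ball (0 : E) R,
      u (x₁ + s • y) ^ p = U ^ p * (U⁻¹ * u (x₁ + s • y)) ^ p := fun y hy => by
    rw [← Real.mul_rpow hU0.le (hv0 y hy).le, mul_inv_cancel_left₀ hU0.ne']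
  have hCε : C₀ ≤ ε * U ^ p := by
    have h1 : C₀ / ε ≤ U := (le_max_right _ _).trans ((le_max_right _ _).trans hUA)
    have h2 : U ≤ U ^ p := Real.self_le_rpow_of_one_le hU1 hp.le
    rw [mul_comm, ← div_le_iff₀ hε]
    exact h1.trans h2
  refine hL (fun y => U⁻¹ * u (x₁ + s • y)) (fun y => U⁻¹ * s ^ 2 * -f (u (x₁ + s • y)))
    ⟨hu.continuousOn_scale _ _ hmem,
      fun y hy => hu.pucciValue_scale hLam isOpen_ball (by positivity) (hmem y hy), hv0,
      fun y hy => ?_⟩ hvB (fun y hy => ?_) ?_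
  · have h1 := (hf _ (hu.pos _ (hmem y hy)).le).1
    rw [hup y hy] at h1
    rw [hs2, inv_mul_le_iff₀ hUp]
    linarith
  · have h1 := (hf _ (hu.pos _ (hmem y hy)).le).2
    rw [hup y hy] at h1
    have h2 : (U⁻¹ * u (x₁ + s • y)) ^ p ≤ (2 ^ q) ^ p :=
      Real.rpow_le_rpow (hv0 y hy).le (hvB y hy) (by linarith)
    rw [hs2, abs_mul, abs_neg, abs_inv, abs_of_pos hUp, inv_mul_le_iff₀ hUp]
    refine h1.trans ?_
    rw [mul_left_comm]
    gcongr
    rw [mul_add, mul_one]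
    gcongr
  · simp [← hU, hU0.ne']

/-- Positive solutions satisfy a scale-invariant gradient bound. -/
theorem exists_norm_gradient_le_rpow {lam Lam p C₀ C₁ : ℝ} {f : ℝ → ℝ} (hlam : 0 < lam)
    (hLam : lam ≤ Lam) (hp : 1 < p) (hC₀ : 0 < C₀) (hC₁ : 0 < C₁)
    (hf : ∀ t, 0 ≤ t → |f t| ≤ C₀ * (1 + t ^ p))
    (hbd : ∀ (u : E → ℝ) (x : E) (d : ℝ), 0 < d → d ≤ 1 →
      IsPositiveSolution lam Lam f u (ball x d) → u x ≤ C₁ * d ^ (-(2 / (p - 1)))) :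
    ∃ C, 0 < C ∧ ∀ (u : E → ℝ) (x : E) (d : ℝ), 0 < d → d ≤ 1 →
      IsPositiveSolution lam Lam f u (ball x d) →
        ‖gradient u x‖ ≤ C * d ^ (-(2 / (p - 1) + 1)) := by
  set q := 2 / (p - 1) with hq
  have hp1 : 0 < p - 1 := by linarith
  have hq0 : 0 < q := by positivity
  have hqp : q * p = q + 2 := by rw [hq]; field_simp; ring
  obtain ⟨L, hL0, hL⟩ := exists_lipschitz_bound n hlam hLam (B := C₁ * 2 ^ q)
    (K := C₀ * (1 + (C₁ * 2 ^ q) ^ p)) (by positivity) (by positivity)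
  refine ⟨2 * L, by positivity, fun u x d hd hd1 hu => ?_⟩
  have hdq : 0 < d ^ q := by positivity
  have hball : ∀ y ∈ ball (0 : E) 1, x + (d / 2) • y ∈ ball x (d / 2) := fun y hy => by
    rw [mem_ball_zero_iff] at hy
    rw [mem_ball_iff_norm, add_sub_cancel_left, norm_smul, Real.norm_of_nonneg (by positivity)]
    exact mul_lt_of_lt_one_right (by positivity) hy
  have hmem : ∀ y ∈ ball (0 : E) 1, x + (d / 2) • y ∈ ball x d := fun y hy =>
    ball_subset_ball (by linarith) (hball y hy)
  have hv0 : ∀ y ∈ ball (0 : E) 1, 0 ≤ d ^ q * u (x + (d / 2) • y) := fun y hy =>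
    mul_nonneg hdq.le (hu.pos _ (hmem y hy)).le
  have hvB : ∀ y ∈ ball (0 : E) 1, d ^ q * u (x + (d / 2) • y) ≤ C₁ * 2 ^ q := fun y hy => by
    have h := hbd u (x + (d / 2) • y) (d / 2) (by positivity) (by linarith)
      (hu.mono (ball_subset_ball' (by linarith [mem_ball.1 (hball y hy)])))
    rw [Real.rpow_neg (by positivity), Real.div_rpow hd.le (by norm_num), inv_div] at h
    calc _ ≤ d ^ q * (C₁ * (2 ^ q / d ^ q)) := by gcongr
      _ = _ := by field_simp
  have hPK : ∀ y ∈ ball (0 : E) 1, |d ^ q * (d / 2) ^ 2 * -f (u (x + (d / 2) • y))| ≤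
      C₀ * (1 + (C₁ * 2 ^ q) ^ p) := fun y hy => by
    have hupos := (hu.pos _ (hmem y hy)).le
    have h1 := hf _ hupos
    have h2 : d ^ (q + 2) * u (x + (d / 2) • y) ^ p ≤ (C₁ * 2 ^ q) ^ p := by
      rw [← hqp, Real.rpow_mul hd.le, ← Real.mul_rpow hdq.le hupos]
      exact Real.rpow_le_rpow (hv0 y hy) (hvB y hy) (by linarith)
    have h3 : d ^ (q + 2) ≤ 1 := Real.rpow_le_one hd.le hd1 (by linarith)
    have h4 : d ^ q * (d / 2) ^ 2 ≤ d ^ (q + 2) := by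
      rw [Real.rpow_add hd, Real.rpow_two]
      gcongr
      linarith
    rw [abs_mul, abs_neg, abs_of_nonneg (by positivity)]
    calc _ ≤ d ^ (q + 2) * (C₀ * (1 + u (x + (d / 2) • y) ^ p)) := by gcongr
      _ = C₀ * (d ^ (q + 2) + d ^ (q + 2) * u (x + (d / 2) • y) ^ p) := by ring
      _ ≤ _ := by gcongr
  have hLip := hL (fun y => d ^ q * u (x + (d / 2) • y))
    (fun y => d ^ q * (d / 2) ^ 2 * -f (u (x + (d / 2) • y)))
    (hu.continuousOn_scale _ _ hmem)
    (fun y hy => hu.pucciValue_scale hLam isOpen_ball hdq.le (hmem y hy)) hv0 hvB hPK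
  set g := gradient u x with hg
  have hdiff : HasGradientAt u g x :=
    ((hu.contDiffOn.contDiffAt (isOpen_ball.mem_nhds (mem_ball_self hd))).differentiableAt
      (by norm_num)).hasGradientAt
  have hline : HasDerivAt (fun t : ℝ => x + (d / 2) • (t • -g)) ((d / 2) • -g) 0 := by
    have := (((hasDerivAt_id (0 : ℝ)).smul_const (-g)).const_smul (d / 2)).const_add x
    simpa using this
  have hder : HasDerivAt (fun t : ℝ => d ^ q * u (x + (d / 2) • (t • -g)))
      (-(d ^ q * (d / 2 * ‖g‖ ^ 2))) 0 := by
    have h := hdiff.hasFDerivAt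
    have h' : HasFDerivAt u (InnerProductSpace.toDual ℝ E g) (x + (d / 2) • ((0 : ℝ) • -g)) := by
      simpa using h
    have := (h'.comp_hasDerivAt (0 : ℝ) hline).const_mul (d ^ q)
    refine this.congr_deriv ?_
    simp [inner_smul_right]
  have hslope := hder.tendsto_slope_zero_right
  have hge : -(L * ‖g‖) ≤ -(d ^ q * (d / 2 * ‖g‖ ^ 2)) := by
    refine ge_of_tendsto hslope ?_
    have hsmall : ∀ᶠ t : ℝ in 𝓝[>] 0, t * ‖g‖ < 3 / 4 := by
      refine nhdsWithin_le_nhds (ContinuousAt.eventually_lt (by fun_prop) continuousAt_const ?_)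
      norm_num
    filter_upwards [hsmall, self_mem_nhdsWithin] with t ht ht0
    rw [mem_Ioi] at ht0
    have hn : ‖t • -g‖ = t * ‖g‖ := by rw [norm_smul, norm_neg, Real.norm_of_nonneg ht0.le]
    have h := hLip (t • -g) (by rw [hn]; exact ht.le)
    rw [hn] at h
    rw [smul_eq_mul, zero_add, zero_smul, ← div_eq_inv_mul, le_div_iff₀ ht0]
    linarith
  rcases (norm_nonneg g).eq_or_lt with h0 | h0
  · rw [← h0]; positivity
  · rw [Real.rpow_neg hd.le, Real.rpow_add hd, Real.rpow_one, ← div_eq_mul_inv,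
      le_div_iff₀ (by positivity)]
    have : (d ^ q * (d / 2) * ‖g‖) * ‖g‖ ≤ L * ‖g‖ := by linarith
    linarith [le_of_mul_le_mul_right this h0]

/-- Interior bound for positive solutions and their gradients on a ball of arbitrary radius. -/
theorem exists_add_norm_gradient_le (hn : 0 < n) {lam Lam p γ : ℝ} {f : ℝ → ℝ} (hlam : 0 < lam)
    (hLam : lam ≤ Lam) (hp : 1 < p)
    (hcrit : lam * ((n : ℝ) - 1) ≤ Lam * (2 / (p - 1) + 1)) (hγ : 0 < γ)
    (hf : ContinuousOn f (Ici 0))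
    (hlim : Tendsto (fun t : ℝ => t ^ (-p) * f t) atTop (𝓝 γ)) :
    ∃ C, 0 < C ∧ ∀ (u : E → ℝ) (x : E) (d : ℝ), 0 < d →
      IsPositiveSolution lam Lam f u (ball x d) →
        u x + ‖gradient u x‖ ^ (2 / (p + 1)) ≤ C * (1 + d ^ (-(2 / (p - 1)))) := by
  obtain ⟨C₀, hC₀, hgr⟩ := exists_growth_bounds (by linarith) hγ hf hlim
  obtain ⟨C₁, hC₁, hu₁⟩ := exists_le_rpow (n := n) hn hlam hLam hp hcrit (by positivity) hC₀ hgr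
  obtain ⟨C₂, hC₂, hu₂⟩ := exists_norm_gradient_le_rpow (n := n) hlam hLam hp hC₀ hC₁
    (fun t ht => (hgr t ht).2) hu₁
  set q := 2 / (p - 1) with hq
  have hp1 : 0 < p - 1 := by linarith
  have hexp : -(q + 1) * (2 / (p + 1)) = -q := by rw [hq]; field_simp; ring
  refine ⟨C₁ + C₂ ^ (2 / (p + 1)), by positivity, fun u x d hd hu => ?_⟩
  have hm : 0 < min d 1 := lt_min hd one_pos
  have hum := hu.mono (ball_subset_ball (min_le_left d 1))
  have h1 := hu₁ u x _ hm (min_le_right _ _) hum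
  have h2 : ‖gradient u x‖ ^ (2 / (p + 1)) ≤ C₂ ^ (2 / (p + 1)) * min d 1 ^ (-q) := by
    rw [← hexp, Real.rpow_mul hm.le, ← Real.mul_rpow hC₂.le (by positivity)]
    exact Real.rpow_le_rpow (norm_nonneg _) (hu₂ u x _ hm (min_le_right _ _) hum) (by positivity)
  have h3 : min d 1 ^ (-q) ≤ 1 + d ^ (-q) := by
    rcases min_choice d 1 with h | h <;> rw [h]
    · linarith
    · rw [Real.one_rpow]; linarith [Real.rpow_nonneg hd.le (-q)]
  calc _ ≤ (C₁ + C₂ ^ (2 / (p + 1))) * min d 1 ^ (-q) := by linarith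
    _ ≤ _ := by gcongr

end IsPositiveSolution

end Solutions

/-- The ball centred in an open set with radius the distance to the frontier lies in the set. -/
lemma IsOpen.ball_infDist_frontier_subset {V : Type*} [NormedAddCommGroup V] [NormedSpace ℝ V]
    {Ω : Set V} (hΩ : IsOpen Ω) {x : V} (hx : x ∈ Ω) :
    ball x (infDist x (frontier Ω)) ⊆ Ω := by
  rcases le_or_gt (infDist x (frontier Ω)) 0 with h | h
  · simp [ball_eq_empty.2 h]
  · refine (convex_ball x _).isPreconnected.subset_left_of_subset_union hΩ
      isClosed_closure.isOpen_compl (disjoint_compl_right_iff_subset.2 subset_closure)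
      (fun z hz => ?_) ⟨x, mem_ball_self h, hx⟩
    by_contra! hz'
    rw [mem_union, not_or, notMem_compl_iff] at hz'
    exact ball_infDist_subset_compl hz (hΩ.frontier_eq ▸ ⟨hz'.2, hz'.1⟩)

open Filter in
theorem stmt8 (n : ℕ) (hn : 3 ≤ n) (lam Lam : ℝ) (hlam : 0 < lam) (hLam : lam ≤ Lam)
    (nt : ℝ) (hnt : nt = lam / Lam * ((n : ℝ) - 1) + 1)
    (p : ℝ) (hp : 1 < p)
    (hcrit : 2 < nt → p ≤ nt / (nt - 2))
    (f : ℝ → ℝ) (hf : ContinuousOn f (Set.Ici 0))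
    (γ : ℝ) (hγ : 0 < γ)
    (hlim : Tendsto (fun t : ℝ => t ^ (-p) * f t) atTop (nhds γ)) :
    ∃ C : ℝ, 0 < C ∧
      ((∀ Ω : Set (EuclideanSpace ℝ (Fin n)), IsOpen Ω → IsConnected Ω → Ω ≠ Set.univ →
        ∀ u : EuclideanSpace ℝ (Fin n) → ℝ, ContDiffOn ℝ 2 u Ω →
          (∀ x ∈ Ω, 0 < u x) →
          (∀ x ∈ Ω, pucciMax lam Lam (hess u x) + f (u x) = 0) →
          ∀ x ∈ Ω, u x + ‖gradient u x‖ ^ (2 / (p + 1)) ≤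
            C * (1 + Metric.infDist x (frontier Ω) ^ (-(2 / (p - 1))))) ∧
      (∀ R : ℝ, 0 < R →
        ∀ u : EuclideanSpace ℝ (Fin n) → ℝ,
          ContDiffOn ℝ 2 u (Metric.ball (0 : EuclideanSpace ℝ (Fin n)) R \ {0}) →
          (∀ x ∈ Metric.ball (0 : EuclideanSpace ℝ (Fin n)) R \ {0}, 0 < u x) →
          (∀ x ∈ Metric.ball (0 : EuclideanSpace ℝ (Fin n)) R \ {0},
            pucciMax lam Lam (hess u x) + f (u x) = 0) →
          ∀ x : EuclideanSpace ℝ (Fin n), 0 < ‖x‖ → ‖x‖ ≤ R / 2 →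
            u x + ‖gradient u x‖ ^ (2 / (p + 1)) ≤ C * (1 + ‖x‖ ^ (-(2 / (p - 1)))))) := by
  have hp1 : 0 < p - 1 := by linarith
  have hLam0 : 0 < Lam := hlam.trans_le hLam
  have hcrit' : lam * ((n : ℝ) - 1) ≤ Lam * (2 / (p - 1) + 1) := by
    have hq : 0 < 2 / (p - 1) := by positivity
    have hnt' : lam * ((n : ℝ) - 1) = Lam * (nt - 1) := by rw [hnt]; field_simp; ring
    rw [hnt']
    refine mul_le_mul_of_nonneg_left ?_ hLam0.le
    rcases le_or_gt nt 2 with h | h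
    · linarith
    · have h2 : 0 < nt - 2 := by linarith
      have h3 := hcrit h
      rw [le_div_iff₀ h2] at h3
      have : nt - 2 ≤ 2 / (p - 1) := by rw [le_div_iff₀ hp1]; linarith
      linarith
  obtain ⟨C, hC, hbd⟩ := IsPositiveSolution.exists_add_norm_gradient_le (n := n) (by omega)
    hlam hLam hp hcrit' hγ hf hlim
  refine ⟨C, hC, fun Ω hΩ hconn hne u hu hpos heq x hx => ?_, fun R hR u hu hpos heq x hx hxR => ?_⟩
  · have hfr : (frontier Ω).Nonempty := nonempty_frontier_iff.2 ⟨⟨x, hx⟩, hne⟩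
    have hd : 0 < infDist x (frontier Ω) :=
      (isClosed_frontier.notMem_iff_infDist_pos hfr).1 fun h => hΩ.inter_frontier_eq.le ⟨hx, h⟩
    exact hbd u x _ hd
      (IsPositiveSolution.mono ⟨hu, hpos, heq⟩ (hΩ.ball_infDist_frontier_subset hx))
  · refine hbd u x _ hx (IsPositiveSolution.mono ⟨hu, hpos, heq⟩ fun z hz => ⟨?_, ?_⟩)
    · rw [mem_ball_iff_norm] at hz
      rw [mem_ball_zero_iff]
      linarith [norm_le_norm_sub_add z x]
    · rintro rfl
      simp at hz
end

section
/- Let n ≥ 2 and 0 < λ ≤ Λ, set ñ = (λ/Λ)(n−1) + 1, and assume ñ ≥ 2 and p, q > 0. Suppose u, v are continuous nonnegative functions on the closed half space such that u is a viscosity supersolution of M⁺_{λ,Λ}(D²u) + v^p = 0 in ℝⁿ₊ and v is a viscosity supersolution of M⁺_{λ,Λ}(D²v) + u^q = 0 in ℝⁿ₊. If either (1) pq > 1 and (2(p+1)/(pq−1) > ñ−1 or 2(q+1)/(pq−1) > ñ−1), or (2) 2(p+1)/(pq−1) = ñ−1 and 2(q+1)/(pq−1) = ñ−1, or (3) pq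 = 1, then u and v are both identically zero. -/
open scoped BigOperators

/-- `u` is a viscosity supersolution of `M⁺_{λ,Λ}(D²u) + g = 0` in `Ω`. -/
def PucciSupersol (lam Lam : ℝ) {n : ℕ} (Ω : Set (EuclideanSpace ℝ (Fin n)))
    (u g : EuclideanSpace ℝ (Fin n) → ℝ) : Prop :=
  ∀ x₀ ∈ Ω, ∀ φ : EuclideanSpace ℝ (Fin n) → ℝ, ContDiff ℝ 2 φ →
    IsLocalMin (fun x => u x - φ x) x₀ → pucciMax lam Lam (hess φ x₀) + g x₀ ≤ 0

section

open Filter Topology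

/-- `pucciMax` dominates every linear operator `tr (A M)` with `A = lam I + (Lam - lam) ξ ξᵀ`. -/
theorem le_pucciMax {n : ℕ} {lam Lam : ℝ} (hLam : lam ≤ Lam)
    {M : Matrix (Fin n) (Fin n) ℝ} (hM : M.IsHermitian) (ξ : EuclideanSpace ℝ (Fin n))
    (hξ : ‖ξ‖ = 1) :
    lam * M.trace + (Lam - lam) * (∑ i, ∑ j, ξ i * ξ j * M i j) ≤ pucciMax lam Lam M := by
  have hquad : ∑ i, ∑ j, ξ i * ξ j * M i j
      = ∑ k, hM.eigenvalues k * (inner ℝ (hM.eigenvectorBasis k) ξ) ^ 2 := by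
    have h1 : ∑ i, ∑ j, ξ i * ξ j * M i j = inner ℝ ξ (Matrix.toEuclideanLin M ξ) := by
      simp only [PiLp.inner_apply, Matrix.toLpLin_apply, Matrix.mulVec, dotProduct,
        RCLike.inner_apply, conj_trivial, Finset.sum_mul]
      refine Finset.sum_congr rfl fun i _ => Finset.sum_congr rfl fun j _ => ?_
      ring
    have hsymm : (Matrix.toEuclideanLin M).IsSymmetric :=
      Matrix.isSymmetric_toEuclideanLin_iff.2 hM
    rw [h1, ← hM.eigenvectorBasis.sum_inner_mul_inner]
    refine Finset.sum_congr rfl fun k _ => ?_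
    have h2 : Matrix.toEuclideanLin M (hM.eigenvectorBasis k)
        = hM.eigenvalues k • hM.eigenvectorBasis k := by
      ext i
      have := congrFun (hM.mulVec_eigenvectorBasis k) i
      simpa [Matrix.toLpLin_apply] using this
    rw [← hsymm, h2, inner_smul_left, real_inner_comm]
    simp
    ring
  have hone : ∑ k, (inner ℝ (hM.eigenvectorBasis k) ξ) ^ 2 = 1 := by
    have := hM.eigenvectorBasis.sum_sq_norm_inner_right ξ
    simpa [hξ] using this
  have htr : M.trace = ∑ k, hM.eigenvalues k := by
    simpa using hM.trace_eq_sum_eigenvalues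
  rw [pucciMax, dif_pos hM, hquad, htr, Finset.mul_sum, Finset.mul_sum, ← Finset.sum_add_distrib]
  refine Finset.sum_le_sum fun k _ => ?_
  have hc1 : (inner ℝ (hM.eigenvectorBasis k) ξ) ^ 2 ≤ 1 := by
    rw [← hone]
    exact Finset.single_le_sum (f := fun k => (inner ℝ (hM.eigenvectorBasis k) ξ) ^ 2)
      (fun i _ => sq_nonneg _) (Finset.mem_univ k)
  set c := (inner ℝ (hM.eigenvectorBasis k) ξ) ^ 2
  have hc0 : 0 ≤ c := sq_nonneg _
  have hd : 0 ≤ Lam - lam := sub_nonneg.2 hLam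
  rcases le_total 0 (hM.eigenvalues k) with h | h
  · rw [max_eq_left h, min_eq_right h]
    nlinarith [mul_nonneg (mul_nonneg hd h) (sub_nonneg.2 hc1)]
  · rw [max_eq_right h, min_eq_left h]
    nlinarith [mul_nonneg (mul_nonneg hd hc0) (neg_nonneg.2 h)]

/-- `φ` is `C²` at `x` and `Q` is the quadratic form of its second derivative there. -/
def HasHessianForm {n : ℕ} (φ : EuclideanSpace ℝ (Fin n) → ℝ) (x : EuclideanSpace ℝ (Fin n))
    (Q : EuclideanSpace ℝ (Fin n) → ℝ) : Prop :=
  ContDiffAt ℝ 2 φ x ∧ ∀ ξ, fderiv ℝ (fderiv ℝ φ) x ξ ξ = Q ξ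

theorem hess_apply {n : ℕ} (φ : EuclideanSpace ℝ (Fin n) → ℝ) (x : EuclideanSpace ℝ (Fin n))
    (i j : Fin n) :
    hess φ x i j = fderiv ℝ (fderiv ℝ φ) x (EuclideanSpace.single i 1)
      (EuclideanSpace.single j 1) := by
  simp [hess, iteratedFDeriv_two_apply]

theorem hess_isHermitian {n : ℕ} {φ : EuclideanSpace ℝ (Fin n) → ℝ}
    {x : EuclideanSpace ℝ (Fin n)} (h : ContDiffAt ℝ 2 φ x) : (hess φ x).IsHermitian := by
  ext i j
  rw [Matrix.conjTranspose_apply, star_trivial, hess_apply, hess_apply]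
  exact (h.isSymmSndFDerivAt (by simp)) _ _

theorem HasHessianForm.le_pucciMax {n : ℕ} {lam Lam : ℝ} (hLam : lam ≤ Lam)
    {φ : EuclideanSpace ℝ (Fin n) → ℝ} {x : EuclideanSpace ℝ (Fin n)}
    {Q : EuclideanSpace ℝ (Fin n) → ℝ} (h : HasHessianForm φ x Q)
    (ξ : EuclideanSpace ℝ (Fin n)) (hξ : ‖ξ‖ = 1) :
    lam * ∑ i, Q (EuclideanSpace.single i 1) + (Lam - lam) * Q ξ
      ≤ pucciMax lam Lam (hess φ x) := by
  have key := _root_.le_pucciMax hLam (hess_isHermitian h.1) ξ hξ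
  have htr : (hess φ x).trace = ∑ i, Q (EuclideanSpace.single i 1) :=
    Finset.sum_congr rfl fun i _ => by rw [Matrix.diag_apply, hess_apply, h.2]
  have hQ : ∑ i, ∑ j, ξ i * ξ j * hess φ x i j = Q ξ := by
    have hsum : ξ = ∑ i, ξ i • EuclideanSpace.single i (1 : ℝ) := by
      have := (EuclideanSpace.basisFun (Fin n) ℝ).sum_repr ξ
      simpa using this.symm
    rw [← h.2]
    conv_rhs => rw [hsum]
    simp only [map_sum, map_smul, sum_apply, smul_apply,
      smul_eq_mul, hess_apply, Finset.mul_sum]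
    rw [Finset.sum_comm]
    refine Finset.sum_congr rfl fun i _ => Finset.sum_congr rfl fun j _ => ?_
    ring
  rwa [htr, hQ] at key

theorem HasHessianForm.add {n : ℕ} {φ ψ : EuclideanSpace ℝ (Fin n) → ℝ}
    {x : EuclideanSpace ℝ (Fin n)} {Q S : EuclideanSpace ℝ (Fin n) → ℝ}
    (hφ : HasHessianForm φ x Q) (hψ : HasHessianForm ψ x S) :
    HasHessianForm (fun z => φ z + ψ z) x (fun ξ => Q ξ + S ξ) := by
  refine ⟨hφ.1.add hψ.1, fun ξ => ?_⟩
  have h := iteratedFDeriv_add_apply (i := 2) hφ.1 hψ.1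
  have := congrArg (fun T => T ![ξ, ξ]) h
  simp only [add_apply, iteratedFDeriv_two_apply] at this
  simp only [Matrix.cons_val_zero, Matrix.cons_val_one] at this
  rw [hφ.2, hψ.2] at this
  exact this

theorem HasHessianForm.const_mul {n : ℕ} {φ : EuclideanSpace ℝ (Fin n) → ℝ}
    {x : EuclideanSpace ℝ (Fin n)} {Q : EuclideanSpace ℝ (Fin n) → ℝ}
    (hφ : HasHessianForm φ x Q) (c : ℝ) :
    HasHessianForm (fun z => c * φ z) x (fun ξ => c * Q ξ) := by
  refine ⟨contDiffAt_const.mul hφ.1, fun ξ => ?_⟩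
  have h := iteratedFDeriv_const_smul_apply (i := 2) (a := c) hφ.1
  have := congrArg (fun T => T ![ξ, ξ]) h
  simp only [smul_apply, iteratedFDeriv_two_apply] at this
  simp only [Matrix.cons_val_zero, Matrix.cons_val_one, hφ.2, smul_eq_mul] at this
  exact this

theorem hasHessianForm_const {n : ℕ} (x : EuclideanSpace ℝ (Fin n)) (c : ℝ) :
    HasHessianForm (fun _ => c) x (fun _ => 0) :=
  ⟨contDiffAt_const, fun ξ => by simp⟩

theorem HasHessianForm.sub_const {n : ℕ} {φ : EuclideanSpace ℝ (Fin n) → ℝ}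
    {x : EuclideanSpace ℝ (Fin n)} {Q : EuclideanSpace ℝ (Fin n) → ℝ}
    (hφ : HasHessianForm φ x Q) (c : ℝ) :
    HasHessianForm (fun z => φ z - c) x Q := by
  simpa [sub_eq_add_neg] using hφ.add (hasHessianForm_const x (-c))

theorem fderiv_fderiv_eq_of_line {n : ℕ} {φ : EuclideanSpace ℝ (Fin n) → ℝ}
    {x ξ : EuclideanSpace ℝ (Fin n)} (hφ : ContDiffAt ℝ 2 φ x) {g : ℝ → ℝ} {c : ℝ}
    (hg : ∀ᶠ t in 𝓝 (0 : ℝ), HasDerivAt (fun t => φ (x + t • ξ)) (g t) t)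
    (hc : HasDerivAt g c 0) : fderiv ℝ (fderiv ℝ φ) x ξ ξ = c := by
  have hline : ∀ t : ℝ, HasDerivAt (fun t : ℝ => x + t • ξ) ξ t := fun t => by
    simpa using ((hasDerivAt_id t).smul_const ξ).const_add x
  have hev : ∀ᶠ z in 𝓝 x, DifferentiableAt ℝ φ z := by
    filter_upwards [hφ.eventually (by simp)] with z hz
    exact hz.differentiableAt (by simp)
  have hcont : Tendsto (fun t : ℝ => x + t • ξ) (𝓝 0) (𝓝 x) := by
    have := (hline 0).continuousAt.tendsto
    simpa using this
  have heq : g =ᶠ[𝓝 0] fun t => fderiv ℝ φ (x + t • ξ) ξ := by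
    filter_upwards [hg, hcont.eventually hev] with t h1 h2
    exact h1.unique (h2.hasFDerivAt.comp_hasDerivAt t (hline t))
  have hd : DifferentiableAt ℝ (fderiv ℝ φ) x :=
    (hφ.fderiv_right (m := 1) (by norm_num)).differentiableAt (by simp)
  have hF : HasFDerivAt (fun z => fderiv ℝ φ z ξ)
      ((ContinuousLinearMap.apply ℝ ℝ ξ).comp (fderiv ℝ (fderiv ℝ φ) x)) (x + (0 : ℝ) • ξ) := by
    rw [zero_smul, add_zero]
    exact (ContinuousLinearMap.apply ℝ ℝ ξ).hasFDerivAt.comp x hd.hasFDerivAt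
  have hcomp : HasDerivAt (fun t : ℝ => fderiv ℝ φ (x + t • ξ) ξ)
      (fderiv ℝ (fderiv ℝ φ) x ξ ξ) 0 :=
    (HasFDerivAt.comp_hasDerivAt (f := fun t : ℝ => x + t • ξ) (0 : ℝ) hF (hline 0) :)
  exact hcomp.unique (hc.congr_of_eventuallyEq heq.symm)

/-- The second derivative of `z ↦ P (z N - y N) * h (‖z - y‖ ^ 2)`. -/
theorem hasHessianForm_mul {n : ℕ} {N : Fin n} {x y : EuclideanSpace ℝ (Fin n)}
    {P P' h h' : ℝ → ℝ} {p₂ h₂ : ℝ} (hPc : ContDiffAt ℝ 2 P (x N - y N))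
    (hhc : ContDiffAt ℝ 2 h (‖x - y‖ ^ 2))
    (hP : ∀ᶠ a in 𝓝 (x N - y N), HasDerivAt P (P' a) a)
    (hP' : HasDerivAt P' p₂ (x N - y N))
    (hh : ∀ᶠ t in 𝓝 (‖x - y‖ ^ 2), HasDerivAt h (h' t) t)
    (hh' : HasDerivAt h' h₂ (‖x - y‖ ^ 2)) :
    HasHessianForm (fun z => P (z N - y N) * h (‖z - y‖ ^ 2)) x
      (fun ξ => p₂ * ξ N ^ 2 * h (‖x - y‖ ^ 2)
        + 4 * P' (x N - y N) * h' (‖x - y‖ ^ 2) * ξ N * inner ℝ (x - y) ξ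
        + P (x N - y N) * (4 * h₂ * inner ℝ (x - y) ξ ^ 2
          + 2 * h' (‖x - y‖ ^ 2) * ‖ξ‖ ^ 2)) := by
  have hcoord : ContDiff ℝ 2 (fun z : EuclideanSpace ℝ (Fin n) => z N - y N) := by fun_prop
  have hnorm : ContDiff ℝ 2 (fun z : EuclideanSpace ℝ (Fin n) => ‖z - y‖ ^ 2) :=
    (contDiff_id.sub contDiff_const).norm_sq ℝ
  have hsm : ContDiffAt ℝ 2 (fun z : EuclideanSpace ℝ (Fin n) =>
      P (z N - y N) * h (‖z - y‖ ^ 2)) x :=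
    (ContDiffAt.comp x hPc hcoord.contDiffAt).mul (ContDiffAt.comp x hhc hnorm.contDiffAt)
  refine ⟨hsm, fun ξ => ?_⟩
  set a := x N - y N with ha
  set b := ξ N with hb
  set ρ := ‖x - y‖ ^ 2 with hρ
  set σ := inner ℝ (x - y) ξ with hσ
  have e1 : ∀ t : ℝ, (x + t • ξ) N - y N = a + t * b := fun t => by
    simp [ha, hb]; ring
  have e2 : ∀ t : ℝ, ‖x + t • ξ - y‖ ^ 2 = ρ + 2 * t * σ + t ^ 2 * ‖ξ‖ ^ 2 := fun t => by
    have : x + t • ξ - y = (x - y) + t • ξ := by abel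
    rw [this, norm_add_sq_real, inner_smul_right, norm_smul, mul_pow, Real.norm_eq_abs, sq_abs]
    ring
  have d1 : ∀ t : ℝ, HasDerivAt (fun t : ℝ => a + t * b) b t := fun t => by
    simpa using ((hasDerivAt_id t).mul_const b).const_add a
  have d2 : ∀ t : ℝ, HasDerivAt (fun t : ℝ => ρ + 2 * t * σ + t ^ 2 * ‖ξ‖ ^ 2)
      (2 * σ + 2 * t * ‖ξ‖ ^ 2) t := fun t => by
    have := ((((hasDerivAt_id t).const_mul 2).mul_const σ).const_add ρ).add
      (((hasDerivAt_id t).pow 2).mul_const (‖ξ‖ ^ 2))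
    refine this.congr_deriv ?_
    simp
  have t1 : Tendsto (fun t : ℝ => a + t * b) (𝓝 0) (𝓝 a) := by
    simpa using (d1 0).continuousAt.tendsto
  have t2 : Tendsto (fun t : ℝ => ρ + 2 * t * σ + t ^ 2 * ‖ξ‖ ^ 2) (𝓝 0) (𝓝 ρ) := by
    simpa using (d2 0).continuousAt.tendsto
  refine fderiv_fderiv_eq_of_line hsm
    (g := fun t => P' (a + t * b) * b * h (ρ + 2 * t * σ + t ^ 2 * ‖ξ‖ ^ 2)
      + P (a + t * b) * (h' (ρ + 2 * t * σ + t ^ 2 * ‖ξ‖ ^ 2)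
        * (2 * σ + 2 * t * ‖ξ‖ ^ 2))) ?_ ?_
  · filter_upwards [t1.eventually hP, t2.eventually hh] with t h1 h2
    simp only [e1, e2]
    exact (h1.comp t (d1 t)).mul (h2.comp t (d2 t))
  · have z1 : a + 0 * b = a := by ring
    have z2 : ρ + 2 * 0 * σ + 0 ^ 2 * ‖ξ‖ ^ 2 = ρ := by ring
    have k1 := (show HasDerivAt P (P' a) (a + 0 * b) from z1.symm ▸ hP.self_of_nhds).comp
      (0 : ℝ) (d1 0)
    have k2 := (show HasDerivAt P' p₂ (a + 0 * b) from z1.symm ▸ hP').comp (0 : ℝ) (d1 0)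
    have k3 := (show HasDerivAt h (h' ρ) (ρ + 2 * 0 * σ + 0 ^ 2 * ‖ξ‖ ^ 2) from
      z2.symm ▸ hh.self_of_nhds).comp (0 : ℝ) (d2 0)
    have k4 := (show HasDerivAt h' h₂ (ρ + 2 * 0 * σ + 0 ^ 2 * ‖ξ‖ ^ 2) from
      z2.symm ▸ hh').comp (0 : ℝ) (d2 0)
    have k5 : HasDerivAt (fun t : ℝ => 2 * σ + 2 * t * ‖ξ‖ ^ 2) (2 * ‖ξ‖ ^ 2) 0 := by
      simpa using (((hasDerivAt_id (0 : ℝ)).const_mul 2).mul_const (‖ξ‖ ^ 2)).const_add (2 * σ)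
    refine (((k2.mul_const b).mul k3).add (k1.mul (k4.mul k5))).congr_deriv ?_
    simp only [Function.comp, Pi.mul_apply, z1, z2]
    ring

theorem hess_congr {n : ℕ} {φ ψ : EuclideanSpace ℝ (Fin n) → ℝ} {x : EuclideanSpace ℝ (Fin n)}
    (h : φ =ᶠ[𝓝 x] ψ) : hess φ x = hess ψ x := by
  ext i j
  rw [hess_apply, hess_apply, (h.fderiv).fderiv_eq]

theorem hess_sub_const {n : ℕ} (φ : EuclideanSpace ℝ (Fin n) → ℝ) (c : ℝ)
    (x : EuclideanSpace ℝ (Fin n)) : hess (fun z => φ z - c) x = hess φ x := by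
  ext i j
  have h : fderiv ℝ (fun z => φ z - c) = fderiv ℝ φ := funext fun z => fderiv_sub_const c
  rw [hess_apply, hess_apply, h]

/-- Test functions need only be `C²` near the touching point. -/
theorem PucciSupersol.of_contDiffAt {lam Lam : ℝ} {n : ℕ} {Ω : Set (EuclideanSpace ℝ (Fin n))}
    {w g φ : EuclideanSpace ℝ (Fin n) → ℝ} (hw : PucciSupersol lam Lam Ω w g)
    {x : EuclideanSpace ℝ (Fin n)} (hx : x ∈ Ω) (hφ : ContDiffAt ℝ 2 φ x)
    (hmin : IsLocalMin (fun z => w z - φ z) x) :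
    pucciMax lam Lam (hess φ x) + g x ≤ 0 := by
  obtain ⟨r, hr, hball⟩ := Metric.eventually_nhds_iff_ball.1 (hφ.eventually (by simp))
  let f : ContDiffBump x := ⟨r / 4, r / 2, by positivity, by linarith⟩
  have hout : f.rOut = r / 2 := rfl
  have hsm : ContDiff ℝ 2 (fun z => f z * φ z) := by
    rw [contDiff_iff_contDiffAt]
    intro z
    by_cases hz : z ∈ Metric.ball x r
    · exact f.contDiff.contDiffAt.mul (hball z hz)
    · have hz' : z ∉ tsupport f := by
        rw [f.tsupport_eq, hout]
        intro hz2
        exact hz (Metric.closedBall_subset_ball (by linarith) hz2)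
      have h0 : (fun y => f y * φ y) =ᶠ[𝓝 z] fun _ => 0 := by
        filter_upwards [notMem_tsupport_iff_eventuallyEq.1 hz'] with y hy
        simp [hy]
      exact contDiffAt_const.congr_of_eventuallyEq h0
  have heq : (fun z => f z * φ z) =ᶠ[𝓝 x] φ := by
    filter_upwards [f.eventuallyEq_one] with z hz
    simp [hz]
  rw [← hess_congr heq]
  refine hw x hx _ hsm (hmin.congr ?_)
  filter_upwards [heq] with z hz
  simp only [hz]

/-- Comparison from below with a strict classical subsolution. -/
theorem PucciSupersol.comparison {lam Lam : ℝ} {n : ℕ} {Ω K : Set (EuclideanSpace ℝ (Fin n))}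
    {w g φ : EuclideanSpace ℝ (Fin n) → ℝ} (hw : PucciSupersol lam Lam Ω w g)
    (hK : IsClosed K) (hwK : ContinuousOn w K) (hφK : ContinuousOn φ K)
    (hdecay : ∀ δ > 0, ∃ T : ℝ, ∀ x ∈ K, T ≤ ‖x‖ → φ x ≤ w x + δ)
    (hint : ∀ x ∈ K, w x < φ x → K ∈ 𝓝 x ∧ x ∈ Ω ∧ ContDiffAt ℝ 2 φ x ∧
      0 < pucciMax lam Lam (hess φ x) + g x) :
    ∀ x ∈ K, φ x ≤ w x := by
  suffices h : ∀ δ > 0, ∀ x ∈ K, φ x ≤ w x + δ from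
    fun x hx => le_of_forall_pos_le_add fun δ hδ => h δ hδ x hx
  intro δ hδ x hx
  by_contra! hlt
  obtain ⟨T, hT⟩ := hdecay δ hδ
  have hxT : ‖x‖ < T := by
    by_contra! h
    exact absurd (hT x hx h) (not_le.2 hlt)
  have hcomp : IsCompact (K ∩ Metric.closedBall 0 T) :=
    (isCompact_closedBall _ _).inter_left hK
  obtain ⟨z, ⟨hzK, -⟩, hz⟩ := hcomp.exists_isMinOn (f := fun z => w z - (φ z - δ))
    ⟨x, hx, by simpa using hxT.le⟩
    ((hwK.sub (hφK.sub continuousOn_const)).mono Set.inter_subset_left)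
  have hzx : w z - (φ z - δ) ≤ w x - (φ x - δ) := hz ⟨hx, by simpa using hxT.le⟩
  have hzT : ‖z‖ < T := by
    by_contra! h
    linarith [hT z hzK h]
  obtain ⟨hnhds, hzΩ, hsm, hpos⟩ := hint z hzK (by linarith)
  have hloc : IsLocalMin (fun z => w z - (φ z - δ)) z := by
    have hball : Metric.closedBall (0 : EuclideanSpace ℝ (Fin n)) T ∈ 𝓝 z :=
      Metric.closedBall_mem_nhds_of_mem (by simpa using hzT)
    exact hz.isLocalMin (inter_mem hnhds hball)
  have := hw.of_contDiffAt hzΩ (hsm.sub contDiffAt_const) hloc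
  rw [hess_sub_const] at this
  linarith

/-- The linear operator `tr (A ·)`, `A = lam I + (Lam - lam) d̂ d̂ᵀ`, on quadratic forms. -/
noncomputable def radialOp (lam Lam : ℝ) {n : ℕ} (d : EuclideanSpace ℝ (Fin n))
    (Q : EuclideanSpace ℝ (Fin n) → ℝ) : ℝ :=
  lam * ∑ i, Q (EuclideanSpace.single i 1) + (Lam - lam) * Q (‖d‖⁻¹ • d)

theorem HasHessianForm.radialOp_le {n : ℕ} {lam Lam : ℝ} (hLam : lam ≤ Lam)
    {φ : EuclideanSpace ℝ (Fin n) → ℝ} {x : EuclideanSpace ℝ (Fin n)}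
    {Q : EuclideanSpace ℝ (Fin n) → ℝ} (h : HasHessianForm φ x Q)
    {d : EuclideanSpace ℝ (Fin n)} (hd : d ≠ 0) :
    radialOp lam Lam d Q ≤ pucciMax lam Lam (hess φ x) :=
  h.le_pucciMax hLam _ (by rw [norm_smul, norm_inv, norm_norm, inv_mul_cancel₀ (norm_ne_zero_iff.2 hd)])

theorem radialOp_add (lam Lam : ℝ) {n : ℕ} (d : EuclideanSpace ℝ (Fin n))
    (Q S : EuclideanSpace ℝ (Fin n) → ℝ) :
    radialOp lam Lam d (fun ξ => Q ξ + S ξ) = radialOp lam Lam d Q + radialOp lam Lam d S := by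
  simp only [radialOp, Finset.sum_add_distrib]
  ring

theorem radialOp_const_mul (lam Lam : ℝ) {n : ℕ} (d : EuclideanSpace ℝ (Fin n)) (c : ℝ)
    (Q : EuclideanSpace ℝ (Fin n) → ℝ) :
    radialOp lam Lam d (fun ξ => c * Q ξ) = c * radialOp lam Lam d Q := by
  simp only [radialOp, ← Finset.mul_sum]
  ring

theorem radialOp_formula (lam Lam : ℝ) {n : ℕ} (N : Fin n) {d : EuclideanSpace ℝ (Fin n)}
    (hd : d ≠ 0) (p₀ p₁ p₂ h₀ h₁ h₂ : ℝ) :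
    radialOp lam Lam d (fun ξ => p₂ * ξ N ^ 2 * h₀ + 4 * p₁ * h₁ * ξ N * inner ℝ d ξ
        + p₀ * (4 * h₂ * inner ℝ d ξ ^ 2 + 2 * h₁ * ‖ξ‖ ^ 2))
      = lam * (p₂ * h₀ + 4 * p₁ * h₁ * d N + p₀ * (4 * h₂ * ‖d‖ ^ 2 + 2 * n * h₁))
        + (Lam - lam) * (p₂ * (d N ^ 2 / ‖d‖ ^ 2) * h₀ + 4 * p₁ * h₁ * d N
          + p₀ * (4 * h₂ * ‖d‖ ^ 2 + 2 * h₁)) := by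
  have hr : ‖d‖ ≠ 0 := norm_ne_zero_iff.2 hd
  have s1 : ∑ i : Fin n, (EuclideanSpace.single i (1 : ℝ) N) ^ 2 = 1 := by
    simp
  have s2 : ∑ i : Fin n, (EuclideanSpace.single i (1 : ℝ) N) * d i = d N := by
    simp
  have s3 : ∑ i : Fin n, d i ^ 2 = ‖d‖ ^ 2 := (EuclideanSpace.real_norm_sq_eq d).symm
  have hin : ∀ i : Fin n, inner ℝ d (EuclideanSpace.single i (1 : ℝ)) = d i := fun i => by
    simp [EuclideanSpace.inner_single_right]
  have hsum : ∑ i : Fin n, (p₂ * (EuclideanSpace.single i (1 : ℝ) N) ^ 2 * h₀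
      + 4 * p₁ * h₁ * (EuclideanSpace.single i (1 : ℝ) N)
        * inner ℝ d (EuclideanSpace.single i (1 : ℝ))
      + p₀ * (4 * h₂ * inner ℝ d (EuclideanSpace.single i (1 : ℝ)) ^ 2
        + 2 * h₁ * ‖EuclideanSpace.single i (1 : ℝ)‖ ^ 2))
      = p₂ * h₀ + 4 * p₁ * h₁ * d N + p₀ * (4 * h₂ * ‖d‖ ^ 2 + 2 * n * h₁) := by
    have : ∀ i : Fin n, (p₂ * (EuclideanSpace.single i (1 : ℝ) N) ^ 2 * h₀
      + 4 * p₁ * h₁ * (EuclideanSpace.single i (1 : ℝ) N)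
        * inner ℝ d (EuclideanSpace.single i (1 : ℝ))
      + p₀ * (4 * h₂ * inner ℝ d (EuclideanSpace.single i (1 : ℝ)) ^ 2
        + 2 * h₁ * ‖EuclideanSpace.single i (1 : ℝ)‖ ^ 2))
      = p₂ * h₀ * (EuclideanSpace.single i (1 : ℝ) N) ^ 2
        + 4 * p₁ * h₁ * ((EuclideanSpace.single i (1 : ℝ) N) * d i)
        + p₀ * 4 * h₂ * d i ^ 2 + p₀ * 2 * h₁ := fun i => by
      rw [hin, PiLp.norm_single, norm_one]
      ring
    rw [Finset.sum_congr rfl fun i _ => this i]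
    simp only [Finset.sum_add_distrib, ← Finset.mul_sum, s1, s2, s3, Finset.sum_const,
      Finset.card_univ, Fintype.card_fin, nsmul_eq_mul]
    ring
  rw [radialOp, hsum, norm_smul, norm_inv, norm_norm, inv_mul_cancel₀ hr, inner_smul_right,
    real_inner_self_eq_norm_sq, PiLp.smul_apply, smul_eq_mul]
  field_simp

theorem eventually_hasDerivAt_rpow {t : ℝ} (ht : 0 < t) (e : ℝ) :
    ∀ᶠ s in 𝓝 t, HasDerivAt (fun s : ℝ => s ^ e) (e * s ^ (e - 1)) s := by
  filter_upwards [lt_mem_nhds ht] with s hs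
  exact Real.hasDerivAt_rpow_const (Or.inl hs.ne')

theorem hasDerivAt_const_mul_rpow {t : ℝ} (ht : 0 < t) (e : ℝ) :
    HasDerivAt (fun s : ℝ => e * s ^ (e - 1)) (e * ((e - 1) * t ^ (e - 1 - 1))) t :=
  (Real.hasDerivAt_rpow_const (Or.inl ht.ne')).const_mul e

section Barriers

variable {n : ℕ} {lam Lam β : ℝ} {N : Fin n} {x y : EuclideanSpace ℝ (Fin n)}

theorem exists_hessianForm_rpow_norm (hLam : 0 < Lam)
    (hβ : Lam * (β - 1) = lam * ((n : ℝ) - 1)) (hβ0 : 0 < β) (N : Fin n) (hxy : x - y ≠ 0) :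
    ∃ Q, HasHessianForm (fun z => (‖z - y‖ ^ 2) ^ (-β)) x Q ∧
      0 < radialOp lam Lam (x - y) Q := by
  have ht : 0 < ‖x - y‖ ^ 2 := by have := norm_pos_iff.2 hxy; positivity
  have key := hasHessianForm_mul (N := N) (P := fun _ => 1) (P' := fun _ => 0) (p₂ := 0)
    (x := x) (y := y) contDiffAt_const (Real.contDiffAt_rpow_const_of_ne (p := -β) ht.ne')
    (Eventually.of_forall fun a => hasDerivAt_const a 1) (hasDerivAt_const _ 0)
    (eventually_hasDerivAt_rpow ht (-β)) (hasDerivAt_const_mul_rpow ht (-β))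
  simp only [one_mul] at key
  refine ⟨_, key, ?_⟩
  have hf := radialOp_formula lam Lam N hxy 1 0 0 ((‖x - y‖ ^ 2) ^ (-β))
    (-β * (‖x - y‖ ^ 2) ^ (-β - 1)) (-β * ((-β - 1) * (‖x - y‖ ^ 2) ^ (-β - 1 - 1)))
  simp only [one_mul] at hf
  rw [hf]
  set t := ‖x - y‖ ^ 2
  have hX : t ^ (-β - 1) = t ^ (-β - 1 - 1) * t := by
    rw [← Real.rpow_add_one ht.ne']; ring_nf
  rw [hX]
  have hX0 : 0 < t ^ (-β - 1 - 1) := Real.rpow_pos_of_pos ht _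
  set X := t ^ (-β - 1 - 1)
  have : 0 < (X * t) * (2 * Lam * β * (β + 2)) := by positivity
  have h2 : lam * (0 * (t ^ (-β)) + 4 * 0 * (-β * (X * t)) * (x - y) N
      + (4 * (-β * ((-β - 1) * X)) * t + 2 * n * (-β * (X * t))))
      + (Lam - lam) * (0 * ((x - y) N ^ 2 / t) * t ^ (-β) + 4 * 0 * (-β * (X * t)) * (x - y) N
        + (4 * (-β * ((-β - 1) * X)) * t + 2 * (-β * (X * t))))
      = (X * t) * (2 * Lam * β * (β + 2)) := by
    linear_combination (2 * β * X * t) * hβ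
  rw [h2]
  exact this

theorem exists_hessianForm_coord_mul_rpow
    (hβ : Lam * (β - 1) = lam * ((n : ℝ) - 1)) (hxy : x - y ≠ 0) :
    ∃ Q, HasHessianForm (fun z => (z N - y N) * (‖z - y‖ ^ 2) ^ (-(β / 2))) x Q ∧
      radialOp lam Lam (x - y) Q = 0 := by
  have ht : 0 < ‖x - y‖ ^ 2 := by have := norm_pos_iff.2 hxy; positivity
  have key := hasHessianForm_mul (N := N) (P := fun a => a) (P' := fun _ => 1) (p₂ := 0)
    (x := x) (y := y) contDiffAt_id (Real.contDiffAt_rpow_const_of_ne (p := -(β / 2)) ht.ne')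
    (Eventually.of_forall fun a => hasDerivAt_id a) (hasDerivAt_const _ 1)
    (eventually_hasDerivAt_rpow ht (-(β / 2))) (hasDerivAt_const_mul_rpow ht (-(β / 2)))
  refine ⟨_, key, ?_⟩
  rw [radialOp_formula lam Lam N hxy, PiLp.sub_apply]
  set t := ‖x - y‖ ^ 2
  have hX : t ^ (-(β / 2) - 1) = t ^ (-(β / 2) - 1 - 1) * t := by
    rw [← Real.rpow_add_one ht.ne']; ring_nf
  rw [hX]
  set X := t ^ (-(β / 2) - 1 - 1)
  linear_combination ((x N - y N) * β * X * t) * hβ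

theorem exists_hessianForm_coord_mul_log
    (hβ : Lam * (β - 1) = lam * ((n : ℝ) - 1)) (hxy : x - y ≠ 0) :
    ∃ Q, HasHessianForm (fun z => (z N - y N) *
        ((‖z - y‖ ^ 2) ^ (-(β / 2)) * Real.log (‖z - y‖ ^ 2))) x Q ∧
      radialOp lam Lam (x - y) Q
        = -2 * Lam * β * (x N - y N) * (‖x - y‖ ^ 2) ^ (-(β / 2) - 1) := by
  have ht : 0 < ‖x - y‖ ^ 2 := by have := norm_pos_iff.2 hxy; positivity
  have h1 : ∀ s : ℝ, 0 < s → HasDerivAt (fun s : ℝ => s ^ (-(β / 2)) * Real.log s)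
      (-(β / 2) * s ^ (-(β / 2) - 1) * Real.log s + s ^ (-(β / 2) - 1)) s := fun s hs => by
    refine ((Real.hasDerivAt_rpow_const (p := -(β / 2)) (Or.inl hs.ne')).mul
      (Real.hasDerivAt_log hs.ne')).congr_deriv ?_
    rw [Real.rpow_sub_one hs.ne']
    ring
  have h2 : HasDerivAt (fun s : ℝ => -(β / 2) * s ^ (-(β / 2) - 1) * Real.log s
      + s ^ (-(β / 2) - 1)) (-(β / 2) * ((-(β / 2) - 1) * (‖x - y‖ ^ 2) ^ (-(β / 2) - 1 - 1))
        * Real.log (‖x - y‖ ^ 2) + -(β / 2) * (‖x - y‖ ^ 2) ^ (-(β / 2) - 1 - 1)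
        + (-(β / 2) - 1) * (‖x - y‖ ^ 2) ^ (-(β / 2) - 1 - 1)) (‖x - y‖ ^ 2) := by
    refine (((hasDerivAt_const_mul_rpow ht (-(β / 2))).mul (Real.hasDerivAt_log ht.ne')).add
      (Real.hasDerivAt_rpow_const (p := -(β / 2) - 1) (Or.inl ht.ne'))).congr_deriv ?_
    rw [Real.rpow_sub_one ht.ne' (-(β / 2) - 1)]
    ring
  have key := hasHessianForm_mul (N := N) (P := fun a => a) (P' := fun _ => 1) (p₂ := 0)
    (x := x) (y := y) contDiffAt_id
    ((Real.contDiffAt_rpow_const_of_ne (p := -(β / 2)) ht.ne').mul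
      (Real.contDiffAt_log.2 ht.ne'))
    (Eventually.of_forall fun a => hasDerivAt_id a) (hasDerivAt_const _ 1)
    (by filter_upwards [lt_mem_nhds ht] with s hs using h1 s hs) h2
  refine ⟨_, key, ?_⟩
  rw [radialOp_formula lam Lam N hxy, PiLp.sub_apply]
  set t := ‖x - y‖ ^ 2
  have hX : t ^ (-(β / 2) - 1) = t ^ (-(β / 2) - 1 - 1) * t := by
    rw [← Real.rpow_add_one ht.ne']; ring_nf
  rw [hX]
  set X := t ^ (-(β / 2) - 1 - 1)
  linear_combination ((x N - y N) * X * t * (β * Real.log t - 2)) * hβ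

theorem exists_hessianForm_coord_sq_mul_rpow (hLam : lam ≤ Lam)
    (hβ : Lam * (β - 1) = lam * ((n : ℝ) - 1)) (hxy : x - y ≠ 0) :
    ∃ Q, HasHessianForm (fun z => (z N - y N) ^ 2 * (‖z - y‖ ^ 2) ^ (-((β + 1) / 2))) x Q ∧
      2 * lam * (‖x - y‖ ^ 2) ^ (-((β + 1) / 2))
        - (β + 1) * Lam * (x N - y N) ^ 2 * (‖x - y‖ ^ 2) ^ (-((β + 1) / 2) - 1)
      ≤ radialOp lam Lam (x - y) Q := by
  have ht : 0 < ‖x - y‖ ^ 2 := by have := norm_pos_iff.2 hxy; positivity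
  have key := hasHessianForm_mul (N := N) (P := fun a => a ^ 2) (P' := fun a => 2 * a) (p₂ := 2)
    (x := x) (y := y) (contDiffAt_id.pow 2)
    (Real.contDiffAt_rpow_const_of_ne (p := -((β + 1) / 2)) ht.ne')
    (Eventually.of_forall fun a => by simpa using hasDerivAt_pow 2 a)
    (by simpa using (hasDerivAt_id (x N - y N)).const_mul 2)
    (eventually_hasDerivAt_rpow ht (-((β + 1) / 2)))
    (hasDerivAt_const_mul_rpow ht (-((β + 1) / 2)))
  refine ⟨_, key, ?_⟩
  rw [radialOp_formula lam Lam N hxy, PiLp.sub_apply]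
  set t := ‖x - y‖ ^ 2
  have hX : t ^ (-((β + 1) / 2) - 1) = t ^ (-((β + 1) / 2) - 1 - 1) * t := by
    rw [← Real.rpow_add_one ht.ne']; ring_nf
  have hY0 : 0 < t ^ (-((β + 1) / 2)) := Real.rpow_pos_of_pos ht _
  set Y := t ^ (-((β + 1) / 2))
  rw [hX]
  set X := t ^ (-((β + 1) / 2) - 1 - 1)
  set a := x N - y N
  have hpos : 0 ≤ (Lam - lam) * (2 * (a ^ 2 / t) * Y) :=
    mul_nonneg (sub_nonneg.2 hLam) (by positivity)
  linear_combination hpos - (a ^ 2 * X * t * (β + 1)) * hβ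

end Barriers

/-- Lower bounds propagate from a ball to concentric larger ones. -/
theorem PucciSupersol.propagation {lam Lam β : ℝ} {n : ℕ} (N : Fin n) (hlam : 0 < lam)
    (hLam : lam ≤ Lam) (hβ : Lam * (β - 1) = lam * ((n : ℝ) - 1)) (hβ0 : 0 < β)
    {Ω : Set (EuclideanSpace ℝ (Fin n))} {w g : EuclideanSpace ℝ (Fin n) → ℝ}
    (hw : PucciSupersol lam Lam Ω w g) (hg : ∀ x ∈ Ω, 0 ≤ g x)
    {y : EuclideanSpace ℝ (Fin n)} {ρ T μ : ℝ} (hρ : 0 < ρ) (hρT : ρ < T)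
    (hball : Metric.ball y T ⊆ Ω) (hcont : ContinuousOn w (Metric.closedBall y T))
    (hnonneg : ∀ x ∈ Metric.closedBall y T, 0 ≤ w x) (hμ : 0 < μ)
    (hlow : ∀ x ∈ Metric.closedBall y ρ, μ ≤ w x) {x : EuclideanSpace ℝ (Fin n)}
    (hx1 : ρ ≤ ‖x - y‖) (hx2 : ‖x - y‖ ≤ T) :
    μ * (ρ ^ 2) ^ β * (‖x - y‖ ^ 2) ^ (-β) - μ * (ρ ^ 2) ^ β * (T ^ 2) ^ (-β) ≤ w x := by
  have hT : 0 < T := hρ.trans hρT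
  have hm : 0 < μ * (ρ ^ 2) ^ β := mul_pos hμ (Real.rpow_pos_of_pos (by positivity) _)
  set K : Set (EuclideanSpace ℝ (Fin n)) := {z | ρ ≤ ‖z - y‖ ∧ ‖z - y‖ ≤ T} with hK
  have hdist : Continuous fun z : EuclideanSpace ℝ (Fin n) => ‖z - y‖ := by fun_prop
  have hne : ∀ z, ρ ≤ ‖z - y‖ → z - y ≠ 0 := fun z hz =>
    norm_pos_iff.1 (hρ.trans_le hz)
  have hKball : K ⊆ Metric.closedBall y T := fun z hz => by
    simpa [Metric.mem_closedBall, dist_eq_norm] using hz.2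
  refine hw.comparison (K := K)
    (φ := fun z => μ * (ρ ^ 2) ^ β * (‖z - y‖ ^ 2) ^ (-β) - μ * (ρ ^ 2) ^ β * (T ^ 2) ^ (-β))
    ?_ (hcont.mono hKball) ?_ ?_ ?_ x ⟨hx1, hx2⟩
  · exact isClosed_Icc.preimage hdist
  · intro z hz
    obtain ⟨Q, hQ, -⟩ := exists_hessianForm_rpow_norm (hlam.trans_le hLam) hβ hβ0 N (hne z hz.1)
    exact ((hQ.const_mul _).sub_const _).1.continuousAt.continuousWithinAt
  · refine fun δ hδ => ⟨‖y‖ + T + 1, fun z hz hzT => ?_⟩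
    have := norm_sub_norm_le z y
    linarith [hz.2]
  · intro z hz hlt
    have h1 : ρ < ‖z - y‖ := by
      refine lt_of_le_of_ne hz.1 fun h => ?_
      have hle : μ ≤ w z := hlow z (by simp [Metric.mem_closedBall, dist_eq_norm, ← h])
      have h2 : (ρ ^ 2) ^ β * (ρ ^ 2) ^ (-β) = 1 := by
        rw [← Real.rpow_add (by positivity)]; simp
      have h3 : 0 < μ * (ρ ^ 2) ^ β * (T ^ 2) ^ (-β) :=
        mul_pos hm (Real.rpow_pos_of_pos (by positivity) _)
      simp only [← h, mul_assoc, h2] at hlt h3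
      linarith
    have h2 : ‖z - y‖ < T := by
      refine lt_of_le_of_ne hz.2 fun h => ?_
      have := hnonneg z (hKball hz)
      simp only [h, sub_self] at hlt
      linarith
    obtain ⟨Q, hQ, hpos⟩ :=
      exists_hessianForm_rpow_norm (hlam.trans_le hLam) hβ hβ0 N (hne z hz.1)
    have hzΩ : z ∈ Ω := hball (by simpa [Metric.mem_ball, dist_eq_norm] using h2)
    refine ⟨?_, hzΩ, ((hQ.const_mul _).sub_const _).1, ?_⟩
    · have hopen : IsOpen {z : EuclideanSpace ℝ (Fin n) | ρ < ‖z - y‖ ∧ ‖z - y‖ < T} :=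
        isOpen_Ioo.preimage hdist
      exact mem_of_superset (hopen.mem_nhds ⟨h1, h2⟩) fun a ha => ⟨ha.1.le, ha.2.le⟩
    · have := ((hQ.const_mul (μ * (ρ ^ 2) ^ β)).sub_const
        (μ * (ρ ^ 2) ^ β * (T ^ 2) ^ (-β))).radialOp_le hLam (hne z hz.1)
      rw [radialOp_const_mul] at this
      linarith [hg z hzΩ, mul_pos hm hpos]

/-- A positive source term forces a quantitative interior lower bound. -/
theorem PucciSupersol.paraboloid_le {lam Lam : ℝ} {n : ℕ} (N : Fin n) (hlam : 0 < lam)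
    (hLam : lam ≤ Lam) {Ω : Set (EuclideanSpace ℝ (Fin n))} {w g : EuclideanSpace ℝ (Fin n) → ℝ}
    (hw : PucciSupersol lam Lam Ω w g) {y : EuclideanSpace ℝ (Fin n)} {T k : ℝ}
    (hball : Metric.ball y T ⊆ Ω) (hcont : ContinuousOn w (Metric.closedBall y T))
    (hnonneg : ∀ x ∈ Metric.closedBall y T, 0 ≤ w x) (hk : 0 < k)
    (hg : ∀ x ∈ Metric.ball y T, k ≤ g x) {x : EuclideanSpace ℝ (Fin n)}
    (hx : x ∈ Metric.closedBall y T) :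
    k / (4 * Lam * n) * (T ^ 2 - ‖x - y‖ ^ 2) ≤ w x := by
  have hn : (1 : ℝ) ≤ n := by exact_mod_cast N.pos
  have hL : 0 < Lam := hlam.trans_le hLam
  set c := k / (4 * Lam * n) with hc
  have hform : ∀ z : EuclideanSpace ℝ (Fin n),
      HasHessianForm (fun z => c * (T ^ 2 - ‖z - y‖ ^ 2)) z (fun ξ => -c * (2 * ‖ξ‖ ^ 2)) := by
    intro z
    have key := hasHessianForm_mul (N := N) (P := fun _ => 1) (P' := fun _ => 0) (p₂ := 0)
      (h := fun t => t) (h' := fun _ => 1) (h₂ := 0)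
      (x := z) (y := y) contDiffAt_const contDiffAt_id
      (Eventually.of_forall fun a => hasDerivAt_const a 1) (hasDerivAt_const _ 0)
      (Eventually.of_forall fun t => hasDerivAt_id t) (hasDerivAt_const _ 1)
    have h2 := (key.const_mul (-c)).sub_const (-c * T ^ 2)
    convert h2 using 1
    · funext a; ring
    · funext ξ; ring
  refine hw.comparison (K := Metric.closedBall y T) (φ := fun z => c * (T ^ 2 - ‖z - y‖ ^ 2))
    Metric.isClosed_closedBall hcont
    (fun z _ => (hform z).1.continuousAt.continuousWithinAt) ?_ ?_ x hx
  · refine fun δ hδ => ⟨‖y‖ + T + 1, fun z hz hzT => ?_⟩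
    have := norm_sub_norm_le z y
    rw [Metric.mem_closedBall, dist_eq_norm] at hz
    linarith
  · intro z hz hlt
    have hzT : z ∈ Metric.ball y T := by
      refine lt_of_le_of_ne (Metric.mem_closedBall.1 hz) fun h => ?_
      have := hnonneg z hz
      rw [dist_eq_norm] at h
      simp only [h, sub_self, mul_zero] at hlt
      linarith
    refine ⟨Metric.closedBall_mem_nhds_of_mem hzT, hball hzT, (hform z).1, ?_⟩
    have := (hform z).le_pucciMax hLam (EuclideanSpace.single N 1) (by simp)
    simp only [PiLp.norm_single, norm_one, one_pow, mul_one, Finset.sum_const, Finset.card_univ,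
      Fintype.card_fin, nsmul_eq_mul] at this
    have hck : c * (4 * Lam * n) = k := by rw [hc]; field_simp
    have hc0 : 0 < c := by positivity
    have h1 : c * (2 * (lam * (n - 1) + Lam)) ≤ c * (2 * Lam * n) := by
      refine mul_le_mul_of_nonneg_left ?_ hc0.le
      nlinarith
    have h2 : c * (2 * Lam * n) = k / 2 := by rw [← hck]; ring
    nlinarith [hg z hzT]

theorem PucciSupersol.exists_growth {lam Lam β : ℝ} {n : ℕ} (N : Fin n) (hlam : 0 < lam)
    (hLam : lam ≤ Lam) (hβ : Lam * (β - 1) = lam * ((n : ℝ) - 1)) (hβ0 : 0 < β) :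
    ∃ c > 0, ∀ (Ω : Set (EuclideanSpace ℝ (Fin n))) (w g : EuclideanSpace ℝ (Fin n) → ℝ),
      PucciSupersol lam Lam Ω w g → (∀ x ∈ Ω, 0 ≤ g x) →
      ∀ (y : EuclideanSpace ℝ (Fin n)) (ρ k : ℝ), 0 < ρ → 0 < k →
        Metric.ball y (3 * ρ) ⊆ Ω → ContinuousOn w (Metric.closedBall y (3 * ρ)) →
        (∀ x ∈ Metric.closedBall y (3 * ρ), 0 ≤ w x) →
        (∀ x ∈ Metric.closedBall y (2 * ρ), k ≤ g x) →
        ∀ x ∈ Metric.closedBall y (2 * ρ), c * (ρ ^ 2 * k) ≤ w x := by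
  have hn : (1 : ℝ) ≤ n := by exact_mod_cast N.pos
  have hL : 0 < Lam := hlam.trans_le hLam
  have hd : (0 : ℝ) < 4 ^ (-β) - 9 ^ (-β) :=
    sub_pos.2 (Real.rpow_lt_rpow_of_neg (by norm_num) (by norm_num) (by linarith))
  have hd1 : (4 : ℝ) ^ (-β) - 9 ^ (-β) ≤ 1 := by
    have h1 : (4 : ℝ) ^ (-β) ≤ 1 := Real.rpow_le_one_of_one_le_of_nonpos (by norm_num) (by linarith)
    have h2 : (0 : ℝ) < 9 ^ (-β) := Real.rpow_pos_of_pos (by norm_num) _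
    linarith
  refine ⟨3 / (4 * Lam * n) * (4 ^ (-β) - 9 ^ (-β)), by positivity, ?_⟩
  intro Ω w g hw hg0 y ρ k hρ hk hball hcont hnonneg hg x hx
  set μ := k / (4 * Lam * n) * (3 * ρ ^ 2) with hμdef
  have hμ : 0 < μ := by positivity
  have heq : 3 / (4 * Lam * n) * ((4 : ℝ) ^ (-β) - 9 ^ (-β)) * (ρ ^ 2 * k)
      = μ * (4 ^ (-β) - 9 ^ (-β)) := by
    rw [hμdef]; ring
  have hlow : ∀ z ∈ Metric.closedBall y ρ, μ ≤ w z := by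
    intro z hz
    have hsub : Metric.closedBall y (2 * ρ) ⊆ Metric.closedBall y (3 * ρ) :=
      Metric.closedBall_subset_closedBall (by linarith)
    have h := hw.paraboloid_le N hlam hLam (T := 2 * ρ)
      ((Metric.ball_subset_ball (by linarith)).trans hball) (hcont.mono hsub)
      (fun z hz => hnonneg z (hsub hz)) hk
      (fun z hz => hg z (Metric.ball_subset_closedBall hz))
      (Metric.closedBall_subset_closedBall (by linarith) hz)
    refine le_trans (mul_le_mul_of_nonneg_left ?_ (by positivity)) h
    rw [Metric.mem_closedBall, dist_eq_norm] at hz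
    nlinarith [norm_nonneg (z - y)]
  rw [heq]
  rw [Metric.mem_closedBall, dist_eq_norm] at hx
  rcases le_total ‖x - y‖ ρ with h | h
  · exact (mul_le_of_le_one_right hμ.le hd1).trans
      (hlow x (by rwa [Metric.mem_closedBall, dist_eq_norm]))
  · refine le_trans ?_ (hw.propagation N hlam hLam hβ hβ0 hg0 hρ (by linarith) hball hcont
      hnonneg hμ hlow h (by linarith))
    have h1 : (ρ ^ 2) ^ β * (ρ ^ 2) ^ (-β) = 1 := by
      rw [← Real.rpow_add (by positivity)]; simp
    have h2 : (4 : ℝ) ^ (-β) * (ρ ^ 2) ^ (-β) ≤ (‖x - y‖ ^ 2) ^ (-β) := by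
      rw [← Real.mul_rpow (by norm_num) (by positivity)]
      have : 0 < ‖x - y‖ := hρ.trans_le h
      exact Real.rpow_le_rpow_of_nonpos (by positivity) (by nlinarith) (by linarith)
    have h3 : ((3 * ρ) ^ 2) ^ (-β) = (9 : ℝ) ^ (-β) * (ρ ^ 2) ^ (-β) := by
      rw [← Real.mul_rpow (by norm_num) (by positivity)]
      congr 1; ring
    have hm : 0 < μ * (ρ ^ 2) ^ β := mul_pos hμ (Real.rpow_pos_of_pos (by positivity) _)
    rw [h3]
    calc μ * (4 ^ (-β) - 9 ^ (-β))
        = μ * (ρ ^ 2) ^ β * (4 ^ (-β) * (ρ ^ 2) ^ (-β))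
          - μ * (ρ ^ 2) ^ β * (9 ^ (-β) * (ρ ^ 2) ^ (-β)) := by
          linear_combination (-μ * (4 ^ (-β) - 9 ^ (-β))) * h1
      _ ≤ _ := sub_le_sub_right (mul_le_mul_of_nonneg_left h2 hm.le) _

theorem isOpen_halfSpace {n : ℕ} (N : Fin n) (c : ℝ) :
    IsOpen {x : EuclideanSpace ℝ (Fin n) | c < x N} :=
  isOpen_lt continuous_const (by fun_prop)

theorem abs_coord_sub_le {n : ℕ} (N : Fin n) (x y : EuclideanSpace ℝ (Fin n)) :
    |x N - y N| ≤ ‖x - y‖ := by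
  simpa using PiLp.norm_apply_le (x - y) N

theorem closedBall_subset_halfSpace {n : ℕ} {N : Fin n} {y : EuclideanSpace ℝ (Fin n)} {T : ℝ}
    (hT : T ≤ y N) : Metric.closedBall y T ⊆ {x | 0 ≤ x N} := by
  intro x hx
  rw [Metric.mem_closedBall, dist_eq_norm] at hx
  have := abs_le.1 ((abs_coord_sub_le N x y).trans hx)
  simp only [Set.mem_ofPred_eq]
  linarith

theorem ball_subset_halfSpace {n : ℕ} {N : Fin n} {y : EuclideanSpace ℝ (Fin n)} {T : ℝ}
    (hT : T ≤ y N) : Metric.ball y T ⊆ {x | 0 < x N} := by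
  intro x hx
  rw [Metric.mem_ball, dist_eq_norm] at hx
  have := abs_lt.1 ((abs_coord_sub_le N x y).trans_lt hx)
  simp only [Set.mem_ofPred_eq]
  linarith

/-- Strong minimum principle in the half space. -/
theorem PucciSupersol.pos_of_exists_pos {lam Lam β : ℝ} {n : ℕ} {N : Fin n} (hlam : 0 < lam)
    (hLam : lam ≤ Lam) (hβ : Lam * (β - 1) = lam * ((n : ℝ) - 1)) (hβ0 : 0 < β)
    {w g : EuclideanSpace ℝ (Fin n) → ℝ} (hw : PucciSupersol lam Lam {x | 0 < x N} w g)
    (hg : ∀ x : EuclideanSpace ℝ (Fin n), 0 < x N → 0 ≤ g x)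
    (hcont : ContinuousOn w {x | 0 ≤ x N})
    (hnonneg : ∀ x : EuclideanSpace ℝ (Fin n), 0 ≤ x N → 0 ≤ w x)
    {x₀ : EuclideanSpace ℝ (Fin n)} (hx₀ : 0 < x₀ N) (hwx₀ : 0 < w x₀) :
    ∀ x : EuclideanSpace ℝ (Fin n), 0 < x N → 0 < w x := by
  have hspread : ∀ y : EuclideanSpace ℝ (Fin n), 0 < y N → 0 < w y →
      ∀ x, ‖x - y‖ < y N → 0 < w x := by
    intro y hy hwy x hx
    have hca : ContinuousAt w y := hcont.continuousAt
      (mem_of_superset ((isOpen_halfSpace N 0).mem_nhds hy) fun z (hz : 0 < z N) => hz.le)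
    obtain ⟨r, hr, hrw⟩ := Metric.eventually_nhds_iff_ball.1
      (hca.eventually (lt_mem_nhds (half_lt_self hwy)))
    set ρ := min (r / 2) (y N / 2) with hρdef
    have hρ : 0 < ρ := by positivity
    have hρr : ρ < r := (min_le_left _ _).trans_lt (by linarith)
    have hρy : ρ < y N := (min_le_right _ _).trans_lt (by linarith)
    have hlow : ∀ z ∈ Metric.closedBall y ρ, w y / 2 ≤ w z := fun z hz =>
      (hrw z (Metric.closedBall_subset_ball hρr hz)).le
    rcases le_total ‖x - y‖ ρ with h | h
    · exact (half_pos hwy).trans_le (hlow x (by rwa [Metric.mem_closedBall, dist_eq_norm]))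
    · have hsub := closedBall_subset_halfSpace (N := N) (y := y) le_rfl
      refine lt_of_lt_of_le ?_ (hw.propagation N hlam hLam hβ hβ0 hg hρ hρy
        (ball_subset_halfSpace le_rfl) (hcont.mono hsub) (fun z hz => hnonneg z (hsub hz))
        (half_pos hwy) hlow h hx.le)
      have hxy : 0 < ‖x - y‖ := hρ.trans_le h
      refine sub_pos.2 (mul_lt_mul_of_pos_left ?_
        (mul_pos (half_pos hwy) (Real.rpow_pos_of_pos (by positivity) _)))
      exact Real.rpow_lt_rpow_of_neg (by positivity) (by nlinarith) (by linarith)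
  have hconn : IsPreconnected {x : EuclideanSpace ℝ (Fin n) | 0 < x N} := by
    refine Convex.isPreconnected ?_
    intro a ha b hb s t hs ht hst
    simp only [Set.mem_ofPred_eq, PiLp.add_apply, PiLp.smul_apply, smul_eq_mul] at *
    rcases hs.lt_or_eq with h | h
    · have := mul_pos h ha
      have := mul_nonneg ht hb.le
      linarith
    · have : t = 1 := by linarith
      subst this
      simp [← h, hb]
  have hsubset : {x : EuclideanSpace ℝ (Fin n) | 0 < x N} ⊆ {x | 0 < x N ∧ 0 < w x} := by
    refine hconn.subset_of_closure_inter_subset ?_ ⟨x₀, hx₀, hx₀, hwx₀⟩ ?_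
    · have := (hcont.mono fun z (hz : 0 < z N) => hz.le).isOpen_inter_preimage
        (isOpen_halfSpace N 0) (isOpen_Ioi (a := (0 : ℝ)))
      exact this
    · rintro z ⟨hz, hzN⟩
      simp only [Set.mem_ofPred_eq] at hzN
      obtain ⟨y, ⟨hy, hwy⟩, hzy⟩ := Metric.mem_closure_iff.1 hz (z N / 3) (by linarith)
      rw [dist_eq_norm] at hzy
      have := abs_le.1 ((abs_coord_sub_le N z y).trans hzy.le)
      exact ⟨hzN, hspread y hy hwy z (by linarith)⟩
  exact fun x hx => (hsubset hx).2

theorem PucciSupersol.exterior_comparison {lam Lam : ℝ} {n : ℕ} {N : Fin n}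
    {w g φ : EuclideanSpace ℝ (Fin n) → ℝ} (hw : PucciSupersol lam Lam {x | 0 < x N} w g)
    (hcont : ContinuousOn w {x | 0 ≤ x N})
    (hpos : ∀ x : EuclideanSpace ℝ (Fin n), 0 < x N → 0 < w x)
    {e : EuclideanSpace ℝ (Fin n)} (he : e N = 1) {ε₀ : ℝ} (hε₀ : 0 < ε₀)
    (hflat : ∀ x : EuclideanSpace ℝ (Fin n), x N = 1 → φ x ≤ 0)
    (hsphere : ∀ x : EuclideanSpace ℝ (Fin n), 1 ≤ x N → ‖x - e‖ = 1 → φ x ≤ 1)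
    (hdecay : ∀ δ > 0, ∃ T : ℝ, ∀ x : EuclideanSpace ℝ (Fin n), 1 ≤ x N → T ≤ ‖x - e‖ → φ x ≤ δ)
    (hφ : ∀ x : EuclideanSpace ℝ (Fin n), 1 ≤ ‖x - e‖ → ContDiffAt ℝ 2 φ x)
    (hsub : ∀ ε, 0 < ε → ε ≤ ε₀ → ∀ x : EuclideanSpace ℝ (Fin n), 1 < x N → 1 < ‖x - e‖ →
      0 < pucciMax lam Lam (hess (fun z => ε * φ z) x) + g x) :
    ∃ ε > 0, ∀ x : EuclideanSpace ℝ (Fin n), 1 ≤ x N → 1 ≤ ‖x - e‖ → ε * φ x ≤ w x := by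
  have hdist : Continuous fun z : EuclideanSpace ℝ (Fin n) => ‖z - e‖ := by fun_prop
  have hcoord : Continuous fun z : EuclideanSpace ℝ (Fin n) => z N := by fun_prop
  have hcap : IsCompact (Metric.sphere e 1 ∩ {x : EuclideanSpace ℝ (Fin n) | 1 ≤ x N}) :=
    (isCompact_sphere e 1).inter_right (isClosed_le continuous_const hcoord)
  have hne : (Metric.sphere e 1 ∩ {x : EuclideanSpace ℝ (Fin n) | 1 ≤ x N}).Nonempty :=
    ⟨e + EuclideanSpace.single N 1, by simp, by simp [he]⟩
  obtain ⟨z₀, ⟨-, hz₀⟩, hmin⟩ := hcap.exists_isMinOn hne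
    (hcont.mono fun z hz => (show (0 : ℝ) ≤ z N from zero_le_one.trans hz.2))
  have hm : 0 < w z₀ := hpos z₀ (zero_lt_one.trans_le hz₀)
  set ε := min ε₀ (w z₀)
  have hε : 0 < ε := lt_min hε₀ hm
  refine ⟨ε, hε, fun x hx1 hx2 => ?_⟩
  refine hw.comparison (K := {z | 1 ≤ z N ∧ 1 ≤ ‖z - e‖}) (φ := fun z => ε * φ z) ?_
    (hcont.mono fun z hz => (show (0 : ℝ) ≤ z N from zero_le_one.trans hz.1))
    (fun z hz => (contDiffAt_const.mul (hφ z hz.2)).continuousAt.continuousWithinAt) ?_ ?_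
    x ⟨hx1, hx2⟩
  · exact (isClosed_le continuous_const hcoord).inter (isClosed_le continuous_const hdist)
  · intro δ hδ
    obtain ⟨T, hT⟩ := hdecay (δ / ε) (by positivity)
    refine ⟨T + ‖e‖, fun z hz hzT => ?_⟩
    have h1 : T ≤ ‖z - e‖ := by linarith [norm_sub_norm_le z e]
    have h2 := mul_le_mul_of_nonneg_left (hT z hz.1 h1) hε.le
    rw [mul_div_cancel₀ _ hε.ne'] at h2
    linarith [hpos z (zero_lt_one.trans_le hz.1)]
  · rintro z ⟨hz1, hz2⟩ hlt
    have hwz := hpos z (zero_lt_one.trans_le hz1)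
    have h1 : 1 < z N := by
      refine lt_of_le_of_ne hz1 fun h => ?_
      have := mul_nonpos_of_nonneg_of_nonpos hε.le (hflat z h.symm)
      linarith
    have h2 : 1 < ‖z - e‖ := by
      refine lt_of_le_of_ne hz2 fun h => ?_
      have h3 : w z₀ ≤ w z := hmin ⟨by rw [mem_sphere_iff_norm, ← h], hz1⟩
      have h4 := mul_le_mul_of_nonneg_left (hsphere z hz1 h.symm) hε.le
      linarith [min_le_right ε₀ (w z₀)]
    refine ⟨?_, zero_lt_one.trans h1, contDiffAt_const.mul (hφ z hz2),
      hsub ε hε (min_le_left _ _) z h1 h2⟩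
    have hopen : IsOpen ({z : EuclideanSpace ℝ (Fin n) | 1 < z N} ∩ {z | 1 < ‖z - e‖}) :=
      (isOpen_lt continuous_const hcoord).inter (isOpen_lt continuous_const hdist)
    exact mem_of_superset (hopen.mem_nhds ⟨h1, h2⟩) fun a ha => ⟨le_of_lt ha.1, le_of_lt ha.2⟩

/-- Supersolutions decay at most like the homogeneous solution `xₙ |x| ^ (-β)`. -/
theorem PucciSupersol.exists_coord_mul_rpow_le {lam Lam β : ℝ} {n : ℕ} {N : Fin n}
    (hLam : lam ≤ Lam) (hβ : Lam * (β - 1) = lam * ((n : ℝ) - 1)) (hβ1 : 1 < β)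
    {w g : EuclideanSpace ℝ (Fin n) → ℝ} (hw : PucciSupersol lam Lam {x | 0 < x N} w g)
    (hg : ∀ x : EuclideanSpace ℝ (Fin n), 0 < x N → 0 < g x)
    (hcont : ContinuousOn w {x | 0 ≤ x N})
    (hpos : ∀ x : EuclideanSpace ℝ (Fin n), 0 < x N → 0 < w x)
    {e : EuclideanSpace ℝ (Fin n)} (he : e N = 1) :
    ∃ ε > 0, ∀ x : EuclideanSpace ℝ (Fin n), 1 ≤ x N → 1 ≤ ‖x - e‖ →
      ε * ((x N - 1) * (‖x - e‖ ^ 2) ^ (-(β / 2))) ≤ w x := by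
  have hne : ∀ x : EuclideanSpace ℝ (Fin n), 1 ≤ ‖x - e‖ → x - e ≠ 0 := fun x hx =>
    norm_pos_iff.1 (zero_lt_one.trans_le hx)
  refine hw.exterior_comparison hcont hpos he
    (φ := fun z => (z N - 1) * (‖z - e‖ ^ 2) ^ (-(β / 2))) one_pos ?_ ?_ ?_ ?_ ?_
  · intro x hx; simp [hx]
  · intro x _ hx
    have := abs_le.1 (abs_coord_sub_le N x e)
    simp only [hx, one_pow, Real.one_rpow, mul_one]
    rw [he, hx] at this
    linarith
  · intro δ hδ
    have hlim : Tendsto (fun r : ℝ => r ^ (-(β - 1))) atTop (𝓝 0) :=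
      tendsto_rpow_neg_atTop (by linarith)
    obtain ⟨T, hT⟩ := eventually_atTop.1 (hlim.eventually (gt_mem_nhds hδ))
    refine ⟨max T 1, fun x _ hx => ?_⟩
    have hr : 0 < ‖x - e‖ := zero_lt_one.trans_le ((le_max_right _ _).trans hx)
    have h1 := (abs_le.1 (abs_coord_sub_le N x e)).2
    rw [he] at h1
    have h2 : (‖x - e‖ ^ 2) ^ (-(β / 2)) = ‖x - e‖ ^ (-β) := by
      rw [← Real.rpow_natCast, ← Real.rpow_mul hr.le]
      congr 1; push_cast; ring
    calc (x N - 1) * (‖x - e‖ ^ 2) ^ (-(β / 2)) ≤ ‖x - e‖ * ‖x - e‖ ^ (-β) := by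
          rw [h2]; exact mul_le_mul_of_nonneg_right h1 (by positivity)
      _ = ‖x - e‖ ^ (-(β - 1)) := by
          rw [mul_comm, ← Real.rpow_add_one hr.ne']; congr 1; ring
      _ ≤ δ := (hT _ ((le_max_left _ _).trans hx)).le
  · intro x hx
    obtain ⟨Q, hQ, -⟩ := exists_hessianForm_coord_mul_rpow (N := N) hβ (hne x hx)
    rw [he] at hQ
    exact hQ.1
  · intro ε _ _ x hx1 hx2
    obtain ⟨Q, hQ, hzero⟩ := exists_hessianForm_coord_mul_rpow (N := N) hβ (hne x hx2.le)
    rw [he] at hQ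
    have := (hQ.const_mul ε).radialOp_le hLam (hne x hx2.le)
    rw [radialOp_const_mul, hzero, mul_zero] at this
    linarith [hg x (zero_lt_one.trans hx1)]

/-- In the resonant case the homogeneous lower bound improves by a logarithm. -/
theorem PucciSupersol.exists_coord_mul_log_le {lam Lam β : ℝ} {n : ℕ} {N : Fin n}
    (hlam : 0 < lam) (hLam : lam ≤ Lam) (hβ : Lam * (β - 1) = lam * ((n : ℝ) - 1)) (hβ1 : 1 < β)
    {w g : EuclideanSpace ℝ (Fin n) → ℝ} (hw : PucciSupersol lam Lam {x | 0 < x N} w g)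
    {e : EuclideanSpace ℝ (Fin n)} (he : e N = 1) {c p : ℝ} (hc : 0 < c)
    (hp : 0 < p) (hcrit : p * (β - 1) = β + 1)
    (hg : ∀ x : EuclideanSpace ℝ (Fin n), 1 ≤ x N → 1 ≤ ‖x - e‖ →
      c * ((x N - 1) * (‖x - e‖ ^ 2) ^ (-(β / 2))) ^ p ≤ g x)
    (hcont : ContinuousOn w {x | 0 ≤ x N})
    (hpos : ∀ x : EuclideanSpace ℝ (Fin n), 0 < x N → 0 < w x) :
    ∃ ε > 0, ∀ x : EuclideanSpace ℝ (Fin n), 1 ≤ x N → 1 ≤ ‖x - e‖ →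
      ε * ((x N - 1) * (‖x - e‖ ^ 2) ^ (-(β / 2)) * Real.log (‖x - e‖ ^ 2)) ≤ w x := by
  have hL : 0 < Lam := hlam.trans_le hLam
  have hne : ∀ x : EuclideanSpace ℝ (Fin n), 1 ≤ ‖x - e‖ → x - e ≠ 0 := fun x hx =>
    norm_pos_iff.1 (zero_lt_one.trans_le hx)
  have hcoord : ∀ x : EuclideanSpace ℝ (Fin n), x N - 1 ≤ ‖x - e‖ := fun x => by
    have := (abs_le.1 (abs_coord_sub_le N x e)).2
    rwa [he] at this
  have hrpow : ∀ (r a : ℝ), 0 < r → (r ^ 2) ^ a = r ^ (2 * a) := fun r a hr => by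
    rw [← Real.rpow_natCast, ← Real.rpow_mul hr.le]
    norm_num
  set κ := Lam * (3 * β + 1) with hκ
  have hκ0 : 0 < κ := by positivity
  set s₀ := 2 * lam / κ with hs₀
  have hs₀0 : 0 < s₀ := by positivity
  set φ : EuclideanSpace ℝ (Fin n) → ℝ := fun z =>
    (z N - 1) * ((‖z - e‖ ^ 2) ^ (-(β / 2)) * Real.log (‖z - e‖ ^ 2))
      + (z N - 1) ^ 2 * (‖z - e‖ ^ 2) ^ (-((β + 1) / 2)) with hφdef
  have hform : ∀ x : EuclideanSpace ℝ (Fin n), 1 ≤ ‖x - e‖ → ∃ Q, HasHessianForm φ x Q ∧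
      -2 * Lam * β * (x N - 1) * (‖x - e‖ ^ 2) ^ (-(β / 2) - 1)
        + (2 * lam * (‖x - e‖ ^ 2) ^ (-((β + 1) / 2))
          - (β + 1) * Lam * (x N - 1) ^ 2 * (‖x - e‖ ^ 2) ^ (-((β + 1) / 2) - 1))
        ≤ radialOp lam Lam (x - e) Q := by
    intro x hx
    obtain ⟨Q, hQ, hQv⟩ := exists_hessianForm_coord_mul_log (N := N) hβ (hne x hx)
    obtain ⟨S, hS, hSv⟩ := exists_hessianForm_coord_sq_mul_rpow (N := N) hLam hβ (hne x hx)
    rw [he] at hQ hS hQv hSv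
    refine ⟨_, hQ.add hS, ?_⟩
    rw [radialOp_add, hQv]
    linarith
  suffices h : ∃ ε > 0, ∀ x : EuclideanSpace ℝ (Fin n), 1 ≤ x N → 1 ≤ ‖x - e‖ →
      ε * φ x ≤ w x by
    obtain ⟨ε, hε, hlow⟩ := h
    refine ⟨ε, hε, fun x hx1 hx2 => le_trans ?_ (hlow x hx1 hx2)⟩
    refine mul_le_mul_of_nonneg_left ?_ hε.le
    have : 0 ≤ (x N - 1) ^ 2 * (‖x - e‖ ^ 2) ^ (-((β + 1) / 2)) := by positivity
    simp only [hφdef]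
    linarith
  refine hw.exterior_comparison hcont hpos he (φ := φ)
    (ε₀ := c * s₀ ^ p / κ) (by positivity) ?_ ?_ ?_ ?_ ?_
  · intro x hx; simp [hφdef, hx]
  · intro x hx1 hx
    have := hcoord x
    rw [hx] at this
    simp only [hφdef, hx, one_pow, Real.one_rpow, Real.log_one, mul_zero, mul_one, zero_add]
    nlinarith
  · intro δ hδ
    set η := (β - 1) / 2 with hη
    have hη0 : 0 < η := by rw [hη]; linarith
    have hlim : Tendsto (fun r : ℝ => (2 / η + 1) * r ^ (-η)) atTop (𝓝 0) := by
      simpa using (tendsto_rpow_neg_atTop hη0).const_mul (2 / η + 1)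
    obtain ⟨T, hT⟩ := eventually_atTop.1 (hlim.eventually (gt_mem_nhds hδ))
    refine ⟨max T 1, fun x hx1 hx => ?_⟩
    have hr1 : 1 ≤ ‖x - e‖ := (le_max_right _ _).trans hx
    refine le_trans ?_ (hT _ ((le_max_left _ _).trans hx)).le
    have hx2 := hcoord x
    simp only [hφdef]
    set r := ‖x - e‖
    have hr : 0 < r := zero_lt_one.trans_le hr1
    have hlog : Real.log (r ^ 2) ≤ 2 / η * r ^ η := by
      rw [Real.log_pow]
      have := Real.log_le_rpow_div hr.le hη0
      push_cast
      calc 2 * Real.log r ≤ 2 * (r ^ η / η) := by linarith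
        _ = 2 / η * r ^ η := by ring
    rw [hrpow r _ hr, hrpow r _ hr]
    have e1 : r * (r ^ (2 * -(β / 2)) * (2 / η * r ^ η)) = 2 / η * r ^ (-η) := by
      have : r ^ (-η) = r * (r ^ (2 * -(β / 2)) * r ^ η) := by
        rw [← Real.rpow_add hr, mul_comm, ← Real.rpow_add_one hr.ne']
        congr 1; rw [hη]; ring
      rw [this]; ring
    have e2 : r ^ 2 * r ^ (2 * -((β + 1) / 2)) ≤ r ^ (-η) := by
      rw [← Real.rpow_natCast, ← Real.rpow_add hr]
      refine Real.rpow_le_rpow_of_exponent_le hr1 ?_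
      rw [hη]; push_cast; linarith
    have h0 : 0 ≤ x N - 1 := sub_nonneg.2 hx1
    calc (x N - 1) * (r ^ (2 * -(β / 2)) * Real.log (r ^ 2))
          + (x N - 1) ^ 2 * r ^ (2 * -((β + 1) / 2))
        ≤ r * (r ^ (2 * -(β / 2)) * (2 / η * r ^ η)) + r ^ 2 * r ^ (2 * -((β + 1) / 2)) := by
          have hl0 : 0 ≤ Real.log (r ^ 2) := Real.log_nonneg (one_le_pow₀ hr1)
          gcongr
      _ ≤ (2 / η + 1) * r ^ (-η) := by rw [e1]; linarith
  · intro x hx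
    obtain ⟨Q, hQ, -⟩ := hform x hx
    exact hQ.1
  · intro ε hε hεle x hx1 hx2
    obtain ⟨Q, hQ, hQv⟩ := hform x hx2.le
    have hop := (hQ.const_mul ε).radialOp_le hLam (hne x hx2.le)
    rw [radialOp_const_mul] at hop
    have hgx := hg x hx1.le hx2.le
    have hx3 := hcoord x
    set r := ‖x - e‖
    have hr : 0 < r := zero_lt_one.trans hx2
    set s := (x N - 1) / r with hs
    have hs0 : 0 < s := div_pos (by linarith) hr
    have hs1 : s ≤ 1 := (div_le_one hr).2 hx3
    have ha : x N - 1 = s * r := by rw [hs]; field_simp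
    rw [ha, hrpow r _ hr] at hgx
    rw [ha, hrpow r _ hr, hrpow r _ hr, hrpow r _ hr] at hQv
    set Y := r ^ (2 * -((β + 1) / 2)) with hY
    have hY0 : 0 < Y := Real.rpow_pos_of_pos hr _
    have e1 : r * r ^ (2 * (-(β / 2) - 1)) = Y := by
      rw [mul_comm, ← Real.rpow_add_one hr.ne', hY]; congr 1; ring
    have e2 : r ^ 2 * r ^ (2 * (-((β + 1) / 2) - 1)) = Y := by
      rw [← Real.rpow_natCast, ← Real.rpow_add hr, hY]; congr 1; push_cast; ring
    have e3 : (s * r * r ^ (2 * -(β / 2))) ^ p = s ^ p * Y := by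
      have : s * r * r ^ (2 * -(β / 2)) = s * r ^ (-(β - 1)) := by
        rw [mul_assoc, mul_comm r, ← Real.rpow_add_one hr.ne']; congr 2; ring
      rw [this, Real.mul_rpow hs0.le (by positivity), ← Real.rpow_mul hr.le, hY]
      congr 2; linear_combination -hcrit
    rw [e3] at hgx
    have hQv' : Y * (2 * lam - κ * s) ≤ radialOp lam Lam (x - e) Q := by
      refine le_trans ?_ hQv
      have h1 : -2 * Lam * β * (s * r) * r ^ (2 * (-(β / 2) - 1))
          + (2 * lam * Y - (β + 1) * Lam * (s * r) ^ 2 * r ^ (2 * (-((β + 1) / 2) - 1)))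
          = Y * (2 * lam - 2 * Lam * β * s - (β + 1) * Lam * s ^ 2) := by
        linear_combination (-2 * Lam * β * s) * e1 - ((β + 1) * Lam * s ^ 2) * e2
      rw [h1]
      refine mul_le_mul_of_nonneg_left ?_ hY0.le
      have : (β + 1) * Lam * s ^ 2 ≤ (β + 1) * Lam * s :=
        mul_le_mul_of_nonneg_left (by nlinarith) (by positivity)
      rw [hκ]; linarith
    have hfin : 0 < ε * (Y * (2 * lam - κ * s)) + c * (s ^ p * Y) := by
      have h2 : ε * (Y * (2 * lam - κ * s)) + c * (s ^ p * Y)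
          = Y * (ε * (2 * lam - κ * s) + c * s ^ p) := by ring
      rw [h2]
      refine mul_pos hY0 ?_
      have hsp : 0 < c * s ^ p := by positivity
      rcases lt_or_ge s s₀ with h | h
      · have : κ * s < 2 * lam := by
          have := (lt_div_iff₀ hκ0).1 h
          linarith
        have := mul_pos hε (sub_pos.2 this)
        linarith
      · have h3 : s₀ ^ p ≤ s ^ p := Real.rpow_le_rpow hs₀0.le h hp.le
        have h4 : ε * κ ≤ c * s₀ ^ p := (le_div_iff₀ hκ0).1 hεle
        have h5 : ε * κ * s ≤ ε * κ := mul_le_of_le_one_right (by positivity) hs1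
        have h6 : c * s₀ ^ p ≤ c * s ^ p := mul_le_mul_of_nonneg_left h3 hc.le
        nlinarith [mul_pos hε hlam]
    linarith [mul_le_mul_of_nonneg_left hQv' hε.le]

/-- Feeding each interior bound into the other equation bounds the infima over large balls. -/
theorem exists_system_bound {lam Lam β : ℝ} {n : ℕ} {N : Fin n} (hlam : 0 < lam)
    (hLam : lam ≤ Lam) (hβ : Lam * (β - 1) = lam * ((n : ℝ) - 1)) (hβ0 : 0 < β)
    {p q : ℝ} (hp : 0 < p) (hq : 0 < q) (hpq : 1 ≤ p * q)
    {u v : EuclideanSpace ℝ (Fin n) → ℝ}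
    (hu : ContinuousOn u {x | 0 ≤ x N}) (hv : ContinuousOn v {x | 0 ≤ x N})
    (hu0 : ∀ x : EuclideanSpace ℝ (Fin n), 0 ≤ x N → 0 ≤ u x)
    (hv0 : ∀ x : EuclideanSpace ℝ (Fin n), 0 ≤ x N → 0 ≤ v x)
    (hsu : PucciSupersol lam Lam {x | 0 < x N} u (fun x => v x ^ p))
    (hsv : PucciSupersol lam Lam {x | 0 < x N} v (fun x => u x ^ q)) :
    ∃ C > 0, ∀ (y : EuclideanSpace ℝ (Fin n)) (ρ l : ℝ), 0 < ρ → 3 * ρ ≤ y N → 0 < l →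
      (∀ x ∈ Metric.closedBall y (2 * ρ), l ≤ u x) →
      C * (ρ ^ (2 + 2 * p) * l ^ (p * q - 1)) ≤ 1 := by
  obtain ⟨c, hc, hgrow⟩ := PucciSupersol.exists_growth N hlam hLam hβ hβ0
  refine ⟨c ^ (1 + p), Real.rpow_pos_of_pos hc _, fun y ρ l hρ hy hl hlow => ?_⟩
  have hball := ball_subset_halfSpace hy
  have hcball := closedBall_subset_halfSpace hy
  have hsub : Metric.closedBall y (2 * ρ) ⊆ {x | 0 ≤ x N} :=
    (Metric.closedBall_subset_closedBall (by linarith)).trans hcball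
  obtain ⟨z, hz, hmin⟩ := (isCompact_closedBall y (2 * ρ)).exists_isMinOn
    ⟨y, Metric.mem_closedBall_self (by positivity)⟩ (hu.mono hsub)
  set k := u z with hk
  have hlk : l ≤ k := hlow z hz
  have hk0 : 0 < k := hl.trans_le hlk
  have hkq : 0 < k ^ q := Real.rpow_pos_of_pos hk0 _
  have hvlow := hgrow _ v _ hsv (fun x hx => Real.rpow_nonneg (hu0 x (le_of_lt hx)) _) y ρ (k ^ q)
    hρ hkq hball (hv.mono hcball) (fun x hx => hv0 x (hcball hx))
    (fun x hx => Real.rpow_le_rpow hk0.le (hmin hx) hq.le)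
  have hk2 : 0 < c * (ρ ^ 2 * k ^ q) := by positivity
  have hulow := hgrow _ u _ hsu (fun x hx => Real.rpow_nonneg (hv0 x (le_of_lt hx)) _) y ρ
    ((c * (ρ ^ 2 * k ^ q)) ^ p) hρ (Real.rpow_pos_of_pos hk2 _) hball (hu.mono hcball)
    (fun x hx => hu0 x (hcball hx))
    (fun x hx => Real.rpow_le_rpow hk2.le (hvlow x hx) hp.le) z hz
  have hexp : c * (ρ ^ 2 * (c * (ρ ^ 2 * k ^ q)) ^ p)
      = c ^ (1 + p) * (ρ ^ (2 + 2 * p) * k ^ (p * q - 1)) * k := by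
    rw [Real.mul_rpow hc.le (by positivity), Real.mul_rpow (by positivity) hkq.le,
      ← Real.rpow_mul hk0.le, mul_comm q p, ← Real.rpow_natCast ρ 2, ← Real.rpow_mul hρ.le,
      Real.rpow_add hc, Real.rpow_one, Real.rpow_add hρ, Real.rpow_sub_one hk0.ne']
    push_cast
    field_simp
  rw [hexp] at hulow
  have hle1 : c ^ (1 + p) * (ρ ^ (2 + 2 * p) * k ^ (p * q - 1)) ≤ 1 := by
    by_contra! h
    nlinarith
  refine le_trans ?_ hle1
  have := Real.rpow_le_rpow hl.le hlk (sub_nonneg.2 hpq)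
  gcongr

theorem no_positive_supersolutions {lam Lam β : ℝ} {n : ℕ} {N : Fin n} (hlam : 0 < lam)
    (hLam : lam ≤ Lam) (hβ : Lam * (β - 1) = lam * ((n : ℝ) - 1)) (hβ1 : 1 < β)
    {p q : ℝ} (hp : 0 < p) (hq : 0 < q) (hpq : 1 ≤ p * q)
    (hcrit : (β - 1) * (p * q - 1) < 2 * (p + 1) ∨
      (p = q ∧ (β - 1) * (p * q - 1) = 2 * (p + 1)))
    {u v : EuclideanSpace ℝ (Fin n) → ℝ}
    (hu : ContinuousOn u {x | 0 ≤ x N}) (hv : ContinuousOn v {x | 0 ≤ x N})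
    (hu0 : ∀ x : EuclideanSpace ℝ (Fin n), 0 ≤ x N → 0 ≤ u x)
    (hv0 : ∀ x : EuclideanSpace ℝ (Fin n), 0 ≤ x N → 0 ≤ v x)
    (hupos : ∀ x : EuclideanSpace ℝ (Fin n), 0 < x N → 0 < u x)
    (hvpos : ∀ x : EuclideanSpace ℝ (Fin n), 0 < x N → 0 < v x)
    (hsu : PucciSupersol lam Lam {x | 0 < x N} u (fun x => v x ^ p))
    (hsv : PucciSupersol lam Lam {x | 0 < x N} v (fun x => u x ^ q)) : False := by
  set e : EuclideanSpace ℝ (Fin n) := EuclideanSpace.single N 1 with hedef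
  have he : e N = 1 := by simp [hedef]
  have hnorm : ‖e‖ = 1 := by simp [hedef]
  obtain ⟨C, hC, hbound⟩ := exists_system_bound hlam hLam hβ (by linarith) hp hq hpq hu hv hu0 hv0
    hsu hsv
  have hy : ∀ ρ : ℝ, ((1 + 4 * ρ) • e) N = 1 + 4 * ρ := fun ρ => by simp [he]
  set b : ℝ := 2 * 36 ^ (-(β / 2)) with hb
  have hb0 : 0 < b := by positivity
  have hgeom : ∀ ρ : ℝ, 1 ≤ ρ → ∀ x ∈ Metric.closedBall ((1 + 4 * ρ) • e) (2 * ρ),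
      1 ≤ x N ∧ 1 ≤ ‖x - e‖ ∧ b * ρ ^ (1 - β) ≤ (x N - 1) * (‖x - e‖ ^ 2) ^ (-(β / 2)) ∧
        ρ ≤ ‖x - e‖ ^ 2 := by
    intro ρ hρ x hx
    have hρ0 : 0 < ρ := zero_lt_one.trans_le hρ
    rw [Metric.mem_closedBall, dist_eq_norm] at hx
    have h1 := (abs_le.1 ((abs_coord_sub_le N x _).trans hx)).1
    rw [hy] at h1
    have h2 := (abs_le.1 (abs_coord_sub_le N x e)).2
    rw [he] at h2
    have h3 : ‖x - e‖ ≤ 6 * ρ := by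
      have : x - e = (x - (1 + 4 * ρ) • e) + (4 * ρ) • e := by module
      rw [this]
      refine (norm_add_le _ _).trans ?_
      rw [norm_smul, hnorm, Real.norm_of_nonneg (by positivity)]
      linarith
    have hr : 0 < ‖x - e‖ := by linarith
    refine ⟨by linarith, by linarith, ?_, by nlinarith⟩
    have h4 : (36 * ρ ^ 2) ^ (-(β / 2)) ≤ (‖x - e‖ ^ 2) ^ (-(β / 2)) :=
      Real.rpow_le_rpow_of_nonpos (by positivity) (by nlinarith) (by linarith)
    have h5 : b * ρ ^ (1 - β) = 2 * ρ * (36 * ρ ^ 2) ^ (-(β / 2)) := by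
      rw [Real.mul_rpow (by norm_num) (by positivity), ← Real.rpow_natCast ρ 2,
        ← Real.rpow_mul hρ0.le, hb]
      have : ρ ^ (1 - β) = ρ * ρ ^ (((2 : ℕ) : ℝ) * -(β / 2)) := by
        rw [mul_comm, ← Real.rpow_add_one hρ0.ne']; congr 1; push_cast; ring
      rw [this]; ring
    rw [h5]
    exact mul_le_mul (by linarith) h4 (by positivity) (by linarith)
  obtain ⟨ε, hε, hulow⟩ := hsu.exists_coord_mul_rpow_le hLam hβ hβ1
    (fun x hx => Real.rpow_pos_of_pos (hvpos x hx) _) hu hupos he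
  rcases hcrit with hsubcrit | ⟨rfl, hcrit⟩
  · have hexp : 0 < (2 + 2 * p) + (1 - β) * (p * q - 1) := by linarith
    have hD : 0 < C * (ε * b) ^ (p * q - 1) := by positivity
    have hlim := (tendsto_rpow_atTop hexp).const_mul_atTop hD
    obtain ⟨ρ, hρ1, hρ⟩ := ((hlim.eventually_gt_atTop 1).and (eventually_ge_atTop 1)).exists
    have hρ0 : 0 < ρ := zero_lt_one.trans_le hρ
    have := hbound ((1 + 4 * ρ) • e) ρ (ε * b * ρ ^ (1 - β)) hρ0 (by rw [hy]; linarith)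
      (by positivity) (fun x hx => by
        obtain ⟨h1, h2, h3, -⟩ := hgeom ρ hρ x hx
        rw [mul_assoc]
        exact (mul_le_mul_of_nonneg_left h3 hε.le).trans (hulow x h1 h2))
    rw [Real.mul_rpow (by positivity) (by positivity), ← Real.rpow_mul hρ0.le] at this
    rw [Real.rpow_add hρ0] at hρ1
    linarith
  · obtain ⟨ε', hε', hvlow⟩ := hsv.exists_coord_mul_rpow_le hLam hβ hβ1
      (fun x hx => Real.rpow_pos_of_pos (hupos x hx) _) hv hvpos he
    have hm : 0 < p * p - 1 := by
      have : 0 < (β - 1) * (p * p - 1) := by rw [hcrit]; linarith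
      exact pos_of_mul_pos_right this (by linarith)
    have hcrit' : p * (β - 1) = β + 1 := by
      have h1 : (p + 1) * (p * (β - 1) - (β + 1)) = 0 := by linear_combination hcrit
      rcases mul_eq_zero.1 h1 with h | h
      · linarith
      · linarith
    obtain ⟨δ, hδ, hlog⟩ := hsu.exists_coord_mul_log_le hlam hLam hβ hβ1 he
      (c := ε' ^ p) (p := p) (by positivity) hp hcrit' (fun x hx1 hx2 => by
        have h0 : 0 ≤ (x N - 1) * (‖x - e‖ ^ 2) ^ (-(β / 2)) :=
          mul_nonneg (by linarith) (by positivity)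
        rw [← Real.mul_rpow hε'.le h0]
        exact Real.rpow_le_rpow (by positivity) (hvlow x hx1 hx2) hp.le) hu hupos
    have hD : 0 < C * (δ * b) ^ (p * p - 1) := by positivity
    have hlim := ((tendsto_rpow_atTop hm).comp Real.tendsto_log_atTop).const_mul_atTop hD
    obtain ⟨ρ, hρ1, hρ⟩ := ((hlim.eventually_gt_atTop 1).and (eventually_gt_atTop 1)).exists
    have hρ0 : 0 < ρ := zero_lt_one.trans hρ
    have hl0 : 0 < Real.log ρ := Real.log_pos hρ
    have := hbound ((1 + 4 * ρ) • e) ρ (δ * b * Real.log ρ * ρ ^ (1 - β)) hρ0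
      (by rw [hy]; linarith) (by positivity) (fun x hx => by
        obtain ⟨h1, h2, h3, h4⟩ := hgeom ρ hρ.le x hx
        have h5 : Real.log ρ ≤ Real.log (‖x - e‖ ^ 2) := Real.log_le_log hρ0 h4
        refine le_trans ?_ (hlog x h1 h2)
        calc δ * b * Real.log ρ * ρ ^ (1 - β) = δ * (b * ρ ^ (1 - β) * Real.log ρ) := by ring
          _ ≤ _ := mul_le_mul_of_nonneg_left
            (mul_le_mul h3 h5 hl0.le (le_trans (by positivity) h3)) hδ.le)
    rw [Real.mul_rpow (by positivity) (by positivity), ← Real.rpow_mul hρ0.le,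
      Real.mul_rpow (by positivity) hl0.le] at this
    have h6 : ρ ^ (2 + 2 * p) * ρ ^ ((1 - β) * (p * p - 1)) = 1 := by
      rw [← Real.rpow_add hρ0, show 2 + 2 * p + (1 - β) * (p * p - 1) = 0 by linarith,
        Real.rpow_zero]
    simp only [Function.comp] at hρ1
    have h7 : C * (ρ ^ (2 + 2 * p) * ((δ * b) ^ (p * p - 1) * Real.log ρ ^ (p * p - 1)
        * ρ ^ ((1 - β) * (p * p - 1))))
        = C * (δ * b) ^ (p * p - 1) * Real.log ρ ^ (p * p - 1) := by
      linear_combination (C * (δ * b) ^ (p * p - 1) * Real.log ρ ^ (p * p - 1)) * h6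
    linarith

/-- If one component vanishes in the half space, so does the source term of its equation. -/
theorem PucciSupersol.source_nonpos_of_eq_zero {lam Lam : ℝ} {n : ℕ} {N : Fin n}
    (hLam : lam ≤ Lam) {w g : EuclideanSpace ℝ (Fin n) → ℝ}
    (hw : PucciSupersol lam Lam {x | 0 < x N} w g)
    (hzero : ∀ x : EuclideanSpace ℝ (Fin n), 0 < x N → w x = 0) {x : EuclideanSpace ℝ (Fin n)}
    (hx : 0 < x N) : g x ≤ 0 := by
  have hloc : IsLocalMin (fun z => w z - (0 : ℝ)) x := by
    filter_upwards [(isOpen_halfSpace N 0).mem_nhds hx] with z hz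
    rw [hzero z hz, hzero x hx]
  have h1 := hw x hx (fun _ => 0) contDiff_const hloc
  have h2 := (hasHessianForm_const x 0).le_pucciMax hLam (EuclideanSpace.single N 1) (by simp)
  simp only [Finset.sum_const_zero, mul_zero, add_zero] at h2
  linarith

theorem eq_zero_of_eq_zero_halfSpace {n : ℕ} {N : Fin n} {w : EuclideanSpace ℝ (Fin n) → ℝ}
    (hcont : ContinuousOn w {x | 0 ≤ x N})
    (hzero : ∀ x : EuclideanSpace ℝ (Fin n), 0 < x N → w x = 0) {x : EuclideanSpace ℝ (Fin n)}
    (hx : 0 ≤ x N) : w x = 0 := by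
  set f : ℝ → EuclideanSpace ℝ (Fin n) := fun t => x + t • EuclideanSpace.single N 1 with hf
  have hfN : ∀ t, f t N = x N + t := fun t => by simp [hf]
  have hf0 : Tendsto f (𝓝[>] 0) (𝓝 x) := by
    have hc : Continuous f := by fun_prop
    have := hc.tendsto 0
    simp only [hf, zero_smul, add_zero] at this
    exact this.mono_left nhdsWithin_le_nhds
  have hfin : Tendsto f (𝓝[>] 0) (𝓝[{x | 0 ≤ x N}] x) := by
    refine tendsto_nhdsWithin_iff.2 ⟨hf0, ?_⟩
    filter_upwards [self_mem_nhdsWithin] with t ht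
    rw [hfN]
    exact add_nonneg hx (le_of_lt ht)
  have hlim : Tendsto (w ∘ f) (𝓝[>] 0) (𝓝 (w x)) := (hcont x hx).tendsto.comp hfin
  refine tendsto_nhds_unique hlim (tendsto_const_nhds.congr' ?_)
  filter_upwards [self_mem_nhdsWithin] with t ht
  exact (hzero _ (by rw [hfN]; exact add_pos_of_nonneg_of_pos hx ht)).symm

theorem PucciSupersol.eq_zero_of_subcritical {lam Lam β : ℝ} {n : ℕ} {N : Fin n} (hlam : 0 < lam)
    (hLam : lam ≤ Lam) (hβ : Lam * (β - 1) = lam * ((n : ℝ) - 1)) (hβ1 : 1 < β)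
    {p q : ℝ} (hp : 0 < p) (hq : 0 < q) (hpq : 1 ≤ p * q)
    (hcrit : (β - 1) * (p * q - 1) < 2 * (p + 1) ∨
      (p = q ∧ (β - 1) * (p * q - 1) = 2 * (p + 1)))
    {u v : EuclideanSpace ℝ (Fin n) → ℝ}
    (hu : ContinuousOn u {x | 0 ≤ x N}) (hv : ContinuousOn v {x | 0 ≤ x N})
    (hu0 : ∀ x : EuclideanSpace ℝ (Fin n), 0 ≤ x N → 0 ≤ u x)
    (hv0 : ∀ x : EuclideanSpace ℝ (Fin n), 0 ≤ x N → 0 ≤ v x)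
    (hsu : PucciSupersol lam Lam {x | 0 < x N} u (fun x => v x ^ p))
    (hsv : PucciSupersol lam Lam {x | 0 < x N} v (fun x => u x ^ q)) :
    ∀ x : EuclideanSpace ℝ (Fin n), 0 ≤ x N → u x = 0 ∧ v x = 0 := by
  have hzero : ∀ {r : ℝ} {w g : EuclideanSpace ℝ (Fin n) → ℝ},
      PucciSupersol lam Lam {x | 0 < x N} w (fun x => g x ^ r) →
      (∀ x : EuclideanSpace ℝ (Fin n), 0 ≤ x N → 0 ≤ g x) →
      (∀ x : EuclideanSpace ℝ (Fin n), 0 < x N → w x = 0) →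
      ∀ x : EuclideanSpace ℝ (Fin n), 0 < x N → g x = 0 := by
    intro r w g hw hg hw0 x hx
    by_contra hne
    have hgx : 0 < g x := lt_of_le_of_ne (hg x hx.le) (Ne.symm hne)
    exact absurd (hw.source_nonpos_of_eq_zero hLam hw0 hx) (Real.rpow_pos_of_pos hgx r).not_ge
  have hpos : ∀ {r : ℝ} {w g : EuclideanSpace ℝ (Fin n) → ℝ},
      PucciSupersol lam Lam {x | 0 < x N} w (fun x => g x ^ r) →
      (∀ x : EuclideanSpace ℝ (Fin n), 0 ≤ x N → 0 ≤ g x) →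
      ContinuousOn w {x | 0 ≤ x N} →
      (∀ x : EuclideanSpace ℝ (Fin n), 0 ≤ x N → 0 ≤ w x) →
      (¬ ∀ x : EuclideanSpace ℝ (Fin n), 0 < x N → w x = 0) →
      ∀ x : EuclideanSpace ℝ (Fin n), 0 < x N → 0 < w x := by
    intro r w g hw hg hwc hw0 hne
    push Not at hne
    obtain ⟨x₀, hx₀, hwx₀⟩ := hne
    exact hw.pos_of_exists_pos hlam hLam hβ (zero_lt_one.trans hβ1)
      (fun x hx => Real.rpow_nonneg (hg x hx.le) r) hwc hw0 hx₀
      (lt_of_le_of_ne (hw0 x₀ hx₀.le) hwx₀.symm)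
  have hboth : (∀ x : EuclideanSpace ℝ (Fin n), 0 < x N → u x = 0) ∧
      ∀ x : EuclideanSpace ℝ (Fin n), 0 < x N → v x = 0 := by
    by_cases hu' : ∀ x : EuclideanSpace ℝ (Fin n), 0 < x N → u x = 0
    · exact ⟨hu', hzero hsu hv0 hu'⟩
    by_cases hv' : ∀ x : EuclideanSpace ℝ (Fin n), 0 < x N → v x = 0
    · exact ⟨hzero hsv hu0 hv', hv'⟩
    exact (no_positive_supersolutions hlam hLam hβ hβ1 hp hq hpq hcrit hu hv hu0 hv0
      (hpos hsu hv0 hu hu0 hu') (hpos hsv hu0 hv hv0 hv') hsu hsv).elim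
  exact fun x hx => ⟨eq_zero_of_eq_zero_halfSpace hu hboth.1 hx,
    eq_zero_of_eq_zero_halfSpace hv hboth.2 hx⟩

end

theorem stmt9 (n : ℕ) (hn : 2 ≤ n) (lam Lam : ℝ) (hlam : 0 < lam) (hLam : lam ≤ Lam)
    (nt : ℝ) (hnt : nt = lam / Lam * ((n : ℝ) - 1) + 1) (hnt2 : 2 ≤ nt)
    (p q : ℝ) (hp : 0 < p) (hq : 0 < q)
    (hcrit :
      (1 < p * q ∧ (nt - 1 < 2 * (p + 1) / (p * q - 1) ∨ nt - 1 < 2 * (q + 1) / (p * q - 1))) ∨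
      (2 * (p + 1) / (p * q - 1) = nt - 1 ∧ 2 * (q + 1) / (p * q - 1) = nt - 1) ∨
      p * q = 1)
    (u v : EuclideanSpace ℝ (Fin n) → ℝ)
    (hu : ContinuousOn u {x | 0 ≤ x ⟨n - 1, by omega⟩})
    (hv : ContinuousOn v {x | 0 ≤ x ⟨n - 1, by omega⟩})
    (hunonneg : ∀ x : EuclideanSpace ℝ (Fin n), 0 ≤ x ⟨n - 1, by omega⟩ → 0 ≤ u x)
    (hvnonneg : ∀ x : EuclideanSpace ℝ (Fin n), 0 ≤ x ⟨n - 1, by omega⟩ → 0 ≤ v x)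
    (hsuperu : PucciSupersol lam Lam {x | 0 < x ⟨n - 1, by omega⟩} u (fun x => v x ^ p))
    (hsuperv : PucciSupersol lam Lam {x | 0 < x ⟨n - 1, by omega⟩} v (fun x => u x ^ q)) :
    ∀ x : EuclideanSpace ℝ (Fin n), 0 ≤ x ⟨n - 1, by omega⟩ → u x = 0 ∧ v x = 0 := by
  have hLam0 : 0 < Lam := hlam.trans_le hLam
  have hβ : Lam * (nt - 1) = lam * ((n : ℝ) - 1) := by rw [hnt]; field_simp; ring
  have hβ1 : 1 < nt := by linarith
  rcases hcrit with ⟨hpq, h | h⟩ | ⟨h1, h2⟩ | hpq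
  · rw [lt_div_iff₀ (sub_pos.2 hpq)] at h
    exact PucciSupersol.eq_zero_of_subcritical hlam hLam hβ hβ1 hp hq hpq.le (.inl h)
      hu hv hunonneg hvnonneg hsuperu hsuperv
  · rw [lt_div_iff₀ (sub_pos.2 hpq), mul_comm p q] at h
    rw [mul_comm] at hpq
    exact fun x hx => (PucciSupersol.eq_zero_of_subcritical hlam hLam hβ hβ1 hq hp hpq.le (.inl h)
      hv hu hvnonneg hunonneg hsuperv hsuperu x hx).symm
  · have hd : 0 < p * q - 1 := by
      refine (div_pos_iff_of_pos_left (a := 2 * (p + 1)) (by positivity)).1 ?_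
      rw [h1]; linarith
    rw [div_eq_iff hd.ne'] at h1 h2
    exact PucciSupersol.eq_zero_of_subcritical hlam hLam hβ hβ1 hp hq (by linarith)
      (.inr ⟨by linarith, h1.symm⟩) hu hv hunonneg hvnonneg hsuperu hsuperv
  · refine PucciSupersol.eq_zero_of_subcritical hlam hLam hβ hβ1 hp hq hpq.ge (.inl ?_)
      hu hv hunonneg hvnonneg hsuperu hsuperv
    rw [hpq, sub_self, mul_zero]
    positivity
end
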